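/- Let n ≥ 3. Then the 0-Schur algebra S_0(n,r) over an algebraically closed field k is τ-tilting finite if and only if it is representation-finite. -/

import Mathlib

open MulOpposite CategoryTheory CategoryTheory.Limits

noncomputable section

/-- A submodule `N ≤ M` is superfluous if `N ⊔ K = ⊤` implies `K = ⊤`. -/
def SuperfluousSubmodule {R M : Type} [Ring R] [AddCommGroup M] [Module R M]
    (N : Submodule R M) : Prop :=
  ∀ K : Submodule R M, N ⊔ K = ⊤ → K = ⊤

section TauTilting

variable (k : Type) [Field k]
variable (B : Type) [Ring B] [Algebra k B]

/-- A minimal projective presentation `P1 → P0 → M → 0` of a right `B`-module `M`. -/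
def IsMinimalProjPresentation (M P1 P0 : ModuleCat.{0} Bᵐᵒᵖ)
    (f : P1 →ₗ[Bᵐᵒᵖ] P0) (g : P0 →ₗ[Bᵐᵒᵖ] M) : Prop :=
  Module.Projective Bᵐᵒᵖ P1 ∧ Module.Projective Bᵐᵒᵖ P0 ∧
    Function.Surjective g ∧ LinearMap.range f = LinearMap.ker g ∧
    SuperfluousSubmodule (LinearMap.ker g) ∧ SuperfluousSubmodule (LinearMap.ker f)

/-- Left multiplication by `b` on the left `B`-module `Hom_B(P, B)` of a right module `P`. -/
def leftMulHom {P : Type} [AddCommGroup P] [Module Bᵐᵒᵖ P] (b : B)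
    (h : P →ₗ[Bᵐᵒᵖ] B) : P →ₗ[Bᵐᵒᵖ] B where
  toFun p := b * h p
  map_add' x y := by simp [mul_add]
  map_smul' r p := by
    simp only [map_smul, RingHom.id_apply]
    rw [MulOpposite.smul_eq_mul_unop, MulOpposite.smul_eq_mul_unop, mul_assoc]

/-- `M` is τ-rigid:  `Hom_B(M, τM) = 0`, where `τM = D(Tr M)` is computed from a minimal
projective presentation `P1 --f--> P0 → M → 0`, `Tr M = coker(Hom(P0,B) → Hom(P1,B))`, and
`D = Hom_k(-, k)`.  A right-module map `M → D(Tr M)` is encoded as an additive map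
`β : M →+ Hom_k(Hom_B(P1, B), k)` which is balanced (`β (m·b) = β m (b·-)`) and vanishes on
the image of `Hom(P0,B)`, i.e. descends to the cokernel `Tr M`. -/
def IsTauRigid (M : ModuleCat.{0} Bᵐᵒᵖ) : Prop :=
  ∀ (P1 P0 : ModuleCat.{0} Bᵐᵒᵖ) (f : P1 →ₗ[Bᵐᵒᵖ] P0) (g : P0 →ₗ[Bᵐᵒᵖ] M),
    IsMinimalProjPresentation B M P1 P0 f g →
    ∀ β : M →+ ((P1 →ₗ[Bᵐᵒᵖ] B) →ₗ[k] k),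
      (∀ (m : M) (b : B) (h : P1 →ₗ[Bᵐᵒᵖ] B),
        β (op b • m) h = β m (leftMulHom B b h)) →
      (∀ (m : M) (g0 : P0 →ₗ[Bᵐᵒᵖ] B), β m (g0.comp f) = 0) →
      β = 0

/-- A module is indecomposable if it is nonzero and admits no nontrivial direct sum
decomposition. -/
def IndecomposableMod (M : ModuleCat.{0} Bᵐᵒᵖ) : Prop :=
  Nontrivial M ∧ ∀ (L L' : ModuleCat.{0} Bᵐᵒᵖ),
    Nonempty (M ≃ₗ[Bᵐᵒᵖ] (L × L')) → Subsingleton L ∨ Subsingleton L'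

/-- A module is basic (multiplicity-free) if it has no repeated direct summand. -/
def IsBasicMod (M : ModuleCat.{0} Bᵐᵒᵖ) : Prop :=
  ∀ (L C : ModuleCat.{0} Bᵐᵒᵖ),
    Nonempty (M ≃ₗ[Bᵐᵒᵖ] (L × L × C)) → Subsingleton L

/-- `L` is an indecomposable direct summand of `M`. -/
def IsIndecSummand (L M : ModuleCat.{0} Bᵐᵒᵖ) : Prop :=
  IndecomposableMod B L ∧ ∃ L' : ModuleCat.{0} Bᵐᵒᵖ, Nonempty (M ≃ₗ[Bᵐᵒᵖ] (L × L'))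

/-- The rank of the Grothendieck group `K_0(B)` is `n`, i.e. there are exactly `n`
isomorphism classes of simple right `B`-modules. -/
def RankK0Is (n : ℕ) : Prop :=
  ∃ S : Fin n → ModuleCat.{0} Bᵐᵒᵖ,
    (∀ i, IsSimpleModule Bᵐᵒᵖ (S i)) ∧
    (∀ i j, i ≠ j → IsEmpty ((S i) ≃ₗ[Bᵐᵒᵖ] (S j))) ∧
    (∀ T : ModuleCat.{0} Bᵐᵒᵖ, IsSimpleModule Bᵐᵒᵖ T → ∃ i, Nonempty (T ≃ₗ[Bᵐᵒᵖ] S i))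

/-- The number of isomorphism classes of indecomposable direct summands of `M` is `n`. -/
def NumIndecSummandsIs (M : ModuleCat.{0} Bᵐᵒᵖ) (n : ℕ) : Prop :=
  ∃ N : Fin n → ModuleCat.{0} Bᵐᵒᵖ,
    (∀ i, IsIndecSummand B (N i) M) ∧
    (∀ i j, i ≠ j → IsEmpty ((N i) ≃ₗ[Bᵐᵒᵖ] (N j))) ∧
    (∀ L, IsIndecSummand B L M → ∃ i, Nonempty (L ≃ₗ[Bᵐᵒᵖ] N i))

/-- `M` is a τ-tilting module over `B`: it is a finitely generated τ-rigid module whose number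
of non-isomorphic indecomposable direct summands equals the rank of `K_0(B)`. -/
def IsTauTiltingMod (M : ModuleCat.{0} Bᵐᵒᵖ) : Prop :=
  Module.Finite Bᵐᵒᵖ M ∧ IsTauRigid k B M ∧
    ∃ n : ℕ, NumIndecSummandsIs B M n ∧ RankK0Is B n

end TauTilting

section Support

variable (k : Type) [Field k]
variable (A : Type) [Ring A] [Algebra k A]

/-- The quotient of `A` by the two-sided ideal `AeA` generated by `e`. -/
def IdemQuot (e : A) : Type := ((TwoSidedIdeal.span {e}).ringCon).Quotient

instance (e : A) : Ring (IdemQuot A e) :=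
  inferInstanceAs (Ring ((TwoSidedIdeal.span {e}).ringCon).Quotient)

/-- The quotient map `A → A/AeA`. -/
def IdemQuot.mk (e : A) : A →+* IdemQuot A e := RingCon.mk' _

instance (e : A) : Algebra k (IdemQuot A e) :=
  RingHom.toAlgebra' ((IdemQuot.mk A e).comp (algebraMap k A)) (by
    intro c x
    induction x using Quotient.ind with
    | _ a =>
      show (IdemQuot.mk A e) (algebraMap k A c) * (IdemQuot.mk A e) a
          = (IdemQuot.mk A e) a * (IdemQuot.mk A e) (algebraMap k A c)
      rw [← map_mul, ← map_mul, Algebra.commutes])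

/-- `M` is a support τ-tilting module over `A`: there is an idempotent `e ∈ A` such that `M` is
(the restriction of) a τ-tilting module over `A/AeA`. -/
def IsSupportTauTilting (M : ModuleCat.{0} Aᵐᵒᵖ) : Prop :=
  ∃ e : A, IsIdempotentElem e ∧
    ∃ N : ModuleCat.{0} (IdemQuot A e)ᵐᵒᵖ,
      IsTauTiltingMod k (IdemQuot A e) N ∧
      letI : Module Aᵐᵒᵖ N := Module.compHom N (RingHom.op (IdemQuot.mk A e))
      Nonempty (M ≃ₛₗ[RingHom.id Aᵐᵒᵖ] N)

/-- `A` is τ-tilting finite: it admits only finitely many basic support τ-tilting modules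
up to isomorphism. -/
def TauTiltingFinite : Prop :=
  ∃ (n : ℕ) (R : Fin n → ModuleCat.{0} Aᵐᵒᵖ),
    ∀ M : ModuleCat.{0} Aᵐᵒᵖ, IsSupportTauTilting k A M → IsBasicMod A M →
      ∃ i, Nonempty (M ≃ₗ[Aᵐᵒᵖ] R i)

/-- `A` is representation-finite: it has only finitely many isomorphism classes of finitely
generated indecomposable right modules. -/
def RepresentationFinite : Prop :=
  ∃ (n : ℕ) (R : Fin n → ModuleCat.{0} Aᵐᵒᵖ),
    ∀ M : ModuleCat.{0} Aᵐᵒᵖ, Module.Finite Aᵐᵒᵖ M → IndecomposableMod A M →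
      ∃ i, Nonempty (M ≃ₗ[Aᵐᵒᵖ] R i)

end Support

section Schur
variable (k : Type) [Field k]

/-- Generators `T_{s_1}, ..., T_{s_{r-1}}` of the 0-Hecke algebra of the symmetric group
`S_r`, indexed by `i` with `i + 2 ≤ r` (the adjacent transposition `(i+1, i+2)`). -/
def AGen (r : ℕ) : Type := {i : ℕ // i + 2 ≤ r}

/-- The defining relations of the type `A_{r-1}` 0-Hecke algebra: `T_i² = -T_i`, the braid
relations `T_i T_j T_i = T_j T_i T_j` for `|i - j| = 1`, and the commutation relations
`T_i T_j = T_j T_i` for `|i - j| ≥ 2`. -/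
inductive heckeARel (r : ℕ) : FreeAlgebra k (AGen r) → FreeAlgebra k (AGen r) → Prop
  | sq (i : AGen r) : heckeARel r (FreeAlgebra.ι k i * FreeAlgebra.ι k i) (- FreeAlgebra.ι k i)
  | braid (i j : AGen r) (h : i.1 + 1 = j.1 ∨ j.1 + 1 = i.1) :
      heckeARel r (FreeAlgebra.ι k i * FreeAlgebra.ι k j * FreeAlgebra.ι k i)
        (FreeAlgebra.ι k j * FreeAlgebra.ι k i * FreeAlgebra.ι k j)
  | comm (i j : AGen r) (h : i.1 + 2 ≤ j.1 ∨ j.1 + 2 ≤ i.1) :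
      heckeARel r (FreeAlgebra.ι k i * FreeAlgebra.ι k j)
        (FreeAlgebra.ι k j * FreeAlgebra.ι k i)

/-- The 0-Hecke algebra `H_0(S_r)` of the symmetric group of degree `r`. -/
def HeckeA (r : ℕ) : Type := RingQuot (heckeARel k r)

instance (r : ℕ) : Ring (HeckeA k r) := inferInstanceAs (Ring (RingQuot (heckeARel k r)))
instance (r : ℕ) : Algebra k (HeckeA k r) :=
  inferInstanceAs (Algebra k (RingQuot (heckeARel k r)))

/-- The generator `T_{s_{i+1}}` of `H_0(S_r)`. -/
def TGen (r : ℕ) (i : AGen r) : HeckeA k r :=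
  RingQuot.mkAlgHom k (heckeARel k r) (FreeAlgebra.ι k i)

/-- The adjacent transposition `s_{i+1} = (i+1, i+2)` in the symmetric group `S_r`. -/
def adjSwap (r : ℕ) (i : AGen r) : Equiv.Perm (Fin r) :=
  Equiv.swap ⟨i.1, by have := i.2; omega⟩ ⟨i.1 + 1, by have := i.2; omega⟩

/-- The number of inversions of a permutation, i.e. its Coxeter length. -/
def invCount {r : ℕ} (w : Equiv.Perm (Fin r)) : ℕ :=
  (Finset.univ.filter (fun p : Fin r × Fin r => p.1 < p.2 ∧ w p.2 < w p.1)).card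

/-- `T` is the standard basis `(T_w)_{w ∈ S_r}` of `H_0(S_r)`: it sends the identity to `1`,
adjacent transpositions to the generators, and satisfies `T_{w s} = T_w T_s` whenever
`ℓ(w s) = ℓ(w) + 1`. -/
def IsHeckeBasis (r : ℕ) (T : Equiv.Perm (Fin r) → HeckeA k r) : Prop :=
  T 1 = 1 ∧
  (∀ i : AGen r, T (adjSwap r i) = TGen k r i) ∧
  (∀ (w : Equiv.Perm (Fin r)) (i : AGen r),
    invCount (w * adjSwap r i) = invCount w + 1 →
    T (w * adjSwap r i) = T w * TGen k r i)

/-- The set `Ω(n,r)` of compositions of `r` with at most `n` parts. -/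
def Comp (n r : ℕ) : Type := {lam : Fin n → ℕ // ∑ i, lam i = r}

/-- The partial sum `λ_1 + ⋯ + λ_i`. -/
def psum {n : ℕ} (lam : Fin n → ℕ) (i : Fin n) : ℕ :=
  ∑ j ∈ Finset.univ.filter (fun j : Fin n => (j : ℕ) < (i : ℕ)), lam j

/-- The Young subgroup `S_λ = S_{λ_1} × ⋯ × S_{λ_n} ≤ S_r`, as the set of permutations
preserving each of the consecutive blocks of sizes `λ_1, ..., λ_n`. -/
def YoungFinset {n r : ℕ} (lam : Fin n → ℕ) : Finset (Equiv.Perm (Fin r)) :=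
  Finset.univ.filter (fun w => ∀ (x : Fin r) (i : Fin n),
    (psum lam i ≤ (x : ℕ) ∧ (x : ℕ) < psum lam i + lam i) →
    (psum lam i ≤ ((w x) : ℕ) ∧ ((w x) : ℕ) < psum lam i + lam i))

/-- The element `x_λ = ∑_{w ∈ S_λ} T_w` of `H_0(S_r)`. -/
def xElt {n r : ℕ} (T : Equiv.Perm (Fin r) → HeckeA k r) (lam : Comp n r) : HeckeA k r :=
  ∑ w ∈ YoungFinset lam.1, T w

/-- The right ideal `x_λ H_0(S_r)`, as a right submodule of `H_0(S_r)`. -/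
def xIdeal {n r : ℕ} (T : Equiv.Perm (Fin r) → HeckeA k r) (lam : Comp n r) :
    Submodule (HeckeA k r)ᵐᵒᵖ (HeckeA k r) :=
  Submodule.span (HeckeA k r)ᵐᵒᵖ {xElt k T lam}

/-- The right `H_0(S_r)`-module `⊕_{λ ∈ Ω(n,r)} x_λ H_0(S_r)`. -/
def SchurModule (n r : ℕ) (T : Equiv.Perm (Fin r) → HeckeA k r) : Type :=
  ∀ lam : Comp n r, (xIdeal k T lam : Type)

instance (n r : ℕ) (T : Equiv.Perm (Fin r) → HeckeA k r) : AddCommGroup (SchurModule k n r T) :=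
  inferInstanceAs (AddCommGroup (∀ lam : Comp n r, (xIdeal k T lam : Type)))
instance (n r : ℕ) (T : Equiv.Perm (Fin r) → HeckeA k r) :
    Module (HeckeA k r)ᵐᵒᵖ (SchurModule k n r T) :=
  inferInstanceAs (Module (HeckeA k r)ᵐᵒᵖ (∀ lam : Comp n r, (xIdeal k T lam : Type)))
instance (n r : ℕ) (T : Equiv.Perm (Fin r) → HeckeA k r) : Module k (SchurModule k n r T) :=
  inferInstanceAs (Module k (∀ lam : Comp n r, (xIdeal k T lam : Type)))
instance (n r : ℕ) (T : Equiv.Perm (Fin r) → HeckeA k r) :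
    SMulCommClass (HeckeA k r)ᵐᵒᵖ k (SchurModule k n r T) :=
  inferInstanceAs (SMulCommClass (HeckeA k r)ᵐᵒᵖ k (∀ lam : Comp n r, (xIdeal k T lam : Type)))
instance (n r : ℕ) (T : Equiv.Perm (Fin r) → HeckeA k r) :
    IsScalarTower k (HeckeA k r)ᵐᵒᵖ (SchurModule k n r T) :=
  inferInstanceAs (IsScalarTower k (HeckeA k r)ᵐᵒᵖ (∀ lam : Comp n r, (xIdeal k T lam : Type)))

/-- The 0-Schur algebra `S_0(n,r) = End_{H_0(S_r)}(⊕_{λ ∈ Ω(n,r)} x_λ H_0(S_r))`. -/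
def Schur0 (n r : ℕ) (T : Equiv.Perm (Fin r) → HeckeA k r) : Type :=
  Module.End (HeckeA k r)ᵐᵒᵖ (SchurModule k n r T)

instance (n r : ℕ) (T : Equiv.Perm (Fin r) → HeckeA k r) : Ring (Schur0 k n r T) :=
  inferInstanceAs (Ring (Module.End (HeckeA k r)ᵐᵒᵖ (SchurModule k n r T)))

instance (n r : ℕ) (T : Equiv.Perm (Fin r) → HeckeA k r) : Algebra k (Schur0 k n r T) :=
  inferInstanceAs (Algebra k (Module.End (HeckeA k r)ᵐᵒᵖ (SchurModule k n r T)))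

end Schur

/-- A finite-dimensional module over a `k`-algebra `R`. -/
structure FM (k R : Type) [Field k] [Ring R] [Algebra k R] where
  carrier : Type
  [acg : AddCommGroup carrier]
  [modR : Module R carrier]
  [modk : Module k carrier]
  [tower : IsScalarTower k R carrier]
  [fin : Module.Finite k carrier]

namespace FM

section Basics

variable {k R : Type} [Field k] [Ring R] [Algebra k R]

instance : CoeSort (FM k R) Type := ⟨FM.carrier⟩

attribute [instance] FM.acg FM.modR FM.modk FM.tower FM.fin

instance finite_hom (X Y : FM k R) : Module.Finite k (X →ₗ[R] Y) :=
  Module.Finite.of_injective (LinearMap.restrictScalarsₗ k R X Y k)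
    (LinearMap.restrictScalars_injective k)

instance finite_sub (X : FM k R) (K : Submodule R X) : Module.Finite k K :=
  inferInstanceAs (Module.Finite k (K.restrictScalars k))

instance finite_quo (X : FM k R) (K : Submodule R X) : Module.Finite k (X ⧸ K) :=
  Module.Finite.of_surjective ((K.mkQ).restrictScalars k) K.mkQ_surjective

/-- Submodules as finite-dimensional modules. -/
abbrev sub (X : FM k R) (K : Submodule R X) : FM k R := ⟨K⟩

/-- Quotients as finite-dimensional modules. -/
abbrev quo (X : FM k R) (K : Submodule R X) : FM k R := ⟨X ⧸ K⟩

/-- Binary products. -/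
abbrev prod (X Y : FM k R) : FM k R := ⟨X × Y⟩

/-- The zero module. -/
abbrev zero : FM k R := ⟨PUnit⟩

/-- Finite powers. -/
abbrev pow (X : FM k R) (n : ℕ) : FM k R := ⟨Fin n → X⟩

/-- Dimension of the space of homomorphisms. -/
def hd (X Y : FM k R) : ℕ := Module.finrank k (X →ₗ[R] Y)

/-- Dimension. -/
def dim (X : FM k R) : ℕ := Module.finrank k X

theorem dim_le_of_injective {X Y : FM k R} (f : X →ₗ[R] Y) (hf : Function.Injective f) :
    dim X ≤ dim Y :=
  LinearMap.finrank_le_finrank_of_injective (f := f.restrictScalars k) hf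

theorem dim_le_of_surjective {X Y : FM k R} (f : X →ₗ[R] Y) (hf : Function.Surjective f) :
    dim Y ≤ dim X :=
  LinearMap.finrank_le_finrank_of_surjective (f := f.restrictScalars k) hf

theorem bijective_of_surjective_of_dim_le {X Y : FM k R} (f : X →ₗ[R] Y)
    (hf : Function.Surjective f) (h : dim X ≤ dim Y) : Function.Bijective f :=
  ⟨(LinearMap.injective_iff_surjective_of_finrank_eq_finrank (f := f.restrictScalars k)
    (le_antisymm h (dim_le_of_surjective f hf))).2 hf, hf⟩

theorem bijective_of_injective_of_dim_le {X Y : FM k R} (f : X →ₗ[R] Y)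
    (hf : Function.Injective f) (h : dim Y ≤ dim X) : Function.Bijective f :=
  ⟨hf, (LinearMap.injective_iff_surjective_of_finrank_eq_finrank (f := f.restrictScalars k)
    (le_antisymm (dim_le_of_injective f hf) h)).1 hf⟩

theorem surjective_iff_injective {X : FM k R} (f : X →ₗ[R] X) :
    Function.Surjective f ↔ Function.Injective f :=
  ⟨fun h => (bijective_of_surjective_of_dim_le f h le_rfl).1,
    fun h => (bijective_of_injective_of_dim_le f h le_rfl).2⟩

theorem dim_sub_add_dim_quo (X : FM k R) (K : Submodule R X) :
    dim (X.sub K) + dim (X.quo K) = dim X := by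
  have := Submodule.finrank_quotient_add_finrank (K.restrictScalars k)
  rw [add_comm]
  exact this

theorem dim_sub_lt {X : FM k R} {K L : Submodule R X} (h : K < L) :
    dim (X.sub K) < dim (X.sub L) :=
  Submodule.finrank_lt_finrank_of_lt
    (s := K.restrictScalars k) (t := L.restrictScalars k) (by exact h)

theorem dim_quo_lt {X : FM k R} {K : Submodule R X} (h : K ≠ ⊥) :
    dim (X.quo K) < dim X := by
  have h1 := dim_sub_add_dim_quo X K
  have h2 : 0 < dim (X.sub K) := by
    have : Nontrivial K := Submodule.nontrivial_iff_ne_bot.2 h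
    exact Module.finrank_pos (R := k) (M := K)
  omega

theorem dim_pos_iff {X : FM k R} : 0 < dim X ↔ Nontrivial X :=
  Module.finrank_pos_iff

/-- A module is indecomposable if it is nonzero and has no nontrivial complementary submodules. -/
def Indec (X : FM k R) : Prop :=
  Nontrivial X ∧ ∀ K L : Submodule R X, IsCompl K L → K = ⊥ ∨ L = ⊥

/-- Isomorphism. -/
def Iso (X Y : FM k R) : Prop := Nonempty (X ≃ₗ[R] Y)

theorem Iso.refl (X : FM k R) : Iso X X := ⟨.refl _ _⟩
theorem Iso.symm {X Y : FM k R} (h : Iso X Y) : Iso Y X := h.map .symm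
theorem Iso.trans {X Y Z : FM k R} (h : Iso X Y) (h' : Iso Y Z) : Iso X Z :=
  ⟨h.some.trans h'.some⟩
theorem Iso.prod {X Y X' Y' : FM k R} (h : Iso X X') (h' : Iso Y Y') :
    Iso (X.prod Y) (X'.prod Y') := ⟨h.some.prodCongr h'.some⟩

theorem Iso.of_bijective {X Y : FM k R} {f : X →ₗ[R] Y} (h : Function.Bijective f) : Iso X Y :=
  ⟨.ofBijective f h⟩

theorem Indec.of_iso {X Y : FM k R} (h : Indec X) (e : Iso X Y) : Indec Y := by
  obtain ⟨e⟩ := e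
  have := h.1
  refine ⟨e.symm.toEquiv.nontrivial, fun K L hKL => ?_⟩
  have hm : ∀ M : Submodule R Y, M.comap e.toLinearMap = ⊥ → M = ⊥ := fun M hM => by
    rw [eq_bot_iff] at hM ⊢
    intro y hy
    have : e.symm y ∈ M.comap e.toLinearMap := by simpa using hy
    simpa using hM this
  refine (h.2 (K.comap e.toLinearMap) (L.comap e.toLinearMap) ?_).imp (hm _) (hm _)
  exact (Submodule.orderIsoMapComap e).symm.isCompl hKL

theorem exists_fitting {X : FM k R} (f : X →ₗ[R] X) :
    ∃ n : ℕ, 1 ≤ n ∧ IsCompl (LinearMap.ker (f ^ n)) (LinearMap.range (f ^ n)) := by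
  have : IsArtinian R X := isArtinian_of_tower k inferInstance
  have : IsNoetherian R X := isNoetherian_of_tower k inferInstance
  obtain ⟨n, h1, h2⟩ := ((LinearMap.eventually_isCompl_ker_pow_range_pow f).and
    (Filter.eventually_ge_atTop 1)).exists
  exact ⟨n, h2, h1⟩

theorem Indec.bijective_or_nilpotent {X : FM k R} (h : Indec X) (f : X →ₗ[R] X) :
    Function.Bijective f ∨ ∃ n : ℕ, f ^ n = 0 := by
  obtain ⟨n, h0, hn⟩ := exists_fitting f
  rcases h.2 _ _ hn with h1 | h1
  · left
    have hinj : Function.Injective (f ^ n) := LinearMap.ker_eq_bot.1 h1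
    obtain ⟨n, rfl⟩ := Nat.exists_eq_succ_of_ne_zero (by omega : n ≠ 0)
    rw [pow_succ] at hinj
    have : Function.Injective f := Function.Injective.of_comp (f := ⇑(f ^ n)) hinj
    exact ⟨this, (surjective_iff_injective f).2 this⟩
  · exact .inr ⟨n, LinearMap.range_eq_bot.1 h1⟩

theorem Indec.bijective_of_add {X : FM k R} (h : Indec X) (f g : X →ₗ[R] X)
    (hfg : Function.Bijective (f + g)) : Function.Bijective f ∨ Function.Bijective g := by
  let e := LinearEquiv.ofBijective (f + g) hfg
  have he : ∀ x, e.symm (f x) + e.symm (g x) = x := fun x => by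
    rw [← map_add]; exact e.symm_apply_apply x
  let f' : X →ₗ[R] X := e.symm.toLinearMap ∘ₗ f
  rcases h.bijective_or_nilpotent f' with hb | ⟨n, hn⟩
  · left
    have : Function.Injective f := Function.Injective.of_comp (f := ⇑e.symm) hb.1
    exact ⟨this, (surjective_iff_injective f).2 this⟩
  · right
    have hinj : Function.Injective g := by
      rw [injective_iff_map_eq_zero]
      intro x hx
      have h1 : f' x = x := by
        have := he x
        rw [hx, map_zero, add_zero] at this
        exact this
      have h2 : ∀ m : ℕ, (f' ^ m) x = x := fun m => by
        induction m with
        | zero => rfl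
        | succ m ih => rw [pow_succ, Module.End.mul_apply, h1, ih]
      rw [← h2 n, hn]; rfl
    exact ⟨hinj, (surjective_iff_injective g).2 hinj⟩

/-- A split monomorphism between indecomposables is an isomorphism. -/
theorem Indec.bijective_of_comp {X Y : FM k R} (hX : Nontrivial X) (hY : Indec Y)
    (f : X →ₗ[R] Y) (g : Y →ₗ[R] X) (h : Function.Bijective (g ∘ₗ f)) :
    Function.Bijective f := by
  have hf : Function.Injective f := Function.Injective.of_comp (f := ⇑g) h.1
  refine ⟨hf, ?_⟩
  have hc : IsCompl (LinearMap.range f) (LinearMap.ker g) := by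
    rw [isCompl_iff, disjoint_iff, codisjoint_iff]
    constructor
    · rw [eq_bot_iff]
      rintro _ ⟨⟨x, rfl⟩, hx⟩
      have : x = 0 := h.1 (by rw [map_zero]; exact hx)
      simp [this]
    · rw [eq_top_iff]
      intro y _
      obtain ⟨x, hx⟩ := h.2 (g y)
      rw [← add_sub_cancel (f x) y]
      refine Submodule.add_mem_sup ⟨x, rfl⟩ ?_
      rw [LinearMap.mem_ker, map_sub, sub_eq_zero]
      exact hx.symm
  rcases hY.2 _ _ hc with h1 | h1
  · exfalso
    obtain ⟨x, hx⟩ := exists_ne (0 : X)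
    apply hx
    apply hf
    rw [LinearMap.range_eq_bot.1 h1]; rfl
  · rw [h1] at hc
    rw [← LinearMap.range_eq_top]
    simpa using hc.sup_eq_top

theorem Indec.bijective_of_comp' {X Y : FM k R} (hX : Indec X) (hY : Indec Y)
    (f : X →ₗ[R] Y) (g : Y →ₗ[R] X) (h : Function.Bijective (f ∘ₗ g)) :
    Function.Bijective f := by
  have hg := Indec.bijective_of_comp hY.1 hX g f h
  exact (Function.Bijective.of_comp_iff f hg).1 h

theorem Indec.exists_scalar [IsAlgClosed k] {X : FM k R} (h : Indec X) (f : X →ₗ[R] X) :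
    ∃ c : k, ¬ Function.Bijective (f - c • (LinearMap.id : X →ₗ[R] X)) := by
  have := h.1
  obtain ⟨c, hc⟩ := Module.End.exists_eigenvalue (K := k) (V := X) (f.restrictScalars k)
  obtain ⟨v, hv⟩ := hc.exists_hasEigenvector
  refine ⟨c, fun hb => hv.2 (hb.1 ?_)⟩
  rw [map_zero]
  have := hv.apply_eq_smul
  simp only [LinearMap.sub_apply, LinearMap.smul_apply, LinearMap.id_apply, sub_eq_zero]
  exact this

theorem indec_of_iff_prod {X : FM k R} (h0 : Nontrivial X)
    (h : ∀ L L' : FM k R, Iso X (L.prod L') → Subsingleton L ∨ Subsingleton L') : Indec X := by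
  refine ⟨h0, fun K L hKL => ?_⟩
  have := h (X.sub K) (X.sub L) ⟨(Submodule.prodEquivOfIsCompl K L hKL).symm⟩
  exact this.imp (fun h => (Submodule.subsingleton_iff_eq_bot).1 h)
    (fun h => (Submodule.subsingleton_iff_eq_bot).1 h)

theorem Indec.prod_cases {X L L' : FM k R} (h : Indec X) (e : Iso X (L.prod L')) :
    Subsingleton L ∨ Subsingleton L' := by
  have h1 := h.of_iso e
  rcases h1.2 _ _ (LinearMap.isCompl_range_inl_inr (R := R) (M := L) (M₂ := L')) with h2 | h2
  · left
    refine ⟨fun a b => ?_⟩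
    have := LinearMap.range_eq_bot.1 h2
    have ha := LinearMap.congr_fun this a
    have hb := LinearMap.congr_fun this b
    have := ha.trans hb.symm
    exact (Prod.ext_iff.1 this).1
  · right
    refine ⟨fun a b => ?_⟩
    have := LinearMap.range_eq_bot.1 h2
    have ha := LinearMap.congr_fun this a
    have hb := LinearMap.congr_fun this b
    have := ha.trans hb.symm
    exact (Prod.ext_iff.1 this).2

end Basics
end FM

namespace FM

section Mult

variable {k R : Type} [Field k] [Ring R] [Algebra k R]

/-- The radical homomorphisms out of an indecomposable module. -/
def rad (L : FM k R) (hL : Indec L) (X : FM k R) : Submodule k (L →ₗ[R] X) where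
  carrier := {f | ∀ g : X →ₗ[R] L, ¬ Function.Bijective (g ∘ₗ f)}
  add_mem' {a b} ha hb g hg := by
    rw [LinearMap.comp_add] at hg
    exact (hL.bijective_of_add _ _ hg).elim (ha g) (hb g)
  zero_mem' g hg := by
    obtain ⟨x, hx⟩ := @exists_ne _ hL.1 (0 : L)
    exact hx (hg.1 (by simp))
  smul_mem' c f hf g hg := by
    refine hf (c • g) ?_
    convert hg using 1
    ext x
    simp

/-- The multiplicity of an indecomposable module as a direct summand. -/
def mult (L : FM k R) (hL : Indec L) (X : FM k R) : ℕ :=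
  Module.finrank k ((L →ₗ[R] X) ⧸ rad L hL X)

theorem mem_rad {L : FM k R} {hL : Indec L} {X : FM k R} {f : L →ₗ[R] X} :
    f ∈ rad L hL X ↔ ∀ g : X →ₗ[R] L, ¬ Function.Bijective (g ∘ₗ f) := Iff.rfl

/-- Postcomposition as a `k`-linear map. -/
def post (L : FM k R) {X Y : FM k R} (g : X →ₗ[R] Y) : (L →ₗ[R] X) →ₗ[k] (L →ₗ[R] Y) where
  toFun f := g ∘ₗ f
  map_add' a b := LinearMap.comp_add _ _ _
  map_smul' c f := by ext x; exact g.map_smul_of_tower c (f x)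

/-- Precomposition as a `k`-linear map. -/
def pre {L X : FM k R} (f : L →ₗ[R] X) (Y : FM k R) : (X →ₗ[R] Y) →ₗ[k] (L →ₗ[R] Y) where
  toFun g := g ∘ₗ f
  map_add' a b := LinearMap.add_comp _ _ _
  map_smul' c f := by ext x; simp

theorem mult_eq_of_iso (L : FM k R) (hL : Indec L) {X Y : FM k R} (e : Iso X Y) :
    mult L hL X = mult L hL Y := by
  obtain ⟨e⟩ := e
  let Φ : (L →ₗ[R] X) →ₗ[k] ((L →ₗ[R] Y) ⧸ rad L hL Y) :=
    (rad L hL Y).mkQ ∘ₗ post L e.toLinearMap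
  have hs : Function.Surjective Φ := by
    refine (Submodule.mkQ_surjective _).comp fun f => ⟨e.symm.toLinearMap ∘ₗ f, ?_⟩
    ext x; simp [post]
  have hk : LinearMap.ker Φ = rad L hL X := by
    ext f
    rw [LinearMap.mem_ker, LinearMap.comp_apply, Submodule.mkQ_apply,
      Submodule.Quotient.mk_eq_zero, mem_rad, mem_rad]
    constructor
    · intro h g
      convert h (g ∘ₗ e.symm.toLinearMap) using 2
      ext x; simp [post]
    · intro h g
      exact h (g ∘ₗ e.toLinearMap)
  rw [mult, ← hk]
  exact (Φ.quotKerEquivOfSurjective hs).finrank_eq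

theorem mult_prod (L : FM k R) (hL : Indec L) (X Y : FM k R) :
    mult L hL (X.prod Y) = mult L hL X + mult L hL Y := by
  let Φ : (L →ₗ[R] X.prod Y) →ₗ[k]
      (((L →ₗ[R] X) ⧸ rad L hL X) × ((L →ₗ[R] Y) ⧸ rad L hL Y)) :=
    ((rad L hL X).mkQ ∘ₗ post L (X := X.prod Y) (LinearMap.fst R X Y)).prod
      ((rad L hL Y).mkQ ∘ₗ post L (X := X.prod Y) (LinearMap.snd R X Y))
  have hs : Function.Surjective Φ := by
    rintro ⟨a, b⟩
    obtain ⟨a, rfl⟩ := Submodule.mkQ_surjective _ a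
    obtain ⟨b, rfl⟩ := Submodule.mkQ_surjective _ b
    exact ⟨a.prod b, rfl⟩
  have hk : LinearMap.ker Φ = rad L hL (X.prod Y) := by
    ext f
    rw [LinearMap.ker_prod, Submodule.mem_inf, LinearMap.mem_ker, LinearMap.mem_ker,
      LinearMap.comp_apply, LinearMap.comp_apply, Submodule.mkQ_apply, Submodule.mkQ_apply,
      Submodule.Quotient.mk_eq_zero, Submodule.Quotient.mk_eq_zero, mem_rad, mem_rad, mem_rad]
    constructor
    · rintro ⟨h1, h2⟩ g hg
      have : g ∘ₗ f = (g ∘ₗ LinearMap.inl R X Y) ∘ₗ (LinearMap.fst R X Y ∘ₗ f)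
          + (g ∘ₗ LinearMap.inr R X Y) ∘ₗ (LinearMap.snd R X Y ∘ₗ f) := by
        ext x
        simp only [LinearMap.comp_apply, LinearMap.add_apply, ← map_add]
        congr 1
        simp
      rw [this] at hg
      exact (hL.bijective_of_add _ _ hg).elim (h1 _) (h2 _)
    · intro h
      exact ⟨fun g => h (g ∘ₗ LinearMap.fst R X Y), fun g => h (g ∘ₗ LinearMap.snd R X Y)⟩
  rw [mult, ← hk, (Φ.quotKerEquivOfSurjective hs).finrank_eq, Module.finrank_prod]
  rfl

theorem mult_eq_zero_of_rad {L : FM k R} (hL : Indec L) {X : FM k R} (h : rad L hL X = ⊤) :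
    mult L hL X = 0 := by
  rw [mult, h]
  have : Subsingleton ((L →ₗ[R] X) ⧸ (⊤ : Submodule k (L →ₗ[R] X))) :=
    Submodule.Quotient.subsingleton_iff.2 rfl
  exact Module.finrank_zero_of_subsingleton

theorem mult_of_subsingleton {L : FM k R} (hL : Indec L) {X : FM k R} (h : Subsingleton X) :
    mult L hL X = 0 := by
  refine mult_eq_zero_of_rad hL (eq_top_iff.2 fun f _ g hg => ?_)
  obtain ⟨x, hx⟩ := @exists_ne _ hL.1 (0 : L)
  refine hx (hg.1 ?_)
  rw [LinearMap.comp_apply, Subsingleton.elim (f x) 0, map_zero, map_zero]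

theorem mult_of_not_iso {L X : FM k R} (hL : Indec L) (hX : Indec X) (h : ¬ Iso L X) :
    mult L hL X = 0 := by
  refine mult_eq_zero_of_rad hL (eq_top_iff.2 fun f _ g hg => ?_)
  exact h (Iso.of_bijective (Indec.bijective_of_comp hL.1 hX f g hg))

theorem mult_self [IsAlgClosed k] {L : FM k R} (hL : Indec L) : mult L hL L = 1 := by
  refine finrank_eq_one ((rad L hL L).mkQ LinearMap.id) ?_ ?_
  · rw [Submodule.mkQ_apply, Ne, Submodule.Quotient.mk_eq_zero]
    intro h
    exact h LinearMap.id Function.bijective_id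
  · intro w
    obtain ⟨f, rfl⟩ := Submodule.mkQ_surjective _ w
    obtain ⟨c, hc⟩ := hL.exists_scalar f
    refine ⟨c, ?_⟩
    rw [← map_smul, ← sub_eq_zero, ← map_sub, Submodule.mkQ_apply,
      Submodule.Quotient.mk_eq_zero]
    intro g hg
    apply hc
    have h1 := Indec.bijective_of_comp hL.1 hL _ g hg
    have h2 : f - c • (LinearMap.id : L →ₗ[R] L) = -(c • (LinearMap.id : L →ₗ[R] L) - f) := by
      rw [neg_sub]
    rw [h2]
    exact (Equiv.neg (L : Type)).bijective.comp h1

theorem mult_of_iso [IsAlgClosed k] {L X : FM k R} (hL : Indec L) (h : Iso L X) :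
    mult L hL X = 1 := by
  rw [← mult_eq_of_iso L hL h, mult_self]

/-- The product of a list of modules from a family. -/
def lprod {ι : Type*} (U : ι → FM k R) : List ι → FM k R
  | [] => zero
  | i :: l => (U i).prod (lprod U l)

variable {ι : Type*} (U : ι → FM k R)

theorem lprod_cons (i : ι) (l : List ι) : lprod U (i :: l) = (U i).prod (lprod U l) := rfl

theorem prod_zero_iso (X : FM k R) : Iso (X.prod zero) X := ⟨LinearEquiv.prodUnique⟩
theorem zero_prod_iso (X : FM k R) : Iso (zero.prod X) X := ⟨LinearEquiv.uniqueProd⟩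
theorem prod_assoc_iso (X Y Z : FM k R) : Iso ((X.prod Y).prod Z) (X.prod (Y.prod Z)) :=
  ⟨LinearEquiv.prodAssoc R X Y Z⟩
theorem prod_comm_iso (X Y : FM k R) : Iso (X.prod Y) (Y.prod X) :=
  ⟨LinearEquiv.prodComm R X Y⟩
theorem iso_of_subsingleton {X Y : FM k R} (hX : Subsingleton X) (hY : Subsingleton Y) :
    Iso X Y := Iso.of_bijective (f := 0)
  ⟨fun _ _ _ => Subsingleton.elim _ _, fun _ => ⟨0, Subsingleton.elim _ _⟩⟩

theorem lprod_append (l l' : List ι) :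
    Iso (lprod U (l ++ l')) ((lprod U l).prod (lprod U l')) := by
  induction l with
  | nil => exact (zero_prod_iso _).symm
  | cons i l ih =>
    exact ((Iso.refl _).prod ih).trans (prod_assoc_iso _ _ _).symm

theorem lprod_perm {l l' : List ι} (h : l.Perm l') : Iso (lprod U l) (lprod U l') := by
  induction h with
  | nil => exact .refl _
  | cons x _ ih => exact (Iso.refl _).prod ih
  | swap x y l =>
    exact (prod_assoc_iso _ _ _).symm.trans
      (((prod_comm_iso _ _).prod (.refl _)).trans (prod_assoc_iso _ _ _))
  | trans _ _ h1 h2 => exact h1.trans h2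

variable {U}

theorem mult_lprod_eq_zero {L : FM k R} (hL : Indec L) (hU : ∀ i, Indec (U i)) (l : List ι)
    (h : ∀ i ∈ l, ¬ Iso L (U i)) : mult L hL (lprod U l) = 0 := by
  induction l with
  | nil => exact mult_of_subsingleton hL (inferInstanceAs (Subsingleton PUnit))
  | cons i l ih =>
    rw [lprod_cons, mult_prod, ih fun j hj => h j (List.mem_cons_of_mem _ hj),
      mult_of_not_iso hL (hU i) (h i List.mem_cons_self)]

theorem mult_lprod [IsAlgClosed k] [DecidableEq ι] (hU : ∀ i, Indec (U i))
    (hne : ∀ i j, i ≠ j → ¬ Iso (U i) (U j)) {L : FM k R} (hL : Indec L) (i : ι)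
    (hi : Iso L (U i)) (l : List ι) :
    mult L hL (lprod U l) = l.count i := by
  induction l with
  | nil => exact mult_of_subsingleton hL (inferInstanceAs (Subsingleton PUnit))
  | cons j l ih =>
    rw [lprod_cons, mult_prod, ih, List.count_cons]
    by_cases h : j = i
    · subst h
      rw [mult_of_iso hL hi]; simp [add_comm]
    · rw [mult_of_not_iso hL (hU j) fun h' => hne i j (Ne.symm h) (hi.symm.trans h')]
      simp [h]

theorem count_eq_of_iso [IsAlgClosed k] [DecidableEq ι] (hU : ∀ i, Indec (U i))
    (hne : ∀ i j, i ≠ j → ¬ Iso (U i) (U j)) {l l' : List ι}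
    (h : Iso (lprod U l) (lprod U l')) (i : ι) : l.count i = l'.count i := by
  rw [← mult_lprod hU hne (hU i) i (.refl _), ← mult_lprod hU hne (hU i) i (.refl _),
    mult_eq_of_iso _ _ h]

/-- An indecomposable summand of a product of indecomposables is one of the factors. -/
theorem exists_iso_of_summand [IsAlgClosed k] (hU : ∀ i, Indec (U i)) {l : List ι}
    {L C : FM k R} (hL : Indec L) (h : Iso (lprod U l) (L.prod C)) :
    ∃ i ∈ l, Iso L (U i) := by
  by_contra! hc
  have h1 := mult_lprod_eq_zero hL hU l hc
  rw [mult_eq_of_iso _ _ h, mult_prod, mult_self] at h1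
  omega

/-- Every finite-dimensional module is a product of indecomposables. -/
theorem exists_lprod (X : FM k R) :
    ∃ l : List {Y : FM k R // Indec Y}, Iso X (lprod Subtype.val l) := by
  induction hn : dim X using Nat.strong_induction_on generalizing X with
  | _ n ih =>
    by_cases hX : Indec X
    · exact ⟨[⟨X, hX⟩], (prod_zero_iso X).symm⟩
    by_cases h0 : Nontrivial X
    · have : ∃ K L : Submodule R X, IsCompl K L ∧ K ≠ ⊥ ∧ L ≠ ⊥ := by
        by_contra! hc
        exact hX ⟨h0, fun K L h => or_iff_not_imp_left.2 (hc K L h)⟩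
      obtain ⟨K, L, hKL, hK, hL⟩ := this
      have e : Iso X ((X.sub K).prod (X.sub L)) :=
        ⟨(Submodule.prodEquivOfIsCompl K L hKL).symm⟩
      have hd : dim X = dim (X.sub K) + dim (X.sub L) := by
        obtain ⟨e⟩ := e
        exact (e.restrictScalars k).finrank_eq.trans Module.finrank_prod
      have hK' : 0 < dim (X.sub K) := dim_pos_iff.2 (Submodule.nontrivial_iff_ne_bot.2 hK)
      have hL' : 0 < dim (X.sub L) := dim_pos_iff.2 (Submodule.nontrivial_iff_ne_bot.2 hL)
      obtain ⟨l1, h1⟩ := ih _ (by omega) (X.sub K) rfl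
      obtain ⟨l2, h2⟩ := ih _ (by omega) (X.sub L) rfl
      exact ⟨l1 ++ l2, e.trans ((h1.prod h2).trans (lprod_append _ _ _).symm)⟩
    · exact ⟨[], iso_of_subsingleton (not_nontrivial_iff_subsingleton.1 h0)
        (inferInstanceAs (Subsingleton PUnit))⟩

/-- Representatives of the isomorphism classes in a list of modules. -/
theorem exists_reps (l : List {Y : FM k R // Indec Y}) :
    ∃ (m : ℕ) (U : Fin m → FM k R), (∀ i, ∃ Y ∈ l, U i = Y.1) ∧
      (∀ i j, i ≠ j → ¬ Iso (U i) (U j)) ∧ ∀ Y ∈ l, ∃ i, Iso Y.1 (U i) := by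
  induction l with
  | nil => exact ⟨0, Fin.elim0, fun i => i.elim0, fun i => i.elim0, by simp⟩
  | cons Z l ih =>
    obtain ⟨m, U, h1, h2, h3⟩ := ih
    by_cases hZ : ∃ i, Iso Z.1 (U i)
    · refine ⟨m, U, fun i => ?_, h2, fun Y hY => ?_⟩
      · obtain ⟨Y, hY, e⟩ := h1 i
        exact ⟨Y, List.mem_cons_of_mem _ hY, e⟩
      · rcases List.mem_cons.1 hY with rfl | hY
        · exact hZ
        · exact h3 Y hY
    · refine ⟨m + 1, Fin.cons Z.1 U, fun i => ?_, fun i j => ?_, fun Y hY => ?_⟩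
      · refine Fin.cases ⟨Z, List.mem_cons_self, rfl⟩ (fun i => ?_) i
        obtain ⟨Y, hY, e⟩ := h1 i
        exact ⟨Y, List.mem_cons_of_mem _ hY, e⟩
      · refine Fin.cases ?_ (fun i => ?_) i <;> refine Fin.cases ?_ (fun j => ?_) j
        · simp
        · exact fun _ h => hZ ⟨j, h⟩
        · exact fun _ h => hZ ⟨i, h.symm⟩
        · exact fun hij => h2 i j fun h => hij (by rw [h])
      · rcases List.mem_cons.1 hY with rfl | hY
        · exact ⟨0, .refl _⟩
        · obtain ⟨i, hi⟩ := h3 Y hY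
          exact ⟨i.succ, hi⟩

theorem lprod_reps {l : List {Y : FM k R // Indec Y}} {m : ℕ} {U : Fin m → FM k R}
    (h : ∀ Y ∈ l, ∃ i, Iso Y.1 (U i)) :
    ∃ l' : List (Fin m), Iso (lprod Subtype.val l) (lprod U l') := by
  induction l with
  | nil => exact ⟨[], .refl _⟩
  | cons Z l ih =>
    obtain ⟨l', hl⟩ := ih fun Y hY => h Y (List.mem_cons_of_mem _ hY)
    obtain ⟨i, hi⟩ := h Z List.mem_cons_self
    exact ⟨i :: l', hi.prod hl⟩

/-- A nonzero module has an indecomposable direct summand. -/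
theorem exists_indec_summand (X : FM k R) (h : Nontrivial X) :
    ∃ L C : FM k R, Indec L ∧ Iso X (L.prod C) := by
  obtain ⟨l, hl⟩ := exists_lprod X
  cases l with
  | nil =>
    obtain ⟨e⟩ := hl
    exact absurd (e.toEquiv.subsingleton_congr.2 (inferInstanceAs (Subsingleton PUnit)))
      (not_subsingleton_iff_nontrivial.2 h)
  | cons Y l => exact ⟨Y.1, lprod Subtype.val l, Y.2, hl⟩

end Mult
end FM

namespace FM

section Torsion

variable {k R : Type} [Field k] [Ring R] [Algebra k R]

/-- Torsion classes of finite-dimensional modules. -/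
structure IsTors (T : FM k R → Prop) : Prop where
  zero : ∀ X : FM k R, Subsingleton X → T X
  quot : ∀ {X Y : FM k R} (f : X →ₗ[R] Y), Function.Surjective f → T X → T Y
  ext : ∀ {X Y Z : FM k R} (f : X →ₗ[R] Y) (g : Y →ₗ[R] Z), Function.Surjective g →
    LinearMap.range f = LinearMap.ker g → T X → T Z → T Y

theorem IsTors.iso {T : FM k R → Prop} (hT : IsTors T) {X Y : FM k R} (e : Iso X Y) (h : T X) :
    T Y :=
  hT.quot e.some.toLinearMap e.some.surjective h

theorem IsTors.prod {T : FM k R → Prop} (hT : IsTors T) {X Y : FM k R} (h : T X) (h' : T Y) :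
    T (X.prod Y) :=
  hT.ext (Y := X.prod Y) (LinearMap.inl R X Y) (LinearMap.snd R X Y) LinearMap.snd_surjective
    (LinearMap.range_inl R X Y) h h'

theorem IsTors.summand {T : FM k R → Prop} (hT : IsTors T) {X L C : FM k R}
    (e : Iso X (L.prod C)) (h : T X) : T L ∧ T C :=
  have h' := hT.iso e h
  ⟨hT.quot (X := L.prod C) (LinearMap.fst R L C) LinearMap.fst_surjective h',
    hT.quot (X := L.prod C) (LinearMap.snd R L C) LinearMap.snd_surjective h'⟩

theorem IsTors.range {T : FM k R → Prop} (hT : IsTors T) {X Y : FM k R} (f : X →ₗ[R] Y)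
    (h : T X) : T (Y.sub (LinearMap.range f)) :=
  hT.quot (Y := Y.sub (LinearMap.range f)) f.rangeRestrict f.surjective_rangeRestrict h

variable {ι : Type*} (U : ι → FM k R) (s : Set ι)

/-- The trace of a family of modules in a module. -/
def tr (X : FM k R) : Submodule R X := ⨆ i ∈ s, ⨆ f : U i →ₗ[R] X, LinearMap.range f

/-- Modules generated by a family. -/
def Gen (X : FM k R) : Prop := tr U s X = ⊤

variable {U s}

theorem range_le_tr {i : ι} (hi : i ∈ s) {X : FM k R} (f : U i →ₗ[R] X) :
    LinearMap.range f ≤ tr U s X :=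
  le_iSup₂_of_le i hi (le_iSup (fun f : U i →ₗ[R] X => LinearMap.range f) f)

theorem tr_le {X : FM k R} {K : Submodule R X}
    (h : ∀ i ∈ s, ∀ f : U i →ₗ[R] X, LinearMap.range f ≤ K) : tr U s X ≤ K :=
  iSup₂_le fun i hi => iSup_le fun f => h i hi f

theorem map_tr_le {X Y : FM k R} (g : X →ₗ[R] Y) : (tr U s X).map g ≤ tr U s Y := by
  rw [Submodule.map_le_iff_le_comap]
  refine tr_le fun i hi f => ?_
  rw [← Submodule.map_le_iff_le_comap, ← LinearMap.range_comp]
  exact range_le_tr hi _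

theorem Gen.quot {X Y : FM k R} (f : X →ₗ[R] Y) (hf : Function.Surjective f)
    (h : Gen U s X) : Gen U s Y := by
  have h1 := map_tr_le (U := U) (s := s) f
  rw [h, Submodule.map_top, LinearMap.range_eq_top.2 hf] at h1
  exact top_le_iff.1 h1

theorem Gen.self {i : ι} (hi : i ∈ s) : Gen U s (U i) := by
  have := range_le_tr (U := U) hi (LinearMap.id)
  rw [LinearMap.range_id] at this
  exact top_le_iff.1 this

theorem Gen.sub_tr (X : FM k R) : Gen U s (X.sub (tr U s X)) := by
  have h : tr U s X ≤ (tr U s (X.sub (tr U s X))).map (tr U s X).subtype := by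
    refine tr_le fun i hi f => ?_
    let f' : U i →ₗ[R] X.sub (tr U s X) :=
      f.codRestrict _ fun x => range_le_tr hi f ⟨x, rfl⟩
    have h1 := Submodule.map_mono (f := (tr U s X).subtype) (range_le_tr hi f')
    refine le_trans ?_ h1
    rw [← LinearMap.range_comp]
    exact le_of_eq rfl
  refine top_le_iff.1 fun x _ => ?_
  obtain ⟨y, hy, hyx⟩ := h x.2
  rwa [← Subtype.ext hyx]

theorem Gen.exists_ne_zero {X : FM k R} (h : Gen U s X) (hX : Nontrivial X) :
    ∃ i ∈ s, ∃ f : U i →ₗ[R] X, f ≠ 0 := by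
  by_contra! hc
  have : tr U s X ≤ ⊥ := tr_le fun i hi f => by rw [hc i hi f, LinearMap.range_zero]
  rw [h] at this
  exact (Submodule.nontrivial_iff_ne_bot.1 (Submodule.nontrivial_iff R |>.2 hX |> fun _ =>
    Submodule.nontrivial_iff_ne_bot.2 (top_ne_bot (α := Submodule R X)))) (le_bot_iff.1 this)

/-- Ext-projectives for a torsion class, via lifting. -/
def EP (T : FM k R → Prop) (X : FM k R) : Prop :=
  ∀ ⦃E Z : FM k R⦄ (p : E →ₗ[R] Z), Function.Surjective p → T (E.sub (LinearMap.ker p)) →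
    ∀ h : X →ₗ[R] Z, ∃ h' : X →ₗ[R] E, p ∘ₗ h' = h

theorem EP.of_retract {T : FM k R → Prop} {X L : FM k R} (h : EP T X) (i : L →ₗ[R] X)
    (q : X →ₗ[R] L) (hq : q ∘ₗ i = LinearMap.id) : EP T L := by
  intro E Z p hp hk g
  obtain ⟨g', hg⟩ := h p hp hk (g ∘ₗ q)
  exact ⟨g' ∘ₗ i, by rw [← LinearMap.comp_assoc, hg, LinearMap.comp_assoc, hq, LinearMap.comp_id]⟩

theorem EP.iso {T : FM k R → Prop} {X L : FM k R} (h : EP T X) (e : Iso X L) : EP T L :=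
  h.of_retract e.some.symm.toLinearMap e.some.toLinearMap (by ext; simp)

theorem EP.summand {T : FM k R → Prop} {X L C : FM k R} (h : EP T X)
    (e : Iso X (L.prod C)) : EP T L ∧ EP T C :=
  have h' := h.iso e
  ⟨h'.of_retract (X := L.prod C) (LinearMap.inl R L C) (LinearMap.fst R L C) (by ext; simp),
    h'.of_retract (X := L.prod C) (LinearMap.inr R L C) (LinearMap.snd R L C) (by ext; simp)⟩

theorem EP.prod {T : FM k R → Prop} {X Y : FM k R} (h : EP T X) (h' : EP T Y) :
    EP T (X.prod Y) := by
  intro E Z p hp hk g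
  obtain ⟨a, ha⟩ := h p hp hk (g ∘ₗ LinearMap.inl R X Y)
  obtain ⟨b, hb⟩ := h' p hp hk (g ∘ₗ LinearMap.inr R X Y)
  refine ⟨a.coprod b, ?_⟩
  rw [LinearMap.comp_coprod, ha, hb, ← LinearMap.comp_coprod, LinearMap.coprod_inl_inr,
    LinearMap.comp_id]

theorem Gen.isTors {T : FM k R → Prop} (hU : ∀ i ∈ s, EP T (U i))
    (hT : ∀ X, Gen U s X → T X) : IsTors (Gen U s) where
  zero X hX := Subsingleton.elim _ _
  quot f hf h := h.quot f hf
  ext {X Y Z} f g hg he hX hZ := by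
    have h1 : LinearMap.ker g ≤ tr U s Y := by
      rw [← he, LinearMap.range_eq_map, ← (show tr U s X = ⊤ from hX)]
      exact map_tr_le f
    have hk : Gen U s (Y.sub (LinearMap.ker g)) :=
      hX.quot (Y := Y.sub (LinearMap.ker g))
        (f.codRestrict _ fun x => he ▸ ⟨x, rfl⟩) fun y => by
          obtain ⟨x, hx⟩ := he.ge y.2
          exact ⟨x, Subtype.ext hx⟩
    have h2 : tr U s Z ≤ (tr U s Y).map g := tr_le fun i hi f => by
      obtain ⟨f', rfl⟩ := hU i hi g hg (hT _ hk) f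
      rw [LinearMap.range_comp]
      exact Submodule.map_mono (range_le_tr hi f')
    refine top_le_iff.1 fun y _ => ?_
    have h3 : g y ∈ tr U s Z := by rw [show tr U s Z = ⊤ from hZ]; trivial
    obtain ⟨y', hy', e⟩ := h2 h3
    rw [← sub_add_cancel y y']
    exact add_mem (h1 (by rw [LinearMap.mem_ker, map_sub, sub_eq_zero, e])) hy'

/-- The torsion submodule. -/
theorem IsTors.exists_torsion {T : FM k R → Prop} (hT : IsTors T) (X : FM k R) :
    ∃ K : Submodule R X, T (X.sub K) ∧ (∀ N, T N → ∀ f : N →ₗ[R] X.quo K, f = 0) ∧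
      ∀ N, T N → ∀ f : N →ₗ[R] X, LinearMap.range f ≤ K := by
  have : IsNoetherian R X := isNoetherian_of_tower k inferInstance
  obtain ⟨K, hK, hm⟩ := (set_has_maximal_iff_noetherian (R := R) (M := X)).2 this
    {K | T (X.sub K)} ⟨⊥, hT.zero _ (inferInstanceAs (Subsingleton (⊥ : Submodule R X)))⟩
  have key : ∀ N, T N → ∀ f : N →ₗ[R] X.quo K, f = 0 := by
    intro N hN f
    let K' : Submodule R X := (LinearMap.range f).comap K.mkQ
    have hKK' : K ≤ K' := fun x hx => by
      show K.mkQ x ∈ LinearMap.range f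
      have : K.mkQ x = 0 := (Submodule.Quotient.mk_eq_zero K).2 hx
      rw [this]
      exact zero_mem _
    let g : X.sub K' →ₗ[R] (X.quo K).sub (LinearMap.range f) :=
      K.mkQ.restrict (p := K') (q := LinearMap.range f) fun x hx => hx
    have hK' : T (X.sub K') := by
      refine hT.ext (X := X.sub K) (Submodule.inclusion hKK') g ?_ ?_ hK (hT.range f hN)
      · rintro ⟨y, hy⟩
        obtain ⟨x, rfl⟩ := K.mkQ_surjective y
        exact ⟨⟨x, hy⟩, rfl⟩
      · rw [Submodule.range_inclusion]
        ext x
        rw [Submodule.mem_comap, LinearMap.mem_ker]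
        exact ((Submodule.Quotient.mk_eq_zero K).symm.trans
          (Subtype.ext_iff (a1 := g x) (a2 := 0)).symm)
    have h1 : K' = K := by
      by_contra hne
      exact hm K' hK' (lt_of_le_of_ne hKK' (Ne.symm hne))
    ext x
    obtain ⟨y, hy⟩ := K.mkQ_surjective (f x)
    have : y ∈ K' := by
      show K.mkQ y ∈ LinearMap.range f
      rw [hy]; exact ⟨x, rfl⟩
    rw [h1] at this
    rw [← hy]
    exact (Submodule.Quotient.mk_eq_zero K).2 this
  refine ⟨K, hK, key, ?_⟩
  rintro N hN f _ ⟨x, rfl⟩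
  rw [← Submodule.Quotient.mk_eq_zero K]
  exact LinearMap.congr_fun (key N hN ((K.mkQ : X →ₗ[R] X.quo K) ∘ₗ f)) x

theorem IsTors.of_gen {T : FM k R → Prop} (hT : IsTors T) (hU : ∀ i ∈ s, T (U i)) {X : FM k R}
    (h : Gen U s X) : T X := by
  obtain ⟨K, hK, -, h2⟩ := hT.exists_torsion X
  have : tr U s X ≤ K := tr_le fun i hi f => h2 _ (hU i hi) f
  rw [h, top_le_iff] at this
  exact hT.quot (X := X.sub K) K.subtype
    (fun x => ⟨(⟨x, by rw [this]; trivial⟩ : K), rfl⟩) hK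

theorem range_lprod_le_tr {l : List ι} (hl : ∀ i ∈ l, i ∈ s) {X : FM k R}
    (f : lprod U l →ₗ[R] X) : LinearMap.range f ≤ tr U s X := by
  induction l with
  | nil =>
    rintro _ ⟨x, rfl⟩
    rw [show x = 0 from rfl, map_zero]
    exact zero_mem _
  | cons i l ih =>
    rintro _ ⟨x, rfl⟩
    let f' : (U i × lprod U l) →ₗ[R] X := f
    have h1 := range_le_tr (hl i List.mem_cons_self) (f' ∘ₗ LinearMap.inl R (U i) (lprod U l))
    have h2 := ih (fun j hj => hl j (List.mem_cons_of_mem _ hj))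
      (f' ∘ₗ LinearMap.inr R (U i) (lprod U l))
    have h3 : f x = f' (x.1, 0) + f' (0, x.2) := by
      rw [← map_add, Prod.mk_add_mk, add_zero, zero_add]
      rfl
    rw [h3]
    exact add_mem (h1 ⟨x.1, rfl⟩) (h2 ⟨x.2, rfl⟩)

theorem IsTors.lprod {T : FM k R → Prop} (hT : IsTors T) {l : List ι} (h : ∀ i ∈ l, T (U i)) :
    T (lprod U l) := by
  induction l with
  | nil => exact hT.zero _ (inferInstanceAs (Subsingleton PUnit))
  | cons i l ih =>
    exact hT.prod (h i List.mem_cons_self) (ih fun j hj => h j (List.mem_cons_of_mem _ hj))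

theorem EP.lprod {T : FM k R → Prop} {l : List ι} (h : ∀ i ∈ l, EP T (U i)) :
    EP T (lprod U l) := by
  induction l with
  | nil =>
    intro E Z p hp _ h
    refine ⟨0, ?_⟩
    ext x
    rw [show x = 0 from rfl, map_zero, map_zero]
  | cons i l ih =>
    exact EP.prod (h i List.mem_cons_self) (ih fun j hj => h j (List.mem_cons_of_mem _ hj))

/-- Left approximations into a torsion class, with their cokernels. -/
structure Approx (T : FM k R → Prop) {P X Y : FM k R} (f : P →ₗ[R] X) (g : X →ₗ[R] Y) :
    Prop where
  mem : T X
  fac : ∀ {N : FM k R}, T N → ∀ h : P →ₗ[R] N, ∃ h' : X →ₗ[R] N, h' ∘ₗ f = h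
  surj : Function.Surjective g
  exact : LinearMap.range f = LinearMap.ker g

theorem Approx.prod {T : FM k R → Prop} (hT : IsTors T) {P X Y P' X' Y' : FM k R}
    {f : P →ₗ[R] X} {g : X →ₗ[R] Y} {f' : P' →ₗ[R] X'} {g' : X' →ₗ[R] Y'}
    (h : Approx T f g) (h' : Approx T f' g') :
    Approx T (P := P.prod P') (X := X.prod X') (Y := Y.prod Y') (f.prodMap f') (g.prodMap g') where
  mem := hT.prod h.mem h'.mem
  fac hN φ := by
    obtain ⟨a, ha⟩ := h.fac hN (φ ∘ₗ LinearMap.inl R P P')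
    obtain ⟨b, hb⟩ := h'.fac hN (φ ∘ₗ LinearMap.inr R P P')
    refine ⟨a.coprod b, ?_⟩
    refine LinearMap.ext fun x => ?_
    have h1 := LinearMap.congr_fun ha x.1
    have h2 := LinearMap.congr_fun hb x.2
    have h3 : a (f x.1) + b (f' x.2) = φ ((x.1, 0) + (0, x.2)) := by
      rw [map_add]; exact congr_arg₂ _ h1 h2
    rw [Prod.mk_add_mk, add_zero, zero_add] at h3
    exact h3
  surj := h.surj.prodMap h'.surj
  exact := by rw [LinearMap.range_prodMap, LinearMap.ker_prodMap, h.exact, h'.exact]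

theorem Approx.iso {T : FM k R → Prop} (hT : IsTors T) {P P' X Y X' Y' : FM k R}
    {f : P →ₗ[R] X} {g : X →ₗ[R] Y}
    (h : Approx T f g) (eP : P ≃ₗ[R] P') (eX : X ≃ₗ[R] X') (eY : Y ≃ₗ[R] Y') :
    Approx T (eX.toLinearMap ∘ₗ f ∘ₗ eP.symm.toLinearMap)
      (eY.toLinearMap ∘ₗ g ∘ₗ eX.symm.toLinearMap) where
  mem := hT.iso ⟨eX⟩ h.mem
  fac hN φ := by
    obtain ⟨a, ha⟩ := h.fac hN (φ ∘ₗ eP.toLinearMap)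
    refine ⟨a ∘ₗ eX.symm.toLinearMap, ?_⟩
    ext x
    have := LinearMap.congr_fun ha (eP.symm x)
    simpa using this
  surj := eY.surjective.comp (h.surj.comp eX.symm.surjective)
  exact := by
    ext x
    have := SetLike.ext_iff.1 h.exact (eX.symm x)
    rw [LinearMap.mem_ker, LinearMap.mem_range] at *
    constructor
    · rintro ⟨y, rfl⟩
      simp only [LinearMap.comp_apply, LinearEquiv.coe_coe] at *
      rw [this.1 ⟨_, (eX.symm_apply_apply _).symm⟩, map_zero]
    · intro hx
      obtain ⟨y, hy⟩ := this.2 (by simpa using hx)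
      exact ⟨eP y, by simp [hy]⟩

theorem Approx.schanuel {T : FM k R → Prop} {P X Y X' Y' : FM k R}
    {f : P →ₗ[R] X} {g : X →ₗ[R] Y} {f' : P →ₗ[R] X'} {g' : X' →ₗ[R] Y'}
    (h : Approx T f g) (h' : Approx T f' g') : Iso (X.prod Y') (X'.prod Y) := by
  obtain ⟨u, hu⟩ := h.fac h'.mem f'
  obtain ⟨v, hv⟩ := h'.fac h.mem f
  have hu' : ∀ p, u (f p) = f' p := LinearMap.congr_fun hu
  have hv' : ∀ p, v (f' p) = f p := LinearMap.congr_fun hv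
  have hgf : ∀ p, g (f p) = 0 := fun p => h.exact.le ⟨p, rfl⟩
  have hgf' : ∀ p, g' (f' p) = 0 := fun p => h'.exact.le ⟨p, rfl⟩
  let a : (X × X') →ₗ[R] (X × Y') :=
    (LinearMap.fst R X X' + v ∘ₗ LinearMap.snd R X X').prod (g' ∘ₗ LinearMap.snd R X X')
  let b : (X × X') →ₗ[R] (X' × Y) :=
    (LinearMap.snd R X X' + u ∘ₗ LinearMap.fst R X X').prod (g ∘ₗ LinearMap.fst R X X')
  have ha : Function.Surjective a := by
    rintro ⟨x, y⟩
    obtain ⟨x', rfl⟩ := h'.surj y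
    exact ⟨(x - v x', x'), by simp [a]⟩
  have hb : Function.Surjective b := by
    rintro ⟨x', y⟩
    obtain ⟨x, rfl⟩ := h.surj y
    exact ⟨(x, x' - u x), by simp [b]⟩
  have hab : LinearMap.ker a = LinearMap.ker b := by
    ext ⟨x, x'⟩
    simp only [a, b, LinearMap.mem_ker, LinearMap.prod_apply, Function.prod_apply,
      Prod.mk_eq_zero, LinearMap.add_apply, LinearMap.comp_apply, LinearMap.fst_apply,
      LinearMap.snd_apply]
    constructor
    · rintro ⟨h1, h2⟩
      obtain ⟨p, rfl⟩ := h'.exact.ge h2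
      rw [hv', add_eq_zero_iff_eq_neg] at h1
      simp [h1, hu', hgf]
    · rintro ⟨h1, h2⟩
      obtain ⟨p, rfl⟩ := h.exact.ge h2
      rw [hu', add_eq_zero_iff_eq_neg] at h1
      simp [h1, hv', hgf']
  exact ⟨(a.quotKerEquivOfSurjective ha).symm.trans
    ((Submodule.quotEquivOfEq _ _ hab).trans (b.quotKerEquivOfSurjective hb))⟩

theorem Approx.hd_eq {T : FM k R → Prop} {P X Y N : FM k R}
    {f : P →ₗ[R] X} {g : X →ₗ[R] Y} (h : Approx T f g) (hN : T N) :
    hd X N = hd P N + hd Y N := by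
  have h1 := LinearMap.finrank_range_add_finrank_ker (pre f N)
  have h2 : LinearMap.range (pre f N) = ⊤ :=
    LinearMap.range_eq_top.2 fun φ => h.fac hN φ
  have h3 : LinearMap.ker (pre f N) = LinearMap.range (pre g N) := by
    ext φ
    constructor
    · intro hφ
      have hle : LinearMap.ker g ≤ LinearMap.ker φ := by
        rw [← h.exact]
        rintro _ ⟨p, rfl⟩
        exact LinearMap.congr_fun hφ p
      refine ⟨(LinearMap.ker g).liftQ φ hle ∘ₗ
        (g.quotKerEquivOfSurjective h.surj).symm.toLinearMap, ?_⟩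
      ext x
      have : (g.quotKerEquivOfSurjective h.surj).symm (g x) = Submodule.Quotient.mk x := by
        rw [LinearEquiv.symm_apply_eq]; rfl
      show (LinearMap.ker g).liftQ φ hle ((g.quotKerEquivOfSurjective h.surj).symm (g x)) = _
      rw [this]; rfl
    · rintro ⟨ψ, rfl⟩
      ext p
      show ψ (g (f p)) = 0
      rw [show g (f p) = 0 from h.exact.le ⟨p, rfl⟩, map_zero]
  have h4 : Function.Injective (pre g N) := fun a b hab => by
    ext y
    obtain ⟨x, rfl⟩ := h.surj y
    exact LinearMap.congr_fun hab x
  rw [h2, finrank_top, h3, LinearMap.finrank_range_of_inj h4] at h1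
  exact h1.symm

end Torsion
end FM

namespace FM

section Approximations

variable {k R : Type} [Field k] [Ring R] [Algebra k R]

/-- The family consisting of a single module. -/
abbrev single (M : FM k R) : Unit → FM k R := fun _ => M

/-- Modules generated by a single module. -/
def Fac (M : FM k R) (X : FM k R) : Prop := Gen (single M) Set.univ X

theorem Fac.exists_surjective {M X : FM k R} (h : Fac M X) :
    ∃ (n : ℕ) (q : M.pow n →ₗ[R] X), Function.Surjective q := by
  let c := Module.finBasis k (M →ₗ[R] X)
  let q : M.pow (Module.finrank k (M →ₗ[R] X)) →ₗ[R] X :=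
    ∑ j, c j ∘ₗ LinearMap.proj j
  have hq : ∀ m, q m = ∑ j, c j (m j) := fun m => by simp [q]
  refine ⟨_, q, LinearMap.range_eq_top.1 (top_le_iff.1 ?_)⟩
  rw [← show tr (single M) Set.univ X = ⊤ from h]
  refine tr_le fun _ _ φ => ?_
  rintro _ ⟨m, rfl⟩
  refine ⟨fun j => c.repr φ j • m, ?_⟩
  rw [hq]
  conv_rhs => rw [← c.sum_repr φ]
  rw [LinearMap.sum_apply]
  refine Finset.sum_congr rfl fun j _ => ?_
  rw [LinearMap.map_smul_of_tower]; rfl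

theorem Fac.pow (M : FM k R) (n : ℕ) : Fac M (M.pow n) := by
  refine top_le_iff.1 fun x _ => ?_
  rw [← Finset.univ_sum_single x]
  exact sum_mem fun j _ => range_le_tr (U := single M) (s := Set.univ) (i := ()) trivial
    (LinearMap.single R (fun _ : Fin n => (M : Type)) j) ⟨x j, rfl⟩

theorem IsTors.of_fac {T : FM k R → Prop} (hT : IsTors T) {M X : FM k R} (hM : T M)
    (h : Fac M X) : T X :=
  hT.of_gen (fun _ _ => hM) h

theorem exists_left_approx {T : FM k R → Prop} (hT : IsTors T) {M : FM k R} (hM : T M)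
    (hTM : ∀ X, T X → Fac M X) (P : FM k R) [Module.Projective R P] :
    ∃ (X : FM k R) (f : P →ₗ[R] X), T X ∧
      ∀ {N : FM k R}, T N → ∀ h : P →ₗ[R] N, ∃ h' : X →ₗ[R] N, h' ∘ₗ f = h := by
  let b := Module.finBasis k (P →ₗ[R] M)
  let f : P →ₗ[R] M.pow (Module.finrank k (P →ₗ[R] M)) := LinearMap.pi b
  refine ⟨_, f, hT.of_fac hM (Fac.pow M _), fun {N} hN h => ?_⟩
  obtain ⟨n, q, hq⟩ := (hTM N hN).exists_surjective
  obtain ⟨h1, rfl⟩ := Module.projective_lifting_property q h hq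
  refine ⟨q ∘ₗ LinearMap.pi fun j =>
    ∑ i, (b.repr (LinearMap.proj j ∘ₗ h1) i) • LinearMap.proj i, ?_⟩
  ext p
  simp only [LinearMap.comp_apply]
  congr 1
  ext j
  rw [LinearMap.pi_apply, LinearMap.sum_apply]
  change _ = (LinearMap.proj j ∘ₗ h1) p
  conv_rhs => rw [← b.sum_repr (LinearMap.proj j ∘ₗ h1)]
  rw [LinearMap.sum_apply]
  rfl

/-- A minimal left approximation has Ext-projective middle term and cokernel. -/
theorem exists_approx {T : FM k R → Prop} (hT : IsTors T) {M : FM k R} (hM : T M)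
    (hTM : ∀ X, T X → Fac M X) (P : FM k R) [Module.Projective R P] :
    ∃ (X Y : FM k R) (f : P →ₗ[R] X) (g : X →ₗ[R] Y), Approx T f g ∧ EP T X ∧ EP T Y := by
  let Q : ℕ → Prop := fun n => ∃ (X : FM k R) (f : P →ₗ[R] X), dim X = n ∧ T X ∧
      ∀ {N : FM k R}, T N → ∀ h : P →ₗ[R] N, ∃ h' : X →ₗ[R] N, h' ∘ₗ f = h
  have hQ : ∃ n, Q n := by
    obtain ⟨X, f, h⟩ := exists_left_approx hT hM hTM P
    exact ⟨_, X, f, rfl, h⟩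
  classical
  obtain ⟨X, f, hn, hX, hf⟩ := Nat.find_spec hQ
  have hmin : ∀ φ : X →ₗ[R] X, φ ∘ₗ f = f → Function.Bijective φ := by
    intro φ hφ
    have h1 : Nat.find hQ ≤ dim (X.sub (LinearMap.range φ)) := by
      refine Nat.find_min' hQ ⟨X.sub (LinearMap.range φ),
        f.codRestrict _ (fun p => ⟨f p, LinearMap.congr_fun hφ p⟩), rfl, hT.range φ hX,
        fun {N} hN h => ?_⟩
      obtain ⟨h', rfl⟩ := hf hN h
      exact ⟨h' ∘ₗ (LinearMap.range φ).subtype, rfl⟩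
    have h2 := bijective_of_injective_of_dim_le (X := X.sub (LinearMap.range φ))
      (LinearMap.range φ).subtype (Submodule.injective_subtype _) (by rw [hn]; exact h1)
    have h3 : Function.Surjective φ := fun x => by
      obtain ⟨⟨_, y, rfl⟩, hy⟩ := h2.2 x
      exact ⟨y, hy⟩
    exact ⟨(surjective_iff_injective φ).1 h3, h3⟩
  have hEP : EP T X := by
    intro E Z p hp hk h
    let W : Submodule R (X × E) := LinearMap.ker
      (h ∘ₗ LinearMap.fst R X E - p ∘ₗ LinearMap.snd R X E)
    have hW : ∀ w : X × E, w ∈ W ↔ h w.1 = p w.2 := fun w => by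
      rw [LinearMap.mem_ker, LinearMap.sub_apply, sub_eq_zero]; rfl
    have hTW : T ((X.prod E).sub W) := by
      let i : E.sub (LinearMap.ker p) →ₗ[R] (X.prod E).sub W :=
        (LinearMap.inr R X E ∘ₗ (LinearMap.ker p).subtype).codRestrict W fun e => by
          rw [hW]; simp
      let q : (X.prod E).sub W →ₗ[R] X := LinearMap.fst R X E ∘ₗ W.subtype
      refine hT.ext i q ?_ ?_ hk hX
      · intro x
        obtain ⟨e, he⟩ := hp (h x)
        exact ⟨⟨(x, e), (hW _).2 he.symm⟩, rfl⟩
      · ext ⟨⟨x, e⟩, hw⟩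
        constructor
        · rintro ⟨e', he'⟩
          have := (Prod.ext_iff.1 (Subtype.ext_iff.1 he')).1
          exact this.symm
        · intro hx
          have hx : x = 0 := hx
          subst hx
          have he : e ∈ LinearMap.ker p := by
            have := (hW _).1 hw
            rw [LinearMap.mem_ker, ← this]; exact map_zero h
          exact ⟨⟨e, he⟩, rfl⟩
    obtain ⟨e, he⟩ := Module.projective_lifting_property p (h ∘ₗ f) hp
    let t : P →ₗ[R] (X.prod E).sub W := (f.prod e).codRestrict W fun x => by
      rw [hW]; exact (LinearMap.congr_fun he x).symm
    obtain ⟨u, hu⟩ := hf hTW t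
    let φ : X →ₗ[R] X := LinearMap.fst R X E ∘ₗ W.subtype ∘ₗ u
    have hφ : Function.Bijective φ := hmin φ (by
      ext x
      show (u (f x)).1.1 = f x
      have : u (f x) = t x := LinearMap.congr_fun hu x
      rw [this]; rfl)
    let ψ := LinearEquiv.ofBijective φ hφ
    refine ⟨LinearMap.snd R X E ∘ₗ W.subtype ∘ₗ u ∘ₗ ψ.symm.toLinearMap, ?_⟩
    ext x
    have h1 := (hW _).1 (u (ψ.symm x)).2
    have h2 : (u (ψ.symm x)).1.1 = x := ψ.apply_symm_apply x
    rw [h2] at h1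
    exact h1.symm
  let Y : FM k R := X.quo (LinearMap.range f)
  let g : X →ₗ[R] Y := (LinearMap.range f).mkQ
  have hA : Approx T f g := ⟨hX, hf, Submodule.mkQ_surjective _, (Submodule.ker_mkQ _).symm⟩
  refine ⟨X, Y, f, g, hA, hEP, ?_⟩
  intro E Z p hp hk h
  obtain ⟨t, ht⟩ := hEP p hp hk (h ∘ₗ g)
  let tf : P →ₗ[R] E.sub (LinearMap.ker p) := (t ∘ₗ f).codRestrict _ fun x => by
    have := LinearMap.congr_fun ht (f x)
    rw [LinearMap.mem_ker]
    refine this.trans ?_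
    show h (g (f x)) = 0
    rw [show g (f x) = 0 from hA.exact.le ⟨x, rfl⟩, map_zero]
  obtain ⟨e, he⟩ := hf hk tf
  let t' : X →ₗ[R] E := t - (LinearMap.ker p).subtype ∘ₗ e
  have ht' : LinearMap.range f ≤ LinearMap.ker t' := by
    rintro _ ⟨x, rfl⟩
    rw [LinearMap.mem_ker, LinearMap.sub_apply, sub_eq_zero]
    have : e (f x) = tf x := LinearMap.congr_fun he x
    rw [LinearMap.comp_apply, this]; rfl
  refine ⟨(LinearMap.range f).liftQ t' ht', ?_⟩
  refine LinearMap.ext fun y => ?_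
  obtain ⟨x, rfl⟩ := (LinearMap.range f).mkQ_surjective y
  show p (t' x) = h (g x)
  rw [LinearMap.sub_apply, map_sub, LinearMap.comp_apply, Submodule.subtype_apply,
    LinearMap.mem_ker.1 (e x).2, sub_zero]
  exact LinearMap.congr_fun ht x

theorem EP.extend {T : FM k R → Prop} (hT : IsTors T) {U P P' N : FM k R} (hU : EP T U)
    {f : P' →ₗ[R] P} {g : P →ₗ[R] U} (hg : Function.Surjective g)
    (hfg : LinearMap.range f = LinearMap.ker g) (hN : T N) (h : P' →ₗ[R] N)
    (hh : LinearMap.ker f ≤ LinearMap.ker h) : ∃ h' : P →ₗ[R] N, h' ∘ₗ f = h := by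
  let D : Submodule R (N × P) := LinearMap.range (h.prod (-f))
  let E : FM k R := (N.prod P).quo D
  let g' : (N × P) →ₗ[R] U := g ∘ₗ LinearMap.snd R N P
  have hD : D ≤ LinearMap.ker g' := by
    rintro _ ⟨x, rfl⟩
    show g (-f x) = 0
    rw [map_neg, show g (f x) = 0 from hfg.le ⟨x, rfl⟩, neg_zero]
  let p : E →ₗ[R] U := D.liftQ g' hD
  have hp : Function.Surjective p := fun u => by
    obtain ⟨x, rfl⟩ := hg u
    exact ⟨D.mkQ (0, x), rfl⟩
  let j : N →ₗ[R] E := D.mkQ ∘ₗ LinearMap.inl R N P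
  have hj : Function.Injective j := by
    rw [injective_iff_map_eq_zero]
    intro x hx
    obtain ⟨y, hy⟩ := (Submodule.Quotient.mk_eq_zero D).1 hx
    have h1 : h y = x := (Prod.ext_iff.1 hy).1
    have h2 : -f y = 0 := (Prod.ext_iff.1 hy).2
    rw [← h1]
    exact hh (neg_eq_zero.1 h2)
  have hjp : LinearMap.range j = LinearMap.ker p := by
    ext e
    constructor
    · rintro ⟨x, rfl⟩
      show g 0 = 0
      exact map_zero g
    · intro he
      obtain ⟨⟨x, y⟩, rfl⟩ := D.mkQ_surjective e
      have he : g y = 0 := he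
      obtain ⟨z, rfl⟩ := hfg.ge he
      refine ⟨x + h z, ?_⟩
      refine (Submodule.Quotient.eq D).2 ⟨z, ?_⟩
      show (h z, -f z) = (x + h z - x, 0 - f z)
      simp
  have hk : T (E.sub (LinearMap.ker p)) := by
    rw [← hjp]; exact hT.range j hN
  obtain ⟨σ, hσ⟩ := hU p hp hk LinearMap.id
  let χ : P →ₗ[R] E := D.mkQ ∘ₗ LinearMap.inr R N P - σ ∘ₗ g
  have hχ : ∀ x, χ x ∈ LinearMap.range j := fun x => by
    rw [hjp, LinearMap.mem_ker]
    show p (D.mkQ (0, x) - σ (g x)) = 0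
    rw [map_sub, show p (σ (g x)) = g x from LinearMap.congr_fun hσ (g x)]
    exact sub_self (g x)
  let ej := LinearEquiv.ofInjective j hj
  refine ⟨ej.symm.toLinearMap ∘ₗ χ.codRestrict _ hχ, ?_⟩
  ext x
  show ej.symm (χ.codRestrict _ hχ (f x)) = h x
  rw [LinearEquiv.symm_apply_eq]
  apply Subtype.ext
  show D.mkQ (0, f x) - σ (g (f x)) = D.mkQ (h x, 0)
  rw [show g (f x) = 0 from hfg.le ⟨x, rfl⟩, map_zero, sub_zero]
  refine ((Submodule.Quotient.eq D).2 ⟨-x, ?_⟩)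
  simp

theorem EP.factor {T : FM k R → Prop} (hT : IsTors T) {U P P' N : FM k R}
    [Module.Projective R P] (hU : EP T U)
    {f : P' →ₗ[R] P} {g : P →ₗ[R] U} (hg : Function.Surjective g)
    (hfg : LinearMap.range f = LinearMap.ker g) (hf : SuperfluousSubmodule (LinearMap.ker f))
    (hN : T N) (h : P' →ₗ[R] N) : ∃ h' : P →ₗ[R] N, h' ∘ₗ f = h := by
  induction hn : dim (N.sub (LinearMap.range h)) using Nat.strong_induction_on
    generalizing h with
  | _ n ih =>
    by_cases h0 : h = 0
    · exact ⟨0, by rw [h0, LinearMap.zero_comp]⟩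
    let K := (LinearMap.ker f).map h
    have hKlt : K < LinearMap.range h := by
      refine lt_of_le_of_ne (LinearMap.map_le_range) fun he => h0 ?_
      have : LinearMap.ker f ⊔ LinearMap.ker h = ⊤ := by
        refine top_le_iff.1 fun x _ => ?_
        obtain ⟨y, hy, hyx⟩ := he.ge ⟨x, rfl⟩
        rw [← add_sub_cancel y x]
        exact Submodule.add_mem_sup hy (by rw [LinearMap.mem_ker, map_sub, sub_eq_zero, hyx])
      exact LinearMap.ker_eq_top.1 (hf _ this)
    obtain ⟨χ, hχ⟩ := hU.extend hT hg hfg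
      (hT.quot (Y := N.quo K) K.mkQ K.mkQ_surjective hN) (K.mkQ ∘ₗ h) (fun x hx => by
        rw [LinearMap.mem_ker]
        exact (Submodule.Quotient.mk_eq_zero K).2 ⟨x, hx, rfl⟩)
    obtain ⟨h1, hh1⟩ := Module.projective_lifting_property K.mkQ χ K.mkQ_surjective
    have hle : LinearMap.range (h - h1 ∘ₗ f) ≤ K := by
      rintro _ ⟨x, rfl⟩
      rw [← Submodule.Quotient.mk_eq_zero K]
      have h2 := LinearMap.congr_fun hχ x
      have h3 := LinearMap.congr_fun hh1 (f x)
      have h4 := h3.trans h2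
      exact (Submodule.Quotient.mk_sub K).trans (sub_eq_zero.2 h4.symm)
    obtain ⟨h2, hh2⟩ := ih _ (hn ▸ dim_sub_lt (lt_of_le_of_lt hle hKlt)) (h - h1 ∘ₗ f) rfl
    exact ⟨h2 + h1, by rw [LinearMap.add_comp, hh2, sub_add_cancel]⟩

theorem Approx.of_presentation {T : FM k R → Prop} {U P P' X Y : FM k R}
    {f : P' →ₗ[R] P} {g : P →ₗ[R] U} (hg : Function.Surjective g)
    (hfg : LinearMap.range f = LinearMap.ker g)
    (hf : ∀ {N : FM k R}, T N → ∀ h : P' →ₗ[R] N, ∃ h' : P →ₗ[R] N, h' ∘ₗ f = h)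
    (hU : T U) {a : P →ₗ[R] X} {b : X →ₗ[R] Y} (h : Approx T a b) :
    ∃ c : X →ₗ[R] U.prod Y, Approx T (a ∘ₗ f) c := by
  obtain ⟨w, hw⟩ := h.fac hU g
  have hw' : ∀ p, w (a p) = g p := LinearMap.congr_fun hw
  refine ⟨w.prod b, h.mem, fun hN φ => ?_, ?_, ?_⟩
  · obtain ⟨φ', rfl⟩ := hf hN φ
    obtain ⟨ψ, rfl⟩ := h.fac hN φ'
    exact ⟨ψ, rfl⟩
  · rintro ⟨u, y⟩
    obtain ⟨t, rfl⟩ := h.surj y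
    obtain ⟨p, hp⟩ := hg (u - w t)
    refine ⟨t + a p, Prod.ext ?_ ?_⟩
    · show w (t + a p) = u
      rw [map_add, hw', hp, add_sub_cancel]
    · show b (t + a p) = b t
      rw [map_add, show b (a p) = 0 from h.exact.le ⟨p, rfl⟩, add_zero]
  · ext x
    constructor
    · rintro ⟨y, rfl⟩
      refine Prod.ext ?_ ?_
      · exact (hw' _).trans (hfg.le ⟨y, rfl⟩)
      · exact h.exact.le ⟨_, rfl⟩
    · intro hx
      have h1 : w x = 0 := (Prod.ext_iff.1 hx).1
      have h2 : b x = 0 := (Prod.ext_iff.1 hx).2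
      obtain ⟨p, rfl⟩ := h.exact.ge h2
      rw [hw'] at h1
      obtain ⟨q, rfl⟩ := hfg.ge h1
      exact ⟨q, rfl⟩

end Approximations
end FM

namespace FM

section Projectives

variable {k R : Type} [Field k] [Ring R] [Algebra k R]

theorem hd_pos_iff {X Y : FM k R} : 0 < hd X Y ↔ ∃ f : X →ₗ[R] Y, f ≠ 0 := by
  rw [hd, Module.finrank_pos_iff, nontrivial_iff_exists_ne (0 : X →ₗ[R] Y)]

theorem hd_eq_zero_iff {X Y : FM k R} : hd X Y = 0 ↔ ∀ f : X →ₗ[R] Y, f = 0 := by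
  have := hd_pos_iff (X := X) (Y := Y)
  rw [← not_iff_not, ← ne_eq, ← Nat.pos_iff_ne_zero, this, not_forall]

theorem hd_prod (X X' Y : FM k R) : hd (X.prod X') Y = hd X Y + hd X' Y := by
  have e : ((X →ₗ[R] Y) × (X' →ₗ[R] Y)) ≃ₗ[k] (X × X' →ₗ[R] Y) := LinearMap.coprodEquiv k
  rw [hd, ← LinearEquiv.finrank_eq e, Module.finrank_prod]
  rfl

theorem hd_lprod {ι : Type*} (U : ι → FM k R) (l : List ι) (Y : FM k R) :
    hd (lprod U l) Y = (l.map fun i => hd (U i) Y).sum := by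
  induction l with
  | nil =>
    rw [hd_eq_zero_iff.2]
    · rfl
    · intro f
      ext x
      rw [show x = 0 from rfl, map_zero, map_zero]
  | cons i l ih => rw [lprod_cons, hd_prod, ih, List.map_cons, List.sum_cons]

theorem hd_projective (P : FM k R) [Module.Projective R P] (N : FM k R) (K : Submodule R N) :
    hd P N = hd P (N.sub K) + hd P (N.quo K) := by
  let Φ := post P (X := N) (Y := N.quo K) K.mkQ
  let Ψ := post P (X := N.sub K) (Y := N) K.subtype
  have h1 := LinearMap.finrank_range_add_finrank_ker Φ
  have h2 : LinearMap.range Φ = ⊤ := LinearMap.range_eq_top.2 fun φ =>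
    Module.projective_lifting_property K.mkQ φ K.mkQ_surjective
  have h3 : LinearMap.ker Φ = LinearMap.range Ψ := by
    ext φ
    constructor
    · intro h
      exact ⟨φ.codRestrict K fun x =>
        (Submodule.Quotient.mk_eq_zero K).1 (LinearMap.congr_fun h x), rfl⟩
    · rintro ⟨ψ, rfl⟩
      ext x
      exact (Submodule.Quotient.mk_eq_zero K).2 (ψ x).2
  have h4 : Function.Injective Ψ := fun a b hab => by
    ext x
    exact LinearMap.congr_fun hab x
  rw [h2, finrank_top, h3, LinearMap.finrank_range_of_inj h4, add_comm] at h1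
  exact h1.symm

theorem split_iso {X Q : FM k R} (q : X →ₗ[R] Q) (σ : Q →ₗ[R] X) (h : q ∘ₗ σ = LinearMap.id) :
    Iso X (Q.prod (X.sub (LinearMap.ker q))) := by
  have h' : ∀ y, q (σ y) = y := LinearMap.congr_fun h
  let f : X →ₗ[R] Q.prod (X.sub (LinearMap.ker q)) :=
    q.prod ((LinearMap.id - σ ∘ₗ q).codRestrict _ fun x => by
      rw [LinearMap.mem_ker, LinearMap.sub_apply, map_sub, LinearMap.comp_apply, h']
      exact sub_self _)
  refine Iso.of_bijective (f := f) ⟨?_, ?_⟩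
  · rw [injective_iff_map_eq_zero]
    intro x hx
    have h1 : q x = 0 := (Prod.ext_iff.1 hx).1
    have h2 : x - σ (q x) = 0 := Subtype.ext_iff.1 (Prod.ext_iff.1 hx).2
    rwa [h1, map_zero, sub_zero] at h2
  · rintro ⟨y, x, hx⟩
    rw [LinearMap.mem_ker] at hx
    refine ⟨σ y + x, Prod.ext ?_ (Subtype.ext ?_)⟩
    · show q (σ y + x) = y
      rw [map_add, h', hx, add_zero]
    · show σ y + x - σ (q (σ y + x)) = x
      rw [map_add, h', hx, add_zero, add_sub_cancel_left]

theorem lprod_mem_summand {ι : Type*} (U : ι → FM k R) {l : List ι} {i : ι} (h : i ∈ l) :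
    ∃ C, Iso (lprod U l) ((U i).prod C) := by
  classical
  exact ⟨lprod U (l.erase i), lprod_perm U (List.perm_cons_erase h)⟩

theorem projective_of_retract {X L : FM k R} [Module.Projective R X] (i : L →ₗ[R] X)
    (q : X →ₗ[R] L) (h : q ∘ₗ i = LinearMap.id) : Module.Projective R L :=
  Module.Projective.of_split i q h

theorem projective_of_summand {X L C : FM k R} (hX : Module.Projective R X)
    (e : Iso X (L.prod C)) : Module.Projective R L := by
  obtain ⟨e⟩ := e
  have : Module.Projective R (L × C) := Module.Projective.of_equiv e
  exact projective_of_retract (X := L.prod C) (LinearMap.inl R L C) (LinearMap.fst R L C)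
    (by ext; simp)

/-- Indecomposable projectives are local. -/
theorem Indec.eq_top_of_sup {P : FM k R} [Module.Projective R P] (hP : Indec P)
    {K K' : Submodule R P} (h : K ⊔ K' = ⊤) (hK' : K' ≠ ⊤) : K = ⊤ := by
  have hs : Function.Surjective (K'.mkQ ∘ₗ K.subtype) := fun y => by
    obtain ⟨x, rfl⟩ := K'.mkQ_surjective y
    obtain ⟨a, ha, b, hb, rfl⟩ := Submodule.mem_sup.1 (h.ge (Submodule.mem_top (x := x)))
    refine ⟨⟨a, ha⟩, ?_⟩
    rw [map_add, Submodule.mkQ_apply _ b, (Submodule.Quotient.mk_eq_zero K').2 hb, add_zero]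
    rfl
  obtain ⟨e, he⟩ := Module.projective_lifting_property (K'.mkQ ∘ₗ K.subtype) K'.mkQ hs
  let φ : P →ₗ[R] P := K.subtype ∘ₗ e
  have hφ : ∀ x, K'.mkQ (φ x) = K'.mkQ x := LinearMap.congr_fun he
  rcases hP.bijective_or_nilpotent φ with hb | ⟨n, hn⟩
  · refine top_le_iff.1 fun x _ => ?_
    obtain ⟨y, rfl⟩ := hb.2 x
    exact (e y).2
  · exfalso
    have h1 : ∀ (m : ℕ) x, K'.mkQ ((φ ^ m) x) = K'.mkQ x := fun m => by
      induction m with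
      | zero => exact fun x => rfl
      | succ m ih => intro x; rw [pow_succ, Module.End.mul_apply, ih, hφ]
    refine hK' (top_le_iff.1 fun x _ => ?_)
    have := h1 n x
    rw [hn, LinearMap.zero_apply, map_zero] at this
    exact (Submodule.Quotient.mk_eq_zero K').1 this.symm

theorem Indec.exists_max {P : FM k R} [Module.Projective R P] (hP : Indec P) :
    ∃ M : Submodule R P, IsCoatom M ∧ ∀ K : Submodule R P, K ≠ ⊤ → K ≤ M := by
  have : IsNoetherian R P := isNoetherian_of_tower k inferInstance
  have := hP.1
  obtain ⟨M, hM, hm⟩ := (set_has_maximal_iff_noetherian (R := R) (M := P)).2 ‹_›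
    {K | K ≠ ⊤} ⟨⊥, bot_ne_top⟩
  refine ⟨M, ⟨hM, fun K hK => ?_⟩, fun K hK => ?_⟩
  · by_contra h
    exact hm K h hK
  · by_contra h
    refine hm (K ⊔ M) (fun h' => hK (hP.eq_top_of_sup h' hM)) ?_
    exact lt_of_le_of_ne le_sup_right fun h' => h (h' ▸ le_sup_left)

theorem surjective_of_simple {X C : FM k R} (hC : IsSimpleModule R C) {f : X →ₗ[R] C}
    (hf : f ≠ 0) : Function.Surjective f :=
  LinearMap.surjective_of_ne_zero hf

theorem iso_of_simple_quotient {P Q C : FM k R} [Module.Projective R P] [Module.Projective R Q]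
    (hP : Indec P) (hQ : Indec Q) (hC : IsSimpleModule R C) {f : P →ₗ[R] C} {g : Q →ₗ[R] C}
    (hf : f ≠ 0) (hg : g ≠ 0) : Iso P Q := by
  have hfs := surjective_of_simple hC hf
  obtain ⟨φ, hφ⟩ := Module.projective_lifting_property g f (surjective_of_simple hC hg)
  have h1 : LinearMap.range φ ⊔ LinearMap.ker g = ⊤ := by
    refine top_le_iff.1 fun y _ => ?_
    obtain ⟨x, hx⟩ := hfs (g y)
    rw [← add_sub_cancel (φ x) y]
    refine Submodule.add_mem_sup ⟨x, rfl⟩ ?_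
    rw [LinearMap.mem_ker, map_sub, sub_eq_zero, ← hx, ← hφ]
    rfl
  have h2 := hQ.eq_top_of_sup h1 fun h => hg (LinearMap.ker_eq_top.1 h)
  obtain ⟨σ, hσ⟩ := Module.projective_lifting_property φ LinearMap.id
    (LinearMap.range_eq_top.1 h2)
  exact Iso.of_bijective (Indec.bijective_of_comp' hP hQ φ σ (by
    rw [hσ]; exact Function.bijective_id))

theorem iso_top_of_simple {P C : FM k R} {M : Submodule R P}
    (hM : ∀ K : Submodule R P, K ≠ ⊤ → K ≤ M) (hM' : M ≠ ⊤)
    (hC : IsSimpleModule R C) {f : P →ₗ[R] C} (hf : f ≠ 0) : Iso C (P.quo M) := by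
  have hs := surjective_of_simple hC hf
  have h1 : IsCoatom (LinearMap.ker f) := by
    rw [← isSimpleModule_iff_isCoatom]
    exact IsSimpleModule.congr (f.quotKerEquivOfSurjective hs)
  have h2 : LinearMap.ker f = M := by
    by_contra hne
    exact hM' (h1.2 M (lt_of_le_of_ne (hM _ h1.1) hne))
  subst h2
  exact ⟨(f.quotKerEquivOfSurjective hs).symm⟩

/-- Nonzero modules have simple submodules. -/
theorem exists_simple_sub (N : FM k R) (h : Nontrivial N) :
    ∃ C : Submodule R N, IsSimpleModule R C := by
  have : IsArtinian R N := isArtinian_of_tower k inferInstance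
  obtain ⟨C, hC⟩ := IsAtomic.exists_atom (Submodule R N)
  exact ⟨C, isSimpleModule_iff_isAtom.2 hC⟩

variable (k R) in
/-- The regular module. -/
abbrev reg [Module.Finite k R] : FM k R := ⟨R⟩

theorem Gen.of_reg [Module.Finite k R] {ι : Type*} {U : ι → FM k R} {l : List ι}
    (e : Iso (reg k R) (lprod U l)) (X : FM k R) : Gen U Set.univ X := by
  refine top_le_iff.1 fun x _ => ?_
  obtain ⟨e⟩ := e
  have := range_lprod_le_tr (U := U) (s := Set.univ) (l := l) (fun _ _ => trivial)
    (LinearMap.toSpanSingleton R X x ∘ₗ e.symm.toLinearMap)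
  refine this ⟨e 1, ?_⟩
  simp

theorem fac_reg [Module.Finite k R] (X : FM k R) : Fac (reg k R) X :=
  Gen.of_reg (l := [()]) (prod_zero_iso _).symm X

theorem pow_iso_lprod {ι : Type*} {U : ι → FM k R} {X : FM k R} {l : List ι}
    (e : Iso X (lprod U l)) (n : ℕ) : ∃ l' : List ι, Iso (X.pow n) (lprod U l') := by
  induction n with
  | zero => exact ⟨[], iso_of_subsingleton (inferInstanceAs (Subsingleton (Fin 0 → X)))
      (inferInstanceAs (Subsingleton PUnit))⟩
  | succ n ih =>
    obtain ⟨l', h⟩ := ih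
    have e1 : Iso (X.pow (n + 1)) (X.prod (X.pow n)) :=
      ⟨(Fin.consLinearEquiv R (fun _ : Fin (n + 1) => (X : Type))).symm⟩
    exact ⟨l ++ l', e1.trans ((e.prod h).trans (lprod_append U l l').symm)⟩

/-- A complete set of indecomposable projectives. -/
structure IsProjSystem {n : ℕ} (P : Fin n → FM k R) : Prop where
  proj : ∀ i, Module.Projective R (P i)
  indec : ∀ i, Indec (P i)
  ne : ∀ i j, i ≠ j → ¬ Iso (P i) (P j)
  gen : ∀ X, Gen P Set.univ X
  exists_iso : ∀ Q : FM k R, Module.Projective R Q → ∃ l : List (Fin n), Iso Q (lprod P l)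

variable (k R) in
theorem exists_projSystem [Module.Finite k R] [IsAlgClosed k] :
    ∃ (n : ℕ) (P : Fin n → FM k R), IsProjSystem P := by
  obtain ⟨l, hl⟩ := exists_lprod (reg k R)
  obtain ⟨n, P, h1, h2, h3⟩ := exists_reps l
  obtain ⟨l', hl'⟩ := lprod_reps h3
  have e := hl.trans hl'
  have hind : ∀ i, Indec (P i) := fun i => by
    obtain ⟨Y, _, h⟩ := h1 i
    rw [h]; exact Y.2
  refine ⟨n, P, fun i => ?_, hind, h2, Gen.of_reg e, fun Q hQ => ?_⟩
  · obtain ⟨Y, hY, h⟩ := h1 i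
    rw [h]
    obtain ⟨C, hC⟩ := lprod_mem_summand Subtype.val hY
    exact projective_of_summand (inferInstanceAs (Module.Projective R R)) (hl.trans hC)
  · obtain ⟨m, q, hq⟩ := (fac_reg Q).exists_surjective
    obtain ⟨σ, hσ⟩ := Module.projective_lifting_property q LinearMap.id hq
    obtain ⟨l1, e1⟩ := pow_iso_lprod e m
    have e2 := split_iso q σ hσ
    obtain ⟨l2, e3⟩ := exists_lprod Q
    obtain ⟨l3, e4⟩ := lprod_reps (l := l2) (U := P) fun Y hY => by
      obtain ⟨C, hC⟩ := lprod_mem_summand Subtype.val hY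
      obtain ⟨i, -, hi⟩ := exists_iso_of_summand hind (l := l1) Y.2
        (e1.symm.trans (e2.trans (((e3.trans hC).prod (.refl _)).trans (prod_assoc_iso _ _ _))))
      exact ⟨i, hi⟩
    exact ⟨l3, e3.trans e4⟩

/-- Projective covers. -/
theorem exists_proj_cover [Module.Finite k R] (X : FM k R) :
    ∃ (P : FM k R) (p : P →ₗ[R] X), Module.Projective R P ∧ Function.Surjective p ∧
      SuperfluousSubmodule (LinearMap.ker p) := by
  let Q : ℕ → Prop := fun n => ∃ (P : FM k R) (p : P →ₗ[R] X), dim P = n ∧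
    Module.Projective R P ∧ Function.Surjective p
  have hQ : ∃ n, Q n := by
    obtain ⟨n, q, hq⟩ := (fac_reg X).exists_surjective
    exact ⟨_, _, q, rfl, inferInstanceAs (Module.Projective R (Fin n → R)), hq⟩
  classical
  obtain ⟨P, p, hn, hP, hp⟩ := Nat.find_spec hQ
  refine ⟨P, p, hP, hp, fun K hK => ?_⟩
  have hs : Function.Surjective (p ∘ₗ K.subtype) := fun y => by
    obtain ⟨x, rfl⟩ := hp y
    obtain ⟨a, ha, b, hb, rfl⟩ := Submodule.mem_sup.1 (hK.ge (Submodule.mem_top (x := x)))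
    refine ⟨⟨b, hb⟩, ?_⟩
    rw [map_add, LinearMap.mem_ker.1 ha, zero_add]
    rfl
  obtain ⟨e, he⟩ := Module.projective_lifting_property (p ∘ₗ K.subtype) p hs
  let φ : P →ₗ[R] P := K.subtype ∘ₗ e
  have hφ : ∀ x, p (φ x) = p x := LinearMap.congr_fun he
  have hφn : ∀ (m : ℕ) x, p ((φ ^ m) x) = p x := fun m => by
    induction m with
    | zero => exact fun x => rfl
    | succ m ih => intro x; rw [pow_succ, Module.End.mul_apply, ih, hφ]
  obtain ⟨m, hm, hc⟩ := exists_fitting φ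
  have e1 : Iso P ((P.sub (LinearMap.range (φ ^ m))).prod (P.sub (LinearMap.ker (φ ^ m)))) :=
    ⟨(Submodule.prodEquivOfIsCompl _ _ hc.symm).symm⟩
  have h1 : Nat.find hQ ≤ dim (P.sub (LinearMap.range (φ ^ m))) := by
    refine Nat.find_min' hQ ⟨_, p ∘ₗ (LinearMap.range (φ ^ m)).subtype, rfl,
      projective_of_summand hP e1, fun y => ?_⟩
    obtain ⟨x, rfl⟩ := hp y
    exact ⟨⟨(φ ^ m) x, x, rfl⟩, hφn m x⟩
  have h2 := bijective_of_injective_of_dim_le (X := P.sub (LinearMap.range (φ ^ m)))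
    (LinearMap.range (φ ^ m)).subtype (Submodule.injective_subtype _) (by rw [hn]; exact h1)
  refine top_le_iff.1 fun x _ => ?_
  obtain ⟨⟨_, y, rfl⟩, hy⟩ := h2.2 x
  obtain ⟨m, rfl⟩ := Nat.exists_eq_succ_of_ne_zero (by omega : m ≠ 0)
  rw [← hy]
  show (φ ^ (m + 1)) y ∈ K
  rw [pow_succ', Module.End.mul_apply]
  exact (e _).2

/-- Minimal projective presentations. -/
theorem exists_presentation [Module.Finite k R] (X : FM k R) :
    ∃ (P' P : FM k R) (f : P' →ₗ[R] P) (g : P →ₗ[R] X), Module.Projective R P' ∧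
      Module.Projective R P ∧ Function.Surjective g ∧ LinearMap.range f = LinearMap.ker g ∧
      SuperfluousSubmodule (LinearMap.ker f) := by
  obtain ⟨P, g, hP, hg, -⟩ := exists_proj_cover X
  obtain ⟨P', q, hP', hq, hs⟩ := exists_proj_cover (P.sub (LinearMap.ker g))
  refine ⟨P', P, (LinearMap.ker g).subtype ∘ₗ q, g, hP', hP, hg, ?_, ?_⟩
  · rw [LinearMap.range_comp, LinearMap.range_eq_top.2 hq, Submodule.map_top,
      Submodule.range_subtype]
  · rwa [LinearMap.ker_comp_of_ker_eq_bot _ (Submodule.ker_subtype _)]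

end Projectives
end FM

namespace FM

section Tilting

theorem sum_map_eq_sum_count {ι : Type*} [Fintype ι] [DecidableEq ι] (l : List ι) (f : ι → ℤ) :
    (l.map f).sum = ∑ j, (l.count j : ℤ) * f j := by
  induction l with
  | nil => simp
  | cons i l ih =>
    simp only [List.map_cons, List.sum_cons, ih, List.count_cons, Nat.cast_add, add_mul,
      Finset.sum_add_distrib]
    rw [add_comm]
    congr 1
    simp

theorem cast_count_flatMap {ι κ : Type*} [Fintype ι] [DecidableEq ι] [DecidableEq κ] (l : List ι)
    (t : ι → List κ) (x : κ) :
    ((l.flatMap t).count x : ℤ) = ∑ j, (l.count j : ℤ) * ((t j).count x : ℤ) := by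
  rw [← sum_map_eq_sum_count, List.count_flatMap, Nat.cast_list_sum, List.map_map]
  rfl

variable {k R : Type} [Field k] [Ring R] [Algebra k R]

theorem hd_lprod_cast {ι : Type*} [Fintype ι] [DecidableEq ι] (U : ι → FM k R) (l : List ι)
    (Y : FM k R) : (hd (lprod U l) Y : ℤ) = ∑ i, (l.count i : ℤ) * (hd (U i) Y : ℤ) := by
  rw [← sum_map_eq_sum_count, hd_lprod, Nat.cast_list_sum, List.map_map]
  rfl

/-- `P` has a left `T`-approximation whose terms are sums of members of the family `U`. -/
def HasApprox {ι : Type*} (T : FM k R → Prop) (U : ι → FM k R) (P : FM k R) (a b : List ι) :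
    Prop :=
  ∃ (f : P →ₗ[R] lprod U a) (g : lprod U a →ₗ[R] lprod U b), Approx T f g

variable {ι : Type*} {T : FM k R → Prop} {U : ι → FM k R}

theorem Approx.hasApprox (hT : IsTors T) {P X Y : FM k R} {f : P →ₗ[R] X} {g : X →ₗ[R] Y}
    (h : Approx T f g) {a b : List ι} (ha : Iso X (lprod U a)) (hb : Iso Y (lprod U b)) :
    HasApprox T U P a b := by
  obtain ⟨ea⟩ := ha
  obtain ⟨eb⟩ := hb
  exact ⟨_, _, h.iso hT (.refl R P) ea eb⟩

theorem HasApprox.iso (hT : IsTors T) {P P' : FM k R} {a b : List ι} (h : HasApprox T U P a b)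
    (e : Iso P P') : HasApprox T U P' a b := by
  obtain ⟨f, g, h⟩ := h
  obtain ⟨e⟩ := e
  exact ⟨_, _, h.iso hT e (.refl R _) (.refl R _)⟩

theorem HasApprox.append (hT : IsTors T) {P P' : FM k R} {a b a' b' : List ι}
    (h : HasApprox T U P a b) (h' : HasApprox T U P' a' b') :
    HasApprox T U (P.prod P') (a ++ a') (b ++ b') := by
  obtain ⟨f, g, h⟩ := h
  obtain ⟨f', g', h'⟩ := h'
  exact (h.prod hT h').hasApprox hT (lprod_append U a a').symm (lprod_append U b b').symm

theorem HasApprox.nil (hT : IsTors T) : HasApprox T U zero [] [] :=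
  ⟨LinearMap.id, LinearMap.id, hT.zero _ (inferInstanceAs (Subsingleton PUnit)),
    fun _ h => ⟨h, rfl⟩, fun x => ⟨x, rfl⟩, by
      refine le_antisymm (fun x _ => rfl) fun x _ => ⟨x, rfl⟩⟩

theorem HasApprox.lprod (hT : IsTors T) {κ : Type*} {P : κ → FM k R} {t0 t1 : κ → List ι}
    (h : ∀ j, HasApprox T U (P j) (t0 j) (t1 j)) (l : List κ) :
    HasApprox T U (FM.lprod P l) (l.flatMap t0) (l.flatMap t1) := by
  induction l with
  | nil => exact HasApprox.nil hT
  | cons j l ih => exact (h j).append hT ih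

theorem HasApprox.hd_eq [Fintype ι] [DecidableEq ι] {P N : FM k R} {a b : List ι}
    (h : HasApprox T U P a b) (hN : T N) :
    (hd P N : ℤ) = ∑ i, ((a.count i : ℤ) - b.count i) * hd (U i) N := by
  obtain ⟨f, g, h⟩ := h
  have := h.hd_eq hN
  have h' : (hd (FM.lprod U a) N : ℤ) = hd P N + hd (FM.lprod U b) N := by exact_mod_cast this
  rw [hd_lprod_cast, hd_lprod_cast] at h'
  simp only [sub_mul, Finset.sum_sub_distrib]
  linarith

theorem HasApprox.count_eq [IsAlgClosed k] [DecidableEq ι] (hU : ∀ i, Indec (U i))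
    (hne : ∀ i j, i ≠ j → ¬ Iso (U i) (U j)) {P : FM k R} {a b a' b' : List ι}
    (h : HasApprox T U P a b) (h' : HasApprox T U P a' b') (i : ι) :
    a.count i + b'.count i = a'.count i + b.count i := by
  obtain ⟨f, g, h⟩ := h
  obtain ⟨f', g', h'⟩ := h'
  have e := (lprod_append U a b').trans ((h.schanuel h').trans (lprod_append U a' b).symm)
  have := count_eq_of_iso hU hne e i
  rwa [List.count_append, List.count_append] at this

/-- `U` is a complete set of indecomposable Ext-projectives generating the torsion class `T`. -/
structure IsTilt (T : FM k R → Prop) (U : ι → FM k R) : Prop where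
  indec : ∀ i, Indec (U i)
  ne : ∀ i j, i ≠ j → ¬ Iso (U i) (U j)
  ep : ∀ i, EP T (U i)
  mem : ∀ i, T (U i)
  gen : ∀ X, T X → Gen U Set.univ X

theorem IsTilt.exists_row [Module.Finite k R] [IsAlgClosed k] {n m : ℕ} {P : Fin n → FM k R}
    (hP : IsProjSystem P) (hT : IsTors T) {U : Fin m → FM k R} (hU : IsTilt T U)
    {t0 t1 : Fin n → List (Fin m)} (ht : ∀ j, HasApprox T U (P j) (t0 j) (t1 j)) (i : Fin m) :
    ∃ G : Fin n → ℤ, ∀ x, ∑ j, G j * (((t0 j).count x : ℤ) - (t1 j).count x)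
      = if i = x then 1 else 0 := by
  obtain ⟨P', Q, f, g, hP', hQ, hg, hfg, hf⟩ := exists_presentation (U i)
  obtain ⟨p1, e1⟩ := hP.exists_iso P' hP'
  obtain ⟨p0, e0⟩ := hP.exists_iso Q hQ
  refine ⟨fun j => (p0.count j : ℤ) - p1.count j, fun x => ?_⟩
  have h1 := (HasApprox.lprod hT ht p1).iso hT e1.symm
  obtain ⟨a, b, h0⟩ := (HasApprox.lprod hT ht p0).iso hT e0.symm
  obtain ⟨c, hc⟩ := Approx.of_presentation hg hfg
    (fun hN h => (hU.ep i).factor hT hg hfg hf hN h) (hU.mem i) h0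
  have h2 : HasApprox T U P' (p0.flatMap t0) (i :: p0.flatMap t1) := ⟨_, _, hc⟩
  have h3 := h2.count_eq hU.indec hU.ne h1 x
  have h4 : (((p0.flatMap t0).count x + (p1.flatMap t1).count x : ℕ) : ℤ)
    = ((p1.flatMap t0).count x + (i :: p0.flatMap t1).count x : ℕ) := by rw [h3]
  rw [List.count_cons] at h4
  push_cast at h4
  simp only [cast_count_flatMap] at h4
  simp only [sub_mul, mul_sub, Finset.sum_sub_distrib]
  have h5 : ((if (i == x) = true then 1 else 0 : ℤ)) = if i = x then 1 else 0 := by simp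
  rw [h5] at h4
  linarith

theorem exists_simple_layer [Module.Finite k R] {n : ℕ} {P : Fin n → FM k R}
    (hP : IsProjSystem P) (hT : IsTors T) (j : Fin n) (hs : ∃ N, T N ∧ 0 < hd (P j) N) :
    ∃ N N' : FM k R, ∃ d : ℕ, 0 < d ∧ T N ∧ T N' ∧
      ∀ i, hd (P i) N = hd (P i) N' + if i = j then d else 0 := by
  classical
  have hq : ∃ d, ∃ N, T N ∧ 0 < hd (P j) N ∧ dim N = d :=
    hs.elim fun N h => ⟨_, N, h.1, h.2, rfl⟩
  obtain ⟨N, hN, hpos, hd'⟩ := Nat.find_spec hq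
  have hnt : Nontrivial N := by
    obtain ⟨f, hf⟩ := hd_pos_iff.1 hpos
    by_contra h
    rw [not_nontrivial_iff_subsingleton] at h
    exact hf (by ext x; exact Subsingleton.elim _ _)
  obtain ⟨C, hC⟩ := exists_simple_sub N hnt
  have hC0 : C ≠ ⊥ := fun h => by
    subst h
    exact (not_nontrivial_iff_subsingleton.2
      (inferInstanceAs (Subsingleton (⊥ : Submodule R N)))) hC.nontrivial
  have hNC : T (N.quo C) := hT.quot C.mkQ C.mkQ_surjective hN
  have hsum : ∀ i, hd (P i) N = hd (P i) (N.quo C) + hd (P i) (N.sub C) := fun i => by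
    have := hP.proj i
    rw [hd_projective (P i) N C, add_comm]
  have hCj : 0 < hd (P j) (N.sub C) := by
    by_contra h
    refine Nat.find_min hq (m := dim (N.quo C)) (by rw [← hd']; exact dim_quo_lt hC0)
      ⟨_, hNC, ?_, rfl⟩
    have := hsum j
    omega
  refine ⟨N, N.quo C, hd (P j) (N.sub C), hCj, hN, hNC, fun i => ?_⟩
  rw [hsum i]
  congr 1
  split_ifs with h
  · rw [h]
  · rw [hd_eq_zero_iff]
    intro f
    by_contra hf
    obtain ⟨g, hg⟩ := hd_pos_iff.1 hCj
    have := hP.proj i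
    have := hP.proj j
    exact hP.ne i j h (iso_of_simple_quotient (C := N.sub C) (hP.indec i) (hP.indec j) hC hf hg)

theorem IsTilt.card_eq [Module.Finite k R] [IsAlgClosed k] {n m : ℕ} {P : Fin n → FM k R}
    (hP : IsProjSystem P) (hT : IsTors T) (hs : ∀ j, ∃ N, T N ∧ 0 < hd (P j) N)
    {U : Fin m → FM k R} (hU : IsTilt T U)
    {t0 t1 : Fin n → List (Fin m)} (ht : ∀ j, HasApprox T U (P j) (t0 j) (t1 j)) : m = n := by
  let Γ : Matrix (Fin n) (Fin m) ℤ := fun j x => (((t0 j).count x : ℤ) - (t1 j).count x)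
  choose G hG using hU.exists_row hP hT ht
  have h1 : (Matrix.of G) * Γ = 1 := by
    ext i x
    rw [Matrix.mul_apply, Matrix.one_apply]
    exact hG i x
  have h2 : (Γ * Matrix.of G - 1) * Γ = 0 := by
    rw [Matrix.sub_mul, Matrix.mul_assoc, h1, Matrix.mul_one, Matrix.one_mul, sub_self]
  have h3 : ∀ N, T N → (Γ * Matrix.of G - 1).mulVec (fun j => (hd (P j) N : ℤ)) = 0 := by
    intro N hN
    have : (fun j => (hd (P j) N : ℤ)) = Γ.mulVec fun i => (hd (U i) N : ℤ) := by
      ext j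
      exact (ht j).hd_eq hN
    rw [this, Matrix.mulVec_mulVec, h2, Matrix.zero_mulVec]
  have h4 : Γ * Matrix.of G = 1 := by
    rw [← sub_eq_zero]
    ext i j
    obtain ⟨N, N', d, hd0, hN, hN', h⟩ := exists_simple_layer hP hT j (hs j)
    have h5 : (fun i => (hd (P i) N : ℤ)) = (fun i => (hd (P i) N' : ℤ)) + Pi.single j (d : ℤ) := by
      ext i
      rw [h i, Pi.add_apply, Pi.single_apply]
      push_cast
      rfl
    have h6 := h3 N hN
    rw [h5, Matrix.mulVec_add, h3 N' hN', zero_add] at h6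
    have h7 := congrFun h6 i
    rw [Matrix.mulVec_single] at h7
    have h8 : (Γ * Matrix.of G - 1 : Matrix (Fin n) (Fin n) ℤ) i j * (d : ℤ) = 0 := h7
    rcases mul_eq_zero.1 h8 with h9 | h9
    · exact h9
    · omega
  have := Matrix.square_of_invertible (Matrix.of G) Γ h1 h4
  simpa using this

/-- A sincere functorially finite torsion class is generated by as many indecomposable
Ext-projectives as there are indecomposable projectives. -/
theorem exists_isTilt [Module.Finite k R] [IsAlgClosed k] {n : ℕ} {P : Fin n → FM k R}
    (hP : IsProjSystem P) (hT : IsTors T) {M : FM k R} (hM : T M) (hTM : ∀ X, T X → Fac M X)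
    (hs : ∀ j, ∃ N, T N ∧ 0 < hd (P j) N) :
    ∃ (U : Fin n → FM k R) (t0 t1 : Fin n → List (Fin n)), IsTilt T U ∧
      ∀ j, HasApprox T U (P j) (t0 j) (t1 j) := by
  have hA : ∀ j, ∃ (X Y : FM k R) (f : P j →ₗ[R] X) (g : X →ₗ[R] Y),
      Approx T f g ∧ EP T X ∧ EP T Y := fun j =>
    have := hP.proj j
    exists_approx hT hM hTM (P j)
  choose X Y f g hfg hX hY using hA
  choose lX eX using fun j => exists_lprod (X j)
  choose lY eY using fun j => exists_lprod (Y j)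
  obtain ⟨m, U, hU1, hU2, hU3⟩ := exists_reps
    ((List.finRange n).flatMap fun j => lX j ++ lY j)
  have hr0 : ∀ j, ∃ l', Iso (lprod Subtype.val (lX j)) (lprod U l') := fun j =>
    lprod_reps fun Z hZ => hU3 Z (List.mem_flatMap.2
      ⟨j, List.mem_finRange j, List.mem_append_left _ hZ⟩)
  have hr1 : ∀ j, ∃ l', Iso (lprod Subtype.val (lY j)) (lprod U l') := fun j =>
    lprod_reps fun Z hZ => hU3 Z (List.mem_flatMap.2
      ⟨j, List.mem_finRange j, List.mem_append_right _ hZ⟩)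
  choose t0 h0 using hr0
  choose t1 h1 using hr1
  have ht : ∀ j, HasApprox T U (P j) (t0 j) (t1 j) := fun j =>
    (hfg j).hasApprox hT ((eX j).trans (h0 j)) ((eY j).trans (h1 j))
  have hTY : ∀ j, T (Y j) := fun j => hT.quot (g j) (hfg j).surj (hfg j).mem
  have hU4 : ∀ i, Indec (U i) ∧ EP T (U i) ∧ T (U i) := fun i => by
    obtain ⟨Z, hZ, h⟩ := hU1 i
    obtain ⟨j, -, hj⟩ := List.mem_flatMap.1 hZ
    rw [h]
    refine ⟨Z.2, ?_⟩
    rcases List.mem_append.1 hj with hj | hj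
    · obtain ⟨C, hC⟩ := lprod_mem_summand Subtype.val hj
      exact ⟨((hX j).summand ((eX j).trans hC)).1, (hT.summand ((eX j).trans hC) (hfg j).mem).1⟩
    · obtain ⟨C, hC⟩ := lprod_mem_summand Subtype.val hj
      exact ⟨((hY j).summand ((eY j).trans hC)).1, (hT.summand ((eY j).trans hC) (hTY j)).1⟩
  have hU : IsTilt T U := by
    refine ⟨fun i => (hU4 i).1, hU2, fun i => (hU4 i).2.1, fun i => (hU4 i).2.2, fun N hN => ?_⟩
    refine top_le_iff.1 ((hP.gen N).ge.trans (tr_le fun j _ h => ?_))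
    obtain ⟨a, b, hab⟩ := ht j
    obtain ⟨h', rfl⟩ := hab.fac hN h
    exact (LinearMap.range_comp_le_range a h').trans
      (range_lprod_le_tr (fun _ _ => trivial) h')
  obtain rfl := hU.card_eq hP hT hs ht
  exact ⟨U, t0, t1, hU, ht⟩

end Tilting
end FM

namespace FM

section Mutation

variable {k R : Type} [Field k] [Ring R] [Algebra k R] {ι : Type*}
  {T : FM k R → Prop} {U : ι → FM k R}

/-- A nonzero map out of some `U j` can be chosen to vanish on radical maps. -/
theorem exists_radical_socle [Fintype ι] (hU : ∀ i, Indec (U i)) {N : FM k R} {j : ι}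
    {f : U j →ₗ[R] N} (hf : f ≠ 0) :
    ∃ (l : ι) (u : U l →ₗ[R] N), u ≠ 0 ∧
      ∀ (i : ι) (r : U i →ₗ[R] U l), ¬ Function.Bijective r → u ∘ₗ r = 0 := by
  classical
  let μ : (Σ l, U l →ₗ[R] N) → ℕ := fun u =>
    ∑ i, Module.finrank k (LinearMap.range (post (U i) u.2))
  have hq : ∃ d, ∃ u : Σ l, U l →ₗ[R] N, u.2 ≠ 0 ∧ μ u = d := ⟨_, ⟨j, f⟩, hf, rfl⟩
  obtain ⟨⟨l, u⟩, hu, hd'⟩ := Nat.find_spec hq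
  refine ⟨l, u, hu, fun i r hr => ?_⟩
  by_contra hur
  have hle : ∀ x, LinearMap.range (post (U x) (u ∘ₗ r)) ≤ LinearMap.range (post (U x) u) := by
    rintro x _ ⟨a, rfl⟩
    exact ⟨r ∘ₗ a, rfl⟩
  have hfr : ∀ x, Module.finrank k (LinearMap.range (post (U x) (u ∘ₗ r)))
      ≤ Module.finrank k (LinearMap.range (post (U x) u)) :=
    fun x => Submodule.finrank_mono (hle x)
  have hge : μ ⟨l, u⟩ ≤ μ ⟨i, u ∘ₗ r⟩ := by
    rw [hd']
    exact Nat.find_min' hq ⟨⟨i, u ∘ₗ r⟩, hur, rfl⟩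
  have heq := (Finset.sum_eq_sum_iff_of_le fun x _ => hfr x).1
    (le_antisymm (Finset.sum_le_sum fun x _ => hfr x) hge) l (Finset.mem_univ l)
  have hrange := Submodule.eq_of_le_of_finrank_eq (hle l) heq
  obtain ⟨s, hs⟩ := hrange.ge ⟨LinearMap.id, rfl⟩
  have hs' : ∀ x, u (r (s x)) = u x := LinearMap.congr_fun hs
  rcases (hU l).bijective_or_nilpotent (r ∘ₗ s) with hb | ⟨n, hn⟩
  · exact hr (Indec.bijective_of_comp' (hU i) (hU l) r s hb)
  · apply hu
    have hpow : ∀ (n : ℕ) x, u (((r ∘ₗ s) ^ n) x) = u x := fun n => by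
      induction n with
      | zero => exact fun x => rfl
      | succ n ih => intro x; rw [pow_succ, Module.End.mul_apply, ih]; exact hs' x
    ext x
    rw [← hpow n x, hn, LinearMap.zero_apply, map_zero, LinearMap.zero_apply]

variable (U) in
/-- The sum of the images of the radical maps into `U i`. -/
def radImage (i : ι) : Submodule R (U i) :=
  ⨆ (j : ι) (r : {r : U j →ₗ[R] U i // ¬ Function.Bijective r}), LinearMap.range r.1

variable (U) in
/-- The quotient of `U i` by the images of radical maps. -/
abbrev brick (i : ι) : FM k R := (U i).quo (radImage U i)

theorem range_le_radImage {i j : ι} {r : U j →ₗ[R] U i} (hr : ¬ Function.Bijective r) :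
    LinearMap.range r ≤ radImage U i :=
  le_iSup_of_le j (le_iSup (fun r : {r : U j →ₗ[R] U i // ¬ Function.Bijective r} =>
    LinearMap.range r.1) ⟨r, hr⟩)

theorem gen_radImage (i : ι) : Gen U Set.univ ((U i).sub (radImage U i)) := by
  have h : radImage U i ≤ (tr U Set.univ ((U i).sub (radImage U i))).map
      (radImage U i).subtype := by
    refine iSup_le fun j => iSup_le fun r => ?_
    rintro _ ⟨x, rfl⟩
    have hx : ∀ y, r.1 y ∈ radImage U i := fun y => range_le_radImage r.2 ⟨y, rfl⟩
    exact ⟨⟨r.1 x, hx x⟩, range_le_tr (Set.mem_univ j) (r.1.codRestrict _ hx) ⟨x, rfl⟩, rfl⟩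
  refine top_le_iff.1 fun x _ => ?_
  obtain ⟨y, hy, hxy⟩ := h x.2
  rwa [← Subtype.ext hxy]

theorem IsTilt.mem_of_gen (hT : IsTors T) (hU : IsTilt T U) {s : Set ι} {X : FM k R}
    (h : Gen U s X) : T X := hT.of_gen (fun i _ => hU.mem i) h

theorem IsTilt.hom_brick (hT : IsTors T) (hU : IsTilt T U) {i j : ι} (h : j ≠ i)
    (f : U j →ₗ[R] brick U i) : f = 0 := by
  obtain ⟨g, rfl⟩ := hU.ep j (E := U i) (radImage U i).mkQ (Submodule.mkQ_surjective _)
    (by rw [Submodule.ker_mkQ]; exact hU.mem_of_gen hT (gen_radImage i)) f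
  ext x
  exact (Submodule.Quotient.mk_eq_zero _).2
    (range_le_radImage (fun hb => hU.ne j i h (Iso.of_bijective hb)) ⟨x, rfl⟩)

theorem IsTilt.hd_brick_le [IsAlgClosed k] (hT : IsTors T) (hU : IsTilt T U) (i : ι) :
    hd (U i) (brick U i) ≤ 1 := by
  refine finrank_le_one (radImage U i).mkQ fun f => ?_
  obtain ⟨g, rfl⟩ := hU.ep i (E := U i) (radImage U i).mkQ (Submodule.mkQ_surjective _)
    (by rw [Submodule.ker_mkQ]; exact hU.mem_of_gen hT (gen_radImage i)) f
  obtain ⟨c, hc⟩ := (hU.indec i).exists_scalar g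
  refine ⟨c, ?_⟩
  ext x
  have h := (Submodule.Quotient.mk_eq_zero _).2 (range_le_radImage hc ⟨x, rfl⟩)
  have h' : (radImage U i).mkQ (g x - c • x) = 0 := h
  rw [map_sub, sub_eq_zero, LinearMap.map_smul_of_tower] at h'
  exact h'.symm

theorem exists_brick_map [Fintype ι] (hU : ∀ i, Indec (U i)) {N : FM k R} {j : ι}
    {f : U j →ₗ[R] N} (hf : f ≠ 0) :
    ∃ (l : ι) (v : brick U l →ₗ[R] N), v ≠ 0 := by
  obtain ⟨l, u, hu, h⟩ := exists_radical_socle hU hf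
  have hle : radImage U l ≤ LinearMap.ker u := by
    refine iSup_le fun i => iSup_le fun r => ?_
    rintro _ ⟨x, rfl⟩
    exact LinearMap.congr_fun (h i r.1 r.2) x
  refine ⟨l, (radImage U l).liftQ u hle, fun h' => hu ?_⟩
  rw [← (radImage U l).liftQ_mkQ u hle, h', LinearMap.zero_comp]

theorem dim_eq_hd_reg [Module.Finite k R] (N : FM k R) : dim N = hd (reg k R) N := by
  have e : (R →ₗ[R] N) ≃ₗ[k] N :=
    { toFun := fun f => f 1
      map_add' := fun _ _ => rfl
      map_smul' := fun _ _ => rfl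
      invFun := fun x => LinearMap.toSpanSingleton R N x
      left_inv := fun f => by ext; simp
      right_inv := fun x => by simp }
  exact (LinearEquiv.finrank_eq e).symm

theorem IsTilt.dim_eq [Module.Finite k R] [Fintype ι] [DecidableEq ι] {a b : List ι}
    (ha : HasApprox T U (reg k R) a b) {N : FM k R} (hN : T N) {i : ι}
    (h : ∀ j, j ≠ i → ∀ f : U j →ₗ[R] N, f = 0) :
    (dim N : ℤ) = ((a.count i : ℤ) - b.count i) * hd (U i) N := by
  rw [dim_eq_hd_reg, ha.hd_eq hN, Finset.sum_eq_single i]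
  · intro j _ hj
    rw [hd_eq_zero_iff.2 (h j hj), Nat.cast_zero, mul_zero]
  · intro h
    exact absurd (Finset.mem_univ i) h

theorem IsTilt.lift_zero (hU : IsTilt T U) {X : FM k R} {K : Submodule R X}
    (hK : T (X.sub K)) {j : ι} (h : ∀ g : U j →ₗ[R] X, LinearMap.range g ≤ K)
    (f : U j →ₗ[R] X.quo K) : f = 0 := by
  obtain ⟨g, rfl⟩ := hU.ep j (E := X) K.mkQ K.mkQ_surjective (by rwa [Submodule.ker_mkQ]) f
  ext x
  exact (Submodule.Quotient.mk_eq_zero _).2 (h g ⟨x, rfl⟩)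

theorem IsTilt.exists_brick_not_mem [Fintype ι] {T' : FM k R → Prop} (hU : IsTilt T' U)
    (hT' : IsTors T') (hT : IsTors T) {X : FM k R} (hX : T' X) (hX' : ¬ T X) :
    ∃ i, ¬ T (brick U i) := by
  by_contra! h
  refine hX' (hT.of_gen (fun j _ => ?_) (hU.gen X hX))
  obtain ⟨K, hK, h0, -⟩ := hT.exists_torsion (U j)
  have hK' : K = ⊤ := by
    by_contra hne
    have hnt : Nontrivial ((U j).quo K) := Submodule.Quotient.nontrivial_iff.2 hne
    obtain ⟨l, -, f, hf⟩ := (hU.gen _ (hT'.quot (Y := (U j).quo K) K.mkQ K.mkQ_surjective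
      (hU.mem j))).exists_ne_zero hnt
    obtain ⟨l', v, hv⟩ := exists_brick_map hU.indec hf
    exact hv (h0 _ (h l') v)
  subst hK'
  exact hT.iso (X := (U j).sub ⊤) ⟨Submodule.topEquiv⟩ hK

/-- A torsion class strictly below `T'` is contained in the torsion class generated by all but
one of the indecomposable Ext-projectives of `T'`. -/
theorem IsTilt.step [Module.Finite k R] [IsAlgClosed k] [Fintype ι] [DecidableEq ι]
    {T' : FM k R → Prop}
    (hU : IsTilt T' U) (hT' : IsTors T') {a b : List ι} (ha : HasApprox T' U (reg k R) a b)
    (hT : IsTors T) (hle : ∀ X, T X → T' X) {X : FM k R} (hX : T' X) (hX' : ¬ T X) :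
    ∃ i, (∀ N, T N → Gen U {i}ᶜ N) ∧ ¬ Gen U {i}ᶜ (U i) := by
  obtain ⟨i, hi⟩ := hU.exists_brick_not_mem hT' hT hX hX'
  have hnt : Nontrivial (brick U i) := by
    by_contra h
    exact hi (hT.zero _ (not_nontrivial_iff_subsingleton.1 h))
  have hBT : T' (brick U i) := hT'.quot (radImage U i).mkQ (Submodule.mkQ_surjective _) (hU.mem i)
  refine ⟨i, fun N hN => ?_, fun h => ?_⟩
  swap
  · obtain ⟨j, hj, f, hf⟩ := (h.quot (Y := brick U i) (radImage U i).mkQ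
      (Submodule.mkQ_surjective _)).exists_ne_zero hnt
    exact hf (hU.hom_brick hT' hj f)
  by_contra hN'
  let good : FM k R → Prop := fun Q =>
    T Q ∧ Nontrivial Q ∧ ∀ j, j ≠ i → ∀ f : U j →ₗ[R] Q, f = 0
  have hgood : ∃ d, ∃ Q, good Q ∧ dim Q = d := by
    refine ⟨_, N.quo (tr U {i}ᶜ N), ⟨hT.quot (Submodule.mkQ _) (Submodule.mkQ_surjective _) hN,
      Submodule.Quotient.nontrivial_iff.2 hN', fun j hj f => ?_⟩, rfl⟩
    exact hU.lift_zero (hU.mem_of_gen hT' (Gen.sub_tr N)) (fun g => range_le_tr hj g) f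
  classical
  obtain ⟨Q, ⟨hQT, hQn, hQ0⟩, hQd⟩ := Nat.find_spec hgood
  obtain ⟨l, -, f, hf⟩ := (hU.gen Q (hle Q hQT)).exists_ne_zero hQn
  obtain ⟨l', v, hv⟩ := exists_brick_map hU.indec hf
  have hl : l' = i := by
    by_contra hne
    refine hv ?_
    have := hQ0 l' hne (v ∘ₗ (radImage U l').mkQ)
    ext x
    exact LinearMap.congr_fun this x
  subst hl
  let I := LinearMap.range v
  have hIT : T' (Q.sub I) := hT'.range v hBT
  have hI0 : ∀ j, j ≠ l' → ∀ f : U j →ₗ[R] Q.sub I, f = 0 := fun j hj f => by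
    have := hQ0 j hj (I.subtype ∘ₗ f)
    ext x
    exact LinearMap.congr_fun this x
  have hIn : Nontrivial (Q.sub I) :=
    Submodule.nontrivial_iff_ne_bot.2 fun h => hv (LinearMap.range_eq_bot.1 h)
  have hd1 := IsTilt.dim_eq ha hIT hI0
  have hd2 := IsTilt.dim_eq ha hBT fun j hj f => hU.hom_brick hT' hj f
  have hd3 := hU.hd_brick_le hT' l'
  have hd4 : 0 < dim (Q.sub I) := dim_pos_iff.2 hIn
  have hle' : dim (brick U l') ≤ dim (Q.sub I) := by
    have h1 : (hd (U l') (brick U l') : ℤ) ≤ 1 := by exact_mod_cast hd3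
    have h2 : (0 : ℤ) < dim (Q.sub I) := by exact_mod_cast hd4
    have h3 : (0 : ℤ) ≤ hd (U l') (Q.sub I) := Nat.cast_nonneg _
    have h4 : (0 : ℤ) ≤ hd (U l') (brick U l') := Nat.cast_nonneg _
    have h5 : (0 : ℤ) < (a.count l' : ℤ) - b.count l' := by
      by_contra h
      nlinarith
    have h6 : (1 : ℤ) ≤ hd (U l') (Q.sub I) := by
      by_contra h
      have : (hd (U l') (Q.sub I) : ℤ) = 0 := by omega
      rw [this, mul_zero] at hd1
      omega
    have : (dim (brick U l') : ℤ) ≤ dim (Q.sub I) := by nlinarith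
    exact_mod_cast this
  have hinj : Function.Injective v := by
    have := (bijective_of_surjective_of_dim_le (X := brick U l') (Y := Q.sub I) v.rangeRestrict
      v.surjective_rangeRestrict hle').1
    intro x y hxy
    exact this (Subtype.ext hxy)
  have hItop : I = ⊤ := by
    by_contra hne
    refine Nat.find_min hgood (m := dim (Q.quo I)) (by
      rw [← hQd]; exact dim_quo_lt (Submodule.nontrivial_iff_ne_bot.1 hIn))
      ⟨_, ⟨hT.quot I.mkQ I.mkQ_surjective hQT, Submodule.Quotient.nontrivial_iff.2 hne,
        fun j hj f => ?_⟩, rfl⟩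
    refine hU.lift_zero hIT (fun g => ?_) f
    rw [hQ0 j hj g, LinearMap.range_zero]
    exact bot_le
  exact hi (hT.iso (Iso.of_bijective ⟨hinj, LinearMap.range_eq_top.1 hItop⟩).symm hQT)

end Mutation
end FM

namespace FM

section Finiteness

variable {k R : Type} [Field k] [Ring R] [Algebra k R]

theorem fac_lprod_of_gen {ι : Type*} {U : ι → FM k R} {s : Set ι} {l : List ι}
    (hl : ∀ i ∈ s, i ∈ l) {X : FM k R} (h : Gen U s X) : Fac (lprod U l) X := by
  refine top_le_iff.1 (h.ge.trans (tr_le fun i hi f => ?_))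
  obtain ⟨C, ⟨e⟩⟩ := lprod_mem_summand U (hl i hi)
  have h1 : f = (f ∘ₗ LinearMap.fst R (U i) C ∘ₗ e.toLinearMap) ∘ₗ
      (e.symm.toLinearMap ∘ₗ LinearMap.inl R (U i) C) := by
    ext x
    simp
  rw [h1]
  exact (LinearMap.range_comp_le_range _ _).trans
    (range_le_tr (U := single (lprod U l)) (i := ()) (Set.mem_univ ()) _)

theorem isTors_perp (M : FM k R) : IsTors (fun N : FM k R => ∀ f : N →ₗ[R] M, f = 0) where
  zero X hX f := by
    ext x
    rw [Subsingleton.elim x 0, map_zero, map_zero]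
  quot f hf h g := by
    ext y
    obtain ⟨x, rfl⟩ := hf y
    exact LinearMap.congr_fun (h (g ∘ₗ f)) x
  ext {X Y Z} f g hg hfg hX hZ φ := by
    have hk : LinearMap.ker g ≤ LinearMap.ker φ := by
      rw [← hfg]
      rintro _ ⟨x, rfl⟩
      exact LinearMap.congr_fun (hX (φ ∘ₗ f)) x
    have h := hZ ((LinearMap.ker g).liftQ φ hk ∘ₗ
      (g.quotKerEquivOfSurjective hg).symm.toLinearMap)
    ext y
    have := LinearMap.congr_fun h (g y)
    rw [LinearMap.comp_apply, LinearEquiv.coe_coe, show g y =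
      g.quotKerEquivOfSurjective hg (Submodule.Quotient.mk y) from rfl,
      LinearEquiv.symm_apply_apply] at this
    exact this

/-- A sincere functorially finite torsion class. -/
structure IsSincereFF {n : ℕ} (P : Fin n → FM k R) (T : FM k R → Prop) : Prop where
  tors : IsTors T
  sincere : ∀ j, ∃ N, T N ∧ 0 < hd (P j) N
  gen : ∃ M, T M ∧ ∀ X, T X → Fac M X

theorem IsSincereFF.exists_lt [Module.Finite k R] [IsAlgClosed k] {n : ℕ} {P : Fin n → FM k R}
    (hP : IsProjSystem P) {T T' : FM k R → Prop} (h' : IsSincereFF P T') (hT : IsTors T)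
    (hs : ∀ j, ∃ N, T N ∧ 0 < hd (P j) N) (hle : ∀ X, T X → T' X) {X : FM k R} (hX : T' X)
    (hX' : ¬ T X) :
    ∃ T'', IsSincereFF P T'' ∧ (∀ X, T X → T'' X) ∧ (∀ X, T'' X → T' X) ∧
      ∃ X, T' X ∧ ¬ T'' X := by
  obtain ⟨M, hM, hTM⟩ := h'.gen
  obtain ⟨U, t0, t1, hU, ht⟩ := exists_isTilt hP h'.tors hM hTM h'.sincere
  obtain ⟨l, hl⟩ := hP.exists_iso (reg k R) (inferInstanceAs (Module.Projective R R))
  have ha := (HasApprox.lprod h'.tors ht l).iso h'.tors hl.symm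
  obtain ⟨i, h1, h2⟩ := hU.step h'.tors ha hT hle hX hX'
  have hle' : ∀ X, Gen U {i}ᶜ X → T' X := fun X h => hU.mem_of_gen h'.tors h
  have htors : IsTors (Gen U {i}ᶜ) := Gen.isTors (fun j _ => hU.ep j) hle'
  refine ⟨Gen U {i}ᶜ, ⟨htors, fun j => ?_, ?_⟩, h1, hle', U i, hU.mem i, h2⟩
  · obtain ⟨N, hN, hN'⟩ := hs j
    exact ⟨N, h1 N hN, hN'⟩
  · refine ⟨lprod U ((List.finRange n).filter (· ≠ i)), htors.lprod fun j hj => ?_,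
      fun X hX => fac_lprod_of_gen (fun j hj => ?_) hX⟩
    · exact Gen.self (by simpa using hj)
    · simpa using hj

/-- If sincere functorially finite torsion classes are finite in number, there is no infinite
Hom-orthogonal family of nonzero modules with the same support. -/
theorem false_of_family [Module.Finite k R] [IsAlgClosed k] {n : ℕ} {P : Fin n → FM k R}
    (hP : IsProjSystem P) (hfin : {T : FM k R → Prop | IsSincereFF P T}.Finite)
    {Λ : Type} [Infinite Λ] (M : Λ → FM k R) (hM : ∀ a, Nontrivial (M a))
    (horth : ∀ a b, a ≠ b → ∀ f : M a →ₗ[R] M b, f = 0)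
    (hsupp : ∀ a b j, 0 < hd (P j) (M a) → 0 < hd (P j) (M b)) : False := by
  let T : Λ → FM k R → Prop := fun a N => ∀ f : N →ₗ[R] M a, f = 0
  have hT : ∀ a, IsTors (T a) := fun a => isTors_perp (M a)
  have hs : ∀ a j, ∃ N, T a N ∧ 0 < hd (P j) N := fun a j => by
    obtain ⟨b, hb⟩ := exists_ne a
    by_cases h : 0 < hd (P j) (M a)
    · exact ⟨M b, horth b a hb, hsupp a b j h⟩
    · refine ⟨P j, hd_eq_zero_iff.1 (by omega), ?_⟩
      have := (hP.indec j).1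
      refine hd_pos_iff.2 ⟨LinearMap.id, fun h' => ?_⟩
      obtain ⟨x, hx⟩ := exists_ne (0 : P j)
      exact hx (LinearMap.congr_fun h' x)
  have hmem : ∀ a, IsSincereFF P (T a) := fun a => by
    let S : Set (FM k R → Prop) := {T' | IsSincereFF P T' ∧ T a ≤ T'}
    have hS : S.Finite := hfin.subset fun T' h => h.1
    have hne : S.Nonempty := ⟨fun _ => True, ⟨⟨fun _ _ => trivial, fun _ _ _ => trivial,
      fun _ _ _ _ _ _ => trivial⟩, fun j => (hs a j).imp fun N h => ⟨trivial, h.2⟩,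
      reg k R, trivial, fun X _ => fac_reg X⟩, fun _ _ => trivial⟩
    obtain ⟨T', hT'⟩ := hS.exists_minimal hne
    have heq : T' = T a := by
      by_contra hne
      obtain ⟨X, hX, hX'⟩ : ∃ X, T' X ∧ ¬ T a X := by
        by_contra! h
        exact hne (le_antisymm h hT'.prop.2)
      obtain ⟨T'', h1, h2, h3, Y, hY, hY'⟩ :=
        hT'.prop.1.exists_lt hP (hT a) (hs a) hT'.prop.2 hX hX'
      exact hY' (hT'.le_of_le ⟨h1, h2⟩ h3 Y hY)
    rw [← heq]
    exact hT'.prop.1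
  have hinj : Function.Injective T := fun a b hab => by
    by_contra hne
    have h1 : T b (M a) := horth a b hne
    rw [← hab] at h1
    have := hM a
    obtain ⟨x, hx⟩ := exists_ne (0 : M a)
    exact hx (LinearMap.congr_fun (h1 LinearMap.id) x)
  exact Set.infinite_of_injective_forall_mem hinj hmem hfin

end Finiteness
end FM

namespace FM

section Interface

/-- Finitely generated modules over a finite-dimensional algebra. -/
abbrev ofMod (k : Type) {R : Type} [Field k] [Ring R] [Algebra k R] [Module.Finite k R]
    (M : Type) [AddCommGroup M] [Module R M] [Module.Finite R M] : FM k R :=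
  letI : Module k M := Module.compHom M (algebraMap k R)
  haveI : IsScalarTower k R M := .of_algebraMap_smul fun _ _ => rfl
  haveI : Module.Finite k M := Module.Finite.trans R M
  { carrier := M }

theorem finite_mod {k R : Type} [Field k] [Ring R] [Algebra k R] (X : FM k R) :
    Module.Finite R X :=
  Module.Finite.of_restrictScalars_finite k R X

theorem finite_of_summand {R M L L' : Type} [Ring R] [AddCommGroup M] [AddCommGroup L]
    [AddCommGroup L'] [Module R M] [Module R L] [Module R L'] [Module.Finite R M]
    (e : M ≃ₗ[R] (L × L')) : Module.Finite R L ∧ Module.Finite R L' :=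
  have := Module.Finite.equiv e
  ⟨Module.Finite.of_surjective (LinearMap.fst R L L') LinearMap.fst_surjective,
    Module.Finite.of_surjective (LinearMap.snd R L L') LinearMap.snd_surjective⟩

theorem finite_of_superfluous {R P M : Type} [Ring R] [AddCommGroup P] [AddCommGroup M]
    [Module R P] [Module R M] [Module.Finite R M] {g : P →ₗ[R] M} (hg : Function.Surjective g)
    (h : SuperfluousSubmodule (LinearMap.ker g)) : Module.Finite R P := by
  obtain ⟨n, q, hq⟩ := Module.Finite.exists_fin' R M
  obtain ⟨r, hr⟩ := Module.projective_lifting_property g q hg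
  have htop : LinearMap.ker g ⊔ LinearMap.range r = ⊤ := by
    refine top_le_iff.1 fun x _ => ?_
    obtain ⟨y, hy⟩ := hq (g x)
    rw [← sub_add_cancel x (r y)]
    refine Submodule.add_mem_sup ?_ ⟨y, rfl⟩
    rw [LinearMap.mem_ker, map_sub, sub_eq_zero, ← hy, ← hr]
    rfl
  exact Module.Finite.of_surjective r (LinearMap.range_eq_top.1 (h _ htop))

theorem exists_dual_basis {B P : Type} [Ring B] [AddCommGroup P] [Module Bᵐᵒᵖ P]
    [Module.Projective Bᵐᵒᵖ P] [Module.Finite Bᵐᵒᵖ P] :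
    ∃ (n : ℕ) (x : Fin n → P) (e : Fin n → P →ₗ[Bᵐᵒᵖ] B), ∀ p, p = ∑ s, op (e s p) • x s := by
  obtain ⟨n, q, hq⟩ := Module.Finite.exists_fin' Bᵐᵒᵖ P
  obtain ⟨σ, hσ⟩ := Module.projective_lifting_property q LinearMap.id hq
  refine ⟨n, fun s => q (Pi.single s 1), fun s =>
    { toFun := fun p => unop (σ p s)
      map_add' := fun p p' => by rw [map_add, Pi.add_apply, MulOpposite.unop_add]
      map_smul' := fun b p => by
        rw [map_smul, Pi.smul_apply, smul_eq_mul, MulOpposite.unop_mul]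
        rfl }, fun p => ?_⟩
  have h1 : q (σ p) = p := LinearMap.congr_fun hσ p
  conv_lhs => rw [← h1, ← Finset.univ_sum_single (σ p), map_sum]
  refine Finset.sum_congr rfl fun s _ => ?_
  rw [← map_smul]
  congr 1
  ext i
  by_cases h : i = s
  · subst h; simp
  · simp [Pi.single_eq_of_ne h]

variable {k B : Type} [Field k] [Ring B] [Algebra k B]

/-- Ext-projectives of a torsion class are `τ`-rigid. -/
theorem EP.isTauRigid [Module.Finite k Bᵐᵒᵖ] {T : FM k Bᵐᵒᵖ → Prop} (hT : IsTors T)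
    {X : FM k Bᵐᵒᵖ} (hX : EP T X) (hTX : T X) : IsTauRigid k B (ModuleCat.of Bᵐᵒᵖ X) := by
  intro P1 P0 f g ⟨h1, h0, hg, hfg, hsg, hsf⟩ β hβ hβ'
  have fX : Module.Finite Bᵐᵒᵖ (ModuleCat.of Bᵐᵒᵖ X) := finite_mod X
  have f0 : Module.Finite Bᵐᵒᵖ P0 := finite_of_superfluous hg hsg
  have hN : IsNoetherianRing Bᵐᵒᵖ := isNoetherian_of_tower k inferInstance
  have hN' : IsNoetherian Bᵐᵒᵖ P0 := isNoetherian_of_isNoetherianRing_of_finite _ _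
  have f1 : Module.Finite Bᵐᵒᵖ P1 := by
    have hs : SuperfluousSubmodule (LinearMap.ker f.rangeRestrict) := by
      rwa [LinearMap.ker_rangeRestrict]
    exact finite_of_superfluous f.surjective_rangeRestrict hs
  obtain ⟨n, y, d, hd⟩ := exists_dual_basis (B := B) (P := P1)
  obtain ⟨m, x, e, he⟩ := exists_dual_basis (B := B) (P := P0)
  ext u h
  let u' : X := u
  let φ : P1 →ₗ[Bᵐᵒᵖ] X :=
    { toFun := fun p => op (h p) • u'
      map_add' := fun p p' => by rw [map_add, MulOpposite.op_add, add_smul]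
      map_smul' := fun b p => by
        rw [map_smul, MulOpposite.smul_eq_mul_unop, MulOpposite.op_mul, MulOpposite.op_unop,
          mul_smul]
        rfl }
  obtain ⟨ψ, hψ⟩ := hX.factor (P := ofMod k P0) (P' := ofMod k P1) hT (f := f) (g := g) hg hfg
    hsf hTX φ
  have hψ' : ∀ p, ψ (f p) = op (h p) • u' := LinearMap.congr_fun hψ
  have hh : h = ∑ t, leftMulHom B (h (y t)) (d t) := by
    ext p
    conv_lhs => rw [hd p, map_sum]
    rw [LinearMap.sum_apply]
    refine Finset.sum_congr rfl fun t _ => ?_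
    rw [map_smul]
    rfl
  have hc : ∀ s, ∑ t, leftMulHom B (e s (f (y t))) (d t) = (e s).comp f := fun s => by
    ext p
    conv_rhs => rw [LinearMap.comp_apply, hd p, map_sum, map_sum]
    rw [LinearMap.sum_apply]
    refine Finset.sum_congr rfl fun t _ => ?_
    rw [map_smul, map_smul]
    rfl
  have hu : ∀ t, (op (h (y t)) • u : ModuleCat.of Bᵐᵒᵖ X)
      = ∑ s, op (e s (f (y t))) • (ψ (x s) : ModuleCat.of Bᵐᵒᵖ X) := fun t => by
    refine (hψ' (y t)).symm.trans ?_
    conv_lhs => rw [he (f (y t))]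
    refine (map_sum ψ _ _).trans (Finset.sum_congr rfl fun s _ => ?_)
    exact map_smul ψ _ _
  have : ∀ t, β u (leftMulHom B (h (y t)) (d t))
      = ∑ s, β (ψ (x s) : ModuleCat.of Bᵐᵒᵖ X) (leftMulHom B (e s (f (y t))) (d t)) := fun t => by
    rw [← hβ, hu, map_sum, LinearMap.sum_apply]
    exact Finset.sum_congr rfl fun s _ => hβ _ _ _
  conv_lhs => rw [hh, map_sum]
  rw [Finset.sum_congr rfl fun t _ => this t, Finset.sum_comm]
  refine Finset.sum_eq_zero fun s _ => ?_
  rw [← map_sum, hc]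
  exact hβ' _ _

theorem Indec.indecomposableMod [Module.Finite k Bᵐᵒᵖ] {X : FM k Bᵐᵒᵖ} (h : Indec X) :
    IndecomposableMod B (ModuleCat.of Bᵐᵒᵖ X) := by
  refine ⟨h.1, fun L L' ⟨e⟩ => ?_⟩
  have fX : Module.Finite Bᵐᵒᵖ (ModuleCat.of Bᵐᵒᵖ X) := finite_mod X
  obtain ⟨h1, h2⟩ := finite_of_summand e
  exact h.prod_cases (L := ofMod k L) (L' := ofMod k L') ⟨e⟩

theorem indec_ofMod [Module.Finite k Bᵐᵒᵖ] {M : ModuleCat.{0} Bᵐᵒᵖ} [Module.Finite Bᵐᵒᵖ M]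
    (h : IndecomposableMod B M) : Indec (ofMod k M : FM k Bᵐᵒᵖ) :=
  indec_of_iff_prod h.1 fun L L' ⟨e⟩ =>
    h.2 (ModuleCat.of Bᵐᵒᵖ L) (ModuleCat.of Bᵐᵒᵖ L') ⟨e⟩

theorem IsProjSystem.rankK0Is [Module.Finite k Bᵐᵒᵖ] {n : ℕ} {P : Fin n → FM k Bᵐᵒᵖ}
    (hP : IsProjSystem P) : RankK0Is B n := by
  have hmax := fun i =>
    have := hP.proj i
    (hP.indec i).exists_max
  choose M hM hM' using hmax
  have hs : ∀ i, IsSimpleModule Bᵐᵒᵖ ((P i).quo (M i)) := fun i =>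
    isSimpleModule_iff_isCoatom.2 (hM i)
  have hne : ∀ i, (M i).mkQ ≠ 0 := fun i h => (hM i).1 (by
    rw [← (M i).ker_mkQ, h, LinearMap.ker_zero])
  refine ⟨fun i => ModuleCat.of Bᵐᵒᵖ ((P i).quo (M i)), hs, fun i j hij => ⟨fun e => ?_⟩,
    fun S hS => ?_⟩
  · have := hP.proj i
    have := hP.proj j
    refine hP.ne i j hij (iso_of_simple_quotient (C := (P j).quo (M j)) (hP.indec i) (hP.indec j)
      (hs j) (f := e.toLinearMap ∘ₗ (M i).mkQ) (g := (M j).mkQ) (fun h => hne i ?_) (hne j))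
    ext x
    exact e.map_eq_zero_iff.1 (LinearMap.congr_fun h x)
  · have : Module.Finite Bᵐᵒᵖ S := inferInstance
    have := hS.nontrivial
    obtain ⟨i, -, f, hf⟩ := (hP.gen (ofMod k S)).exists_ne_zero (hS.nontrivial)
    exact ⟨i, iso_top_of_simple (C := ofMod k S) (hM' i) (hM i).1 hS hf⟩

variable [Module.Finite k Bᵐᵒᵖ] [IsAlgClosed k] {n : ℕ} {U : Fin n → FM k Bᵐᵒᵖ}

theorem numIndecSummandsIs_lprod (hU : ∀ i, Indec (U i))
    (hne : ∀ i j, i ≠ j → ¬ Iso (U i) (U j)) :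
    NumIndecSummandsIs B (ModuleCat.of Bᵐᵒᵖ (lprod U (List.finRange n))) n := by
  refine ⟨fun i => ModuleCat.of Bᵐᵒᵖ (U i), fun i => ⟨(hU i).indecomposableMod, ?_⟩,
    fun i j hij => ⟨fun e => hne i j hij ⟨e⟩⟩, fun L ⟨hL, L', ⟨e⟩⟩ => ?_⟩
  · obtain ⟨C, ⟨e⟩⟩ := lprod_mem_summand U (List.mem_finRange i)
    exact ⟨ModuleCat.of Bᵐᵒᵖ C, ⟨e⟩⟩
  · have fX : Module.Finite Bᵐᵒᵖ (ModuleCat.of Bᵐᵒᵖ (lprod U (List.finRange n))) := finite_mod _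
    obtain ⟨h1, h2⟩ := finite_of_summand e
    obtain ⟨i, -, hi⟩ := exists_iso_of_summand hU (L := ofMod k L) (C := ofMod k L')
      (indec_ofMod hL) ⟨e⟩
    exact ⟨i, hi⟩

theorem isBasicMod_lprod (hU : ∀ i, Indec (U i))
    (hne : ∀ i j, i ≠ j → ¬ Iso (U i) (U j)) {l : List (Fin n)} (hl : l.Nodup) :
    IsBasicMod B (ModuleCat.of Bᵐᵒᵖ (lprod U l)) := by
  intro L C ⟨e⟩
  by_contra hL
  have fX : Module.Finite Bᵐᵒᵖ (ModuleCat.of Bᵐᵒᵖ (lprod U l)) := finite_mod _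
  obtain ⟨h1, h2⟩ := finite_of_summand e
  have h3 := (finite_of_summand (.refl Bᵐᵒᵖ (L × C))).2
  have e' : Iso (lprod U l) ((ofMod k L).prod ((ofMod k L).prod (ofMod k C))) := ⟨e⟩
  obtain ⟨D, E, hD, hE⟩ := exists_indec_summand (ofMod k L : FM k Bᵐᵒᵖ)
    (not_subsingleton_iff_nontrivial.1 hL)
  obtain ⟨i, -, hi⟩ := exists_iso_of_summand hU hD
    (e'.trans ((hE.prod (.refl _)).trans (prod_assoc_iso _ _ _)))
  have hm := mult_lprod hU hne hD i hi l
  have hc := List.nodup_iff_count_le_one.1 hl i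
  rw [mult_eq_of_iso D hD e', mult_prod, mult_prod, mult_eq_of_iso D hD hE, mult_prod,
    mult_self hD] at hm
  omega

end Interface
end FM

namespace FM

section Transfer

variable {k : Type} [Field k] [IsAlgClosed k]

theorem finite_isSincereFF {B : Type} [Ring B] [Algebra k B] [Module.Finite k Bᵐᵒᵖ] {n : ℕ}
    {P : Fin n → FM k Bᵐᵒᵖ} (hP : IsProjSystem P)
    (h : ∃ (m : ℕ) (S : Fin m → ModuleCat.{0} Bᵐᵒᵖ), ∀ M : ModuleCat.{0} Bᵐᵒᵖ,
      IsTauTiltingMod k B M → IsBasicMod B M → ∃ i, Nonempty (M ≃ₗ[Bᵐᵒᵖ] S i)) :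
    {T : FM k Bᵐᵒᵖ → Prop | IsSincereFF P T}.Finite := by
  obtain ⟨m, S, hS⟩ := h
  have key : ∀ T : {T : FM k Bᵐᵒᵖ → Prop | IsSincereFF P T}, ∃ (M : FM k Bᵐᵒᵖ) (i : Fin m),
      T.1 M ∧ (∀ X, T.1 X → Fac M X) ∧ Nonempty (M ≃ₗ[Bᵐᵒᵖ] S i) := by
    rintro ⟨T, hT⟩
    obtain ⟨M, hM, hTM⟩ := hT.gen
    obtain ⟨U, -, -, hU, -⟩ := exists_isTilt hP hT.tors hM hTM hT.sincere
    have hX : T (lprod U (List.finRange n)) := hT.tors.lprod fun i _ => hU.mem i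
    have fX := finite_mod (lprod U (List.finRange n))
    obtain ⟨i, hi⟩ := hS (ModuleCat.of Bᵐᵒᵖ (lprod U (List.finRange n)))
      ⟨fX, (EP.lprod fun i _ => hU.ep i).isTauRigid hT.tors hX, n,
        numIndecSummandsIs_lprod hU.indec hU.ne, hP.rankK0Is⟩
      (isBasicMod_lprod hU.indec hU.ne (List.nodup_finRange n))
    exact ⟨_, i, hX, fun X h => fac_lprod_of_gen (fun i _ => List.mem_finRange i) (hU.gen X h), hi⟩
  choose M i h1 h2 h3 using key
  have hle : ∀ T T', i T = i T' → ∀ X, T.1 X → T'.1 X := fun T T' hi X hX => by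
    obtain ⟨e⟩ := h3 T
    obtain ⟨e'⟩ := h3 T'
    rw [← hi] at e'
    exact T'.2.tors.of_fac (T'.2.tors.iso (X := M T') (Y := M T) ⟨e'.trans e.symm⟩ (h1 T'))
      (h2 T X hX)
  exact Set.finite_coe_iff.1 (Finite.of_injective i fun T T' hi =>
    Subtype.ext (le_antisymm (hle T T' hi) (hle T' T hi.symm)))

end Transfer

section Quotient

variable {k A : Type} [Field k] [Ring A] [Algebra k A]

theorem mk_zero_bijective : Function.Bijective (IdemQuot.mk A (0 : A)) := by
  refine ⟨?_, Quotient.mk_surjective⟩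
  intro a b h
  have h1 : (TwoSidedIdeal.span {(0 : A)}).ringCon a b := Quotient.exact h
  have h2 : TwoSidedIdeal.span {(0 : A)} = ⊥ := by
    rw [eq_bot_iff, TwoSidedIdeal.span_le]
    rintro _ rfl
    exact zero_mem _
  rw [h2] at h1
  have h3 := (TwoSidedIdeal.rel_iff _ _ _).1 h1
  rwa [TwoSidedIdeal.mem_bot, sub_eq_zero] at h3

variable (A) in
/-- `A ≃ A/A0A` on opposite rings. -/
def mkEquiv : Aᵐᵒᵖ ≃+* (IdemQuot A (0 : A))ᵐᵒᵖ :=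
  RingEquiv.op (RingEquiv.ofBijective (IdemQuot.mk A 0) mk_zero_bijective)

variable (A) in
/-- Restriction of an `A`-module to `A/A0A`. -/
abbrev down (M : Type) [AddCommGroup M] [Module Aᵐᵒᵖ M] : Module (IdemQuot A (0 : A))ᵐᵒᵖ M :=
  Module.compHom M (mkEquiv A).symm.toRingHom

variable (A) in
/-- Inflation of an `A/A0A`-module to `A`. -/
abbrev up (M : Type) [AddCommGroup M] [Module (IdemQuot A (0 : A))ᵐᵒᵖ M] : Module Aᵐᵒᵖ M :=
  Module.compHom M (RingHom.op (IdemQuot.mk A 0))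

theorem exists_finite_of_tauTiltingFinite (h : TauTiltingFinite k A) :
    ∃ (m : ℕ) (S : Fin m → ModuleCat.{0} (IdemQuot A (0 : A))ᵐᵒᵖ),
      ∀ M : ModuleCat.{0} (IdemQuot A (0 : A))ᵐᵒᵖ, IsTauTiltingMod k (IdemQuot A 0) M →
        IsBasicMod (IdemQuot A 0) M → ∃ i, Nonempty (M ≃ₗ[(IdemQuot A (0 : A))ᵐᵒᵖ] S i) := by
  obtain ⟨m, S, hS⟩ := h
  refine ⟨m, fun i => letI := down A (S i); ModuleCat.of (IdemQuot A (0 : A))ᵐᵒᵖ (S i),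
    fun M hM hM' => ?_⟩
  let _ : Module Aᵐᵒᵖ M := up A M
  have hsmul : ∀ (b : (IdemQuot A (0 : A))ᵐᵒᵖ) (x : M), b • x = (mkEquiv A).symm b • x := by
    intro b x
    conv_lhs => rw [← (mkEquiv A).apply_symm_apply b]
    rfl
  obtain ⟨i, ⟨e⟩⟩ := hS (ModuleCat.of Aᵐᵒᵖ M) ⟨0, IsIdempotentElem.zero, M, hM,
    ⟨LinearEquiv.refl Aᵐᵒᵖ M⟩⟩ (by
      intro L C ⟨e⟩
      let _ := down A L
      let _ := down A C
      exact hM' (ModuleCat.of (IdemQuot A (0 : A))ᵐᵒᵖ L)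
        (ModuleCat.of (IdemQuot A (0 : A))ᵐᵒᵖ C) ⟨{ e with
        map_smul' := fun b x => by
          refine (congrArg e (hsmul b x)).trans ?_
          exact e.map_smul ((mkEquiv A).symm b) x }⟩)
  refine ⟨i, ⟨{ e with
    map_smul' := fun b x => ?_ }⟩⟩
  refine (congrArg e (hsmul b x)).trans ?_
  exact e.map_smul ((mkEquiv A).symm b) x

instance [Module.Finite k A] : Module.Finite k (IdemQuot A (0 : A)) :=
  Module.Finite.of_surjective
    ({ IdemQuot.mk A (0 : A) with
      map_smul' := fun c a => by
        show IdemQuot.mk A 0 (c • a) = c • IdemQuot.mk A 0 a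
        rw [Algebra.smul_def, Algebra.smul_def, map_mul]
        rfl } : A →ₗ[k] IdemQuot A (0 : A)) mk_zero_bijective.2

instance finite_op [Module.Finite k A] : Module.Finite k Aᵐᵒᵖ :=
  Module.Finite.equiv (opLinearEquiv k)

/-- Restriction of finite-dimensional modules to `A/A0A`. -/
abbrev downFM (M : FM k Aᵐᵒᵖ) : FM k (IdemQuot A (0 : A))ᵐᵒᵖ where
  carrier := M.carrier
  modR := down A M.carrier
  tower := by
    let _ := down A M.carrier
    refine .of_algebraMap_smul fun c x => ?_
    show (mkEquiv A).symm (algebraMap k (IdemQuot A (0 : A))ᵐᵒᵖ c) • x = c • x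
    rw [show algebraMap k (IdemQuot A (0 : A))ᵐᵒᵖ c = mkEquiv A (algebraMap k Aᵐᵒᵖ c) from rfl,
      RingEquiv.symm_apply_apply, algebraMap_smul]

/-- An infinite Hom-orthogonal family of modules with the same support prevents `τ`-tilting
finiteness. -/
theorem not_tauTiltingFinite [IsAlgClosed k] [Module.Finite k A] {Λ : Type} [Infinite Λ]
    (M : Λ → FM k Aᵐᵒᵖ) (hM : ∀ a, Nontrivial (M a))
    (horth : ∀ a b, a ≠ b → ∀ f : M a →ₗ[Aᵐᵒᵖ] M b, f = 0)
    (hsupp : ∀ (P : Type) [AddCommGroup P] [Module Aᵐᵒᵖ P] [Module.Projective Aᵐᵒᵖ P] (a b : Λ),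
      (∃ f : P →ₗ[Aᵐᵒᵖ] M a, f ≠ 0) → ∃ f : P →ₗ[Aᵐᵒᵖ] M b, f ≠ 0) :
    ¬ TauTiltingFinite k A := by
  intro h
  obtain ⟨n, P, hP⟩ := exists_projSystem k (IdemQuot A (0 : A))ᵐᵒᵖ
  have hsymm : ∀ a : Aᵐᵒᵖ, (mkEquiv A).symm (mkEquiv A a) = a := (mkEquiv A).symm_apply_apply
  refine false_of_family hP (finite_isSincereFF hP (exists_finite_of_tauTiltingFinite h))
    (fun a => downFM (M a)) hM (fun a b hab f => ?_) fun a b j hj => ?_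
  · have := horth a b hab
      { toFun := f
        map_add' := f.map_add
        map_smul' := fun r x => by
          have h1 := f.map_smul (mkEquiv A r) x
          have h2 : f ((mkEquiv A).symm (mkEquiv A r) • (show M a from x))
            = (mkEquiv A).symm (mkEquiv A r) • (show M b from f x) := h1
          rwa [hsymm] at h2 }
    ext x
    exact LinearMap.congr_fun this x
  · rw [hd_pos_iff] at hj ⊢
    let _ : Module Aᵐᵒᵖ (P j) := up A (P j)
    have hPj := hP.proj j
    have i1 : RingHomInvPair (mkEquiv A).symm.toRingHom (mkEquiv A).toRingHom :=
      ⟨by ext; simp, by ext; simp⟩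
    have i2 : RingHomInvPair (mkEquiv A).toRingHom (mkEquiv A).symm.toRingHom :=
      ⟨by ext; simp, by ext; simp⟩
    have : Module.Projective Aᵐᵒᵖ (P j) :=
      Module.Projective.of_equiv (σ := (mkEquiv A).symm.toRingHom) (σ' := (mkEquiv A).toRingHom)
        (M := P j) (N := P j)
        { AddEquiv.refl (P j) with
          map_smul' := fun b x => by
            conv_lhs => rw [← (mkEquiv A).apply_symm_apply b]
            rfl }
    obtain ⟨f, hf⟩ := hj
    obtain ⟨g, hg⟩ := hsupp (P j) a b ⟨
      { toFun := f
        map_add' := f.map_add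
        map_smul' := fun r x => by
          have h1 := f.map_smul (mkEquiv A r) x
          have h2 : f (r • x)
            = (mkEquiv A).symm (mkEquiv A r) • (show M a from f x) := h1
          rwa [hsymm] at h2 }, fun h => hf (by ext x; exact LinearMap.congr_fun h x)⟩
    refine ⟨
      { toFun := g
        map_add' := g.map_add
        map_smul' := fun b x => by
          have h1 := g.map_smul ((mkEquiv A).symm b) x
          refine Eq.trans (congrArg g ?_) h1
          conv_lhs => rw [← (mkEquiv A).apply_symm_apply b]
          rfl }, fun h => hg (by ext x; exact LinearMap.congr_fun h x)⟩

end Quotient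
end FM

namespace FM

section RepFinite

variable {k A : Type} [Field k] [Ring A] [Algebra k A] [Module.Finite k A]

theorem representationFinite_of_fm {m : ℕ} (U : Fin m → FM k Aᵐᵒᵖ)
    (h : ∀ X : FM k Aᵐᵒᵖ, Indec X → ∃ i, Iso X (U i)) : RepresentationFinite A :=
  ⟨m, fun i => ModuleCat.of Aᵐᵒᵖ (U i), fun M _ hM' => h (ofMod k M) (indec_ofMod hM')⟩

theorem exists_fm_of_representationFinite (h : RepresentationFinite A) :
    ∃ (m : ℕ) (U : Fin m → FM k Aᵐᵒᵖ), (∀ i, Indec (U i)) ∧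
      ∀ X : FM k Aᵐᵒᵖ, Indec X → ∃ i, Iso X (U i) := by
  obtain ⟨m, S, hS⟩ := h
  let I := {i : Fin m // ∃ X : FM k Aᵐᵒᵖ, Indec X ∧ Nonempty (X ≃ₗ[Aᵐᵒᵖ] S i)}
  have : Finite I := Subtype.finite
  obtain ⟨m', ⟨e⟩⟩ := Finite.exists_equiv_fin I
  choose V hV hV' using fun i : I => i.2
  refine ⟨m', fun j => V (e.symm j), fun j => hV _, fun X hX => ?_⟩
  have := finite_mod X
  obtain ⟨i, ⟨f⟩⟩ := hS (ModuleCat.of Aᵐᵒᵖ X) this hX.indecomposableMod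
  refine ⟨e ⟨i, X, hX, ⟨f⟩⟩, ?_⟩
  show Iso X (V (e.symm (e ⟨i, X, hX, ⟨f⟩⟩)))
  rw [e.symm_apply_apply]
  exact ⟨LinearEquiv.trans (M₂ := S i) f (hV' ⟨i, X, hX, ⟨f⟩⟩).some.symm⟩

theorem tauTiltingFinite_of_representationFinite (h : RepresentationFinite A) :
    TauTiltingFinite k A := by
  classical
  obtain ⟨m, U, hU, hX⟩ := exists_fm_of_representationFinite (k := k) h
  have : Fintype {l : List (Fin m) // l.Nodup} := inferInstance
  let e := Fintype.equivFin {l : List (Fin m) // l.Nodup}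
  refine ⟨_, fun j => ModuleCat.of Aᵐᵒᵖ (lprod U (e.symm j).1), ?_⟩
  rintro M ⟨a, -, N, hN, ⟨f⟩⟩ hM
  have hfin : Module.Finite Aᵐᵒᵖ M := by
    let _ : Module Aᵐᵒᵖ N := Module.compHom N (RingHom.op (IdemQuot.mk A a))
    have fN := hN.1
    have : Module.Finite Aᵐᵒᵖ N := by
      obtain ⟨s, hs⟩ := fN.fg_top
      refine ⟨⟨s, eq_top_iff.2 fun x _ => ?_⟩⟩
      have hx : x ∈ Submodule.span (IdemQuot A a)ᵐᵒᵖ (s : Set N) := hs ▸ Submodule.mem_top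
      induction hx using Submodule.span_induction with
      | mem x h => exact Submodule.subset_span h
      | zero => exact zero_mem _
      | add x y _ _ h1 h2 => exact add_mem (h1 trivial) (h2 trivial)
      | smul c x _ h1 =>
        obtain ⟨b, hb⟩ := Quotient.mk_surjective (unop c)
        have : c • x = (op b : Aᵐᵒᵖ) • x := by
          show c • x = op (IdemQuot.mk A a b) • x
          congr 1
          exact congrArg op hb.symm
        rw [this]
        exact Submodule.smul_mem _ _ (h1 trivial)
    exact Module.Finite.equiv f.symm
  obtain ⟨l, hl⟩ := exists_lprod (ofMod k M : FM k Aᵐᵒᵖ)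
  obtain ⟨l', hl'⟩ := lprod_reps (l := l) (U := U) fun Y _ => hX Y.1 Y.2
  have hnd : l'.Nodup := by
    rw [List.nodup_iff_count_le_one]
    intro i
    by_contra! hc
    obtain ⟨t, ht⟩ :=
      (List.replicate_sublist_iff.2 hc : (List.replicate 2 i).Sublist l').exists_perm_append
    obtain ⟨g⟩ := (hl.trans hl').trans (lprod_perm U ht)
    have := hM (ModuleCat.of Aᵐᵒᵖ (U i)) (ModuleCat.of Aᵐᵒᵖ (lprod U t)) ⟨g⟩
    exact not_subsingleton_iff_nontrivial.2 (hU i).1 this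
  refine ⟨e ⟨l', hnd⟩, ?_⟩
  show Nonempty (M ≃ₗ[Aᵐᵒᵖ] (lprod U (e.symm (e ⟨l', hnd⟩)).1))
  rw [e.symm_apply_apply]
  exact hl.trans hl'

end RepFinite
end FM

namespace ZeroHecke

section Perm

variable {r : ℕ}

/-- The lower point moved by `adjSwap r i`. -/
def lo (i : AGen r) : Fin r := ⟨i.1, by have := i.2; omega⟩

/-- The upper point moved by `adjSwap r i`. -/
def hi (i : AGen r) : Fin r := ⟨i.1 + 1, by have := i.2; omega⟩

theorem adjSwap_eq (i : AGen r) : adjSwap r i = Equiv.swap (lo i) (hi i) := rfl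

theorem adjSwap_mul_self (i : AGen r) : adjSwap r i * adjSwap r i = 1 := Equiv.swap_mul_self _ _

theorem adjSwap_ne_one (i : AGen r) : adjSwap r i ≠ 1 := by
  rw [adjSwap_eq, Ne, Equiv.swap_eq_one_iff]
  simp [lo, hi]

theorem mul_adjSwap_mul (w : Equiv.Perm (Fin r)) (i : AGen r) :
    w * adjSwap r i * adjSwap r i = w := by
  rw [mul_assoc, adjSwap_mul_self, mul_one]

theorem mul_adjSwap_lo (w : Equiv.Perm (Fin r)) (i : AGen r) :
    (w * adjSwap r i) (lo i) = w (hi i) := by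
  rw [Equiv.Perm.mul_apply, adjSwap_eq, Equiv.swap_apply_left]

theorem mul_adjSwap_hi (w : Equiv.Perm (Fin r)) (i : AGen r) :
    (w * adjSwap r i) (hi i) = w (lo i) := by
  rw [Equiv.Perm.mul_apply, adjSwap_eq, Equiv.swap_apply_right]

theorem lo_ne_hi (i : AGen r) : lo i ≠ hi i := by simp [lo, hi]

theorem lt_or_gt (w : Equiv.Perm (Fin r)) (i : AGen r) :
    w (lo i) < w (hi i) ∨ w (hi i) < w (lo i) :=
  lt_or_gt_of_ne fun h => lo_ne_hi i (w.injective h)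

theorem invCount_mul_adjSwap {w : Equiv.Perm (Fin r)} {i : AGen r} (h : w (lo i) < w (hi i)) :
    invCount (w * adjSwap r i) = invCount w + 1 := by
  have hsw : ∀ x, adjSwap r i x = if x = lo i then hi i else if x = hi i then lo i else x :=
    fun x => by rw [adjSwap_eq, Equiv.swap_apply_def]
  have hmem : ∀ p q, (p, q) ∈ (Finset.univ.filter (fun p : Fin r × Fin r =>
        p.1 < p.2 ∧ w p.2 < w p.1)).map
          (Equiv.prodCongr (adjSwap r i) (adjSwap r i)).toEmbedding ↔
        adjSwap r i p < adjSwap r i q ∧ w (adjSwap r i q) < w (adjSwap r i p) := by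
    intro p q
    rw [Finset.mem_map_equiv]
    simp [adjSwap_eq, Equiv.prodCongr_symm]
  have hlh : lo i < hi i := Nat.lt_succ_self _
  have hset : (Finset.univ.filter (fun p : Fin r × Fin r =>
        p.1 < p.2 ∧ (w * adjSwap r i) p.2 < (w * adjSwap r i) p.1))
      = insert (lo i, hi i) ((Finset.univ.filter (fun p : Fin r × Fin r =>
        p.1 < p.2 ∧ w p.2 < w p.1)).map
          (Equiv.prodCongr (adjSwap r i) (adjSwap r i)).toEmbedding) := by
    ext ⟨p, q⟩
    rw [Finset.mem_insert, hmem, Finset.mem_filter, Prod.mk.injEq]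
    simp only [Finset.mem_univ, true_and, Equiv.Perm.mul_apply]
    have hl : (lo i : ℕ) = i.1 := rfl
    have hh : (hi i : ℕ) = i.1 + 1 := rfl
    rw [Fin.lt_def] at h
    have hv : ∀ x, (x = lo i ∧ adjSwap r i x = hi i) ∨ (x = hi i ∧ adjSwap r i x = lo i) ∨
        (x.1 ≠ i.1 ∧ x.1 ≠ i.1 + 1 ∧ adjSwap r i x = x) := by
      intro x
      rw [hsw]
      split_ifs with h1 h2
      · exact .inl ⟨h1, rfl⟩
      · exact .inr (.inl ⟨h2, rfl⟩)
      · exact .inr (.inr ⟨fun h => h1 (Fin.ext h), fun h => h2 (Fin.ext h), rfl⟩)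
    rcases hv p with ⟨e1, e2⟩ | ⟨e1, e2⟩ | ⟨h1, h2, e2⟩ <;>
      rcases hv q with ⟨e3, e4⟩ | ⟨e3, e4⟩ | ⟨h3, h4, e4⟩ <;>
      rw [e2, e4] <;> (try rw [e1]) <;> (try rw [e3]) <;>
      simp only [Fin.lt_def, Fin.ext_iff, hl, hh, true_and, true_or, iff_true] <;> omega
  rw [invCount, hset, Finset.card_insert_of_notMem, Finset.card_map]
  · rfl
  · rw [hmem]
    simp only [hsw, lo_ne_hi, (lo_ne_hi i).symm, if_true, if_false]
    exact fun hc => lt_asymm hc.1 hlh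

theorem exists_descent {w : Equiv.Perm (Fin r)} (h : w ≠ 1) :
    ∃ i : AGen r, w (hi i) < w (lo i) := by
  by_contra! hc
  refine h ?_
  have hlt : ∀ i : AGen r, w (lo i) < w (hi i) := fun i =>
    (lt_or_gt w i).resolve_right (not_lt.2 (hc i))
  have hm : StrictMono w := by
    intro x y hxy
    obtain ⟨y, hy⟩ := y
    induction y with
    | zero => exact absurd hxy (Nat.not_lt_zero _)
    | succ m ih =>
      have h1 := hlt ⟨m, by omega⟩
      rcases Nat.lt_succ_iff_lt_or_eq.1 (show x.1 < m + 1 from hxy) with h2 | h2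
      · exact (ih (by omega) h2).trans h1
      · have : x = lo (⟨m, by omega⟩ : AGen r) := Fin.ext h2
        rw [this]
        exact h1
  have := Subsingleton.elim (hm.orderIsoOfSurjective w w.surjective) (OrderIso.refl _)
  ext x
  have h2 := DFunLike.congr_fun this x
  exact congrArg Fin.val h2

end Perm

section Young

variable {n r : ℕ}

theorem psum_succ (lam : Fin n → ℕ) (i j : Fin n) (h : (i : ℕ) + 1 = j) :
    psum lam j = psum lam i + lam i := by
  unfold psum
  rw [show Finset.univ.filter (fun x : Fin n => (x : ℕ) < j)
    = insert i (Finset.univ.filter (fun x : Fin n => (x : ℕ) < i)) by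
      ext x
      simp only [Finset.mem_filter, Finset.mem_univ, true_and, Finset.mem_insert, Fin.ext_iff]
      omega, Finset.sum_insert (by simp), add_comm]

theorem psum_zero (lam : Fin n → ℕ) (i : Fin n) (h : (i : ℕ) = 0) : psum lam i = 0 := by
  simp [psum, h]

theorem psum_last (lam : Fin n → ℕ) (i : Fin n) (h : (i : ℕ) + 1 = n) :
    psum lam i + lam i = ∑ j, lam j := by
  have : (Finset.univ : Finset (Fin n))
      = insert i (Finset.univ.filter (fun x : Fin n => (x : ℕ) < i)) := by
    ext x
    simp only [Finset.mem_filter, Finset.mem_univ, true_and, Finset.mem_insert, Fin.ext_iff,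
      true_iff]
    have := x.2
    omega
  refine Eq.trans ?_ (Finset.sum_congr this.symm fun _ _ => rfl)
  rw [Finset.sum_insert (by simp), add_comm]
  rfl

theorem psum_add_le (lam : Fin n → ℕ) {i j : Fin n} (h : i < j) :
    psum lam i + lam i ≤ psum lam j := by
  unfold psum
  rw [add_comm, ← Finset.sum_insert (s := Finset.univ.filter (fun x : Fin n => (x : ℕ) < i))
    (by simp)]
  refine Finset.sum_le_sum_of_subset fun x => ?_
  simp only [Finset.mem_filter, Finset.mem_univ, true_and, Finset.mem_insert]
  rintro (rfl | hx)
  · exact h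
  · exact hx.trans h

theorem exists_block (lam : Comp n r) (x : Fin r) :
    ∃ m : Fin n, psum lam.1 m ≤ x ∧ (x : ℕ) < psum lam.1 m + lam.1 m := by
  have hn : 0 < n := by
    rcases Nat.eq_zero_or_pos n with rfl | h
    · have := lam.2
      simp only [Finset.univ_eq_empty, Finset.sum_empty] at this
      exact absurd x.2 (by omega)
    · exact h
  by_contra! hc
  have : ∀ m (hm : m < n), psum lam.1 ⟨m, hm⟩ ≤ x := by
    intro m
    induction m with
    | zero => intro hm; rw [psum_zero _ _ rfl]; exact Nat.zero_le _
    | succ m ih =>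
      intro hm
      rw [psum_succ lam.1 ⟨m, by omega⟩ _ rfl]
      exact hc _ (ih _)
  have h1 := hc _ (this (n - 1) (by omega))
  rw [psum_last _ _ (by show n - 1 + 1 = n; omega), lam.2] at h1
  exact absurd x.2 (by omega)

theorem mem_young {lam : Fin n → ℕ} {w : Equiv.Perm (Fin r)} :
    w ∈ YoungFinset lam ↔ ∀ (x : Fin r) (i : Fin n),
    (psum lam i ≤ (x : ℕ) ∧ (x : ℕ) < psum lam i + lam i) →
    (psum lam i ≤ ((w x) : ℕ) ∧ ((w x) : ℕ) < psum lam i + lam i) := by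
  simp [YoungFinset]

theorem young_one (lam : Fin n → ℕ) : (1 : Equiv.Perm (Fin r)) ∈ YoungFinset lam :=
  mem_young.2 fun _ _ h => h

theorem young_mul {lam : Fin n → ℕ} {w w' : Equiv.Perm (Fin r)} (h : w ∈ YoungFinset lam)
    (h' : w' ∈ YoungFinset lam) : w * w' ∈ YoungFinset lam :=
  mem_young.2 fun x i hx => mem_young.1 h _ i (mem_young.1 h' x i hx)

theorem adjSwap_mem_young {lam : Fin n → ℕ} {i : AGen r} {m : Fin n} (h1 : psum lam m ≤ i.1)
    (h2 : i.1 + 1 < psum lam m + lam m) : adjSwap r i ∈ YoungFinset lam := by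
  rw [mem_young]
  intro x m' hx
  have hmm : x = lo i ∨ x = hi i → m' = m := by
    intro h
    have hv : x.1 = i.1 ∨ x.1 = i.1 + 1 := h.imp (congrArg Fin.val) (congrArg Fin.val)
    rcases lt_trichotomy m' m with h | h | h
    · have := psum_add_le lam h
      omega
    · exact h
    · have := psum_add_le lam h
      omega
  rw [adjSwap_eq, Equiv.swap_apply_def]
  split_ifs with h h'
  · rw [hmm (.inl h)]
    exact ⟨by show _ ≤ i.1 + 1; omega, h2⟩
  · rw [hmm (.inr h')]
    exact ⟨h1, by show i.1 < _; omega⟩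
  · exact hx

theorem adjSwap_mem_of_descent {lam : Comp n r} {w : Equiv.Perm (Fin r)}
    (hw : w ∈ YoungFinset lam.1) {i : AGen r} (h : w (hi i) < w (lo i)) :
    adjSwap r i ∈ YoungFinset lam.1 := by
  obtain ⟨m, hm1, hm2⟩ := exists_block lam (lo i)
  obtain ⟨m', hm1', hm2'⟩ := exists_block lam (hi i)
  obtain ⟨h1, h2⟩ := mem_young.1 hw _ _ ⟨hm1, hm2⟩
  obtain ⟨h1', h2'⟩ := mem_young.1 hw _ _ ⟨hm1', hm2'⟩
  have hlt : (w (hi i) : ℕ) < w (lo i) := h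
  have hlo : (lo i : ℕ) = i.1 := rfl
  have hhi : (hi i : ℕ) = i.1 + 1 := rfl
  rcases lt_trichotomy m m' with h | rfl | h
  · have := psum_add_le lam.1 h
    omega
  · exact adjSwap_mem_young (m := m) (by omega) (by omega)
  · have := psum_add_le lam.1 h
    omega

end Young
end ZeroHecke

namespace ZeroHecke

section Algebra

variable {k : Type} [Field k] {n r : ℕ}

theorem TGen_sq (i : AGen r) : TGen k r i * TGen k r i = - TGen k r i := by
  have := RingQuot.mkAlgHom_rel k (heckeARel.sq (k := k) i)
  rw [map_mul, map_neg] at this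
  exact this

theorem TGen_braid (i j : AGen r) (h : i.1 + 1 = j.1 ∨ j.1 + 1 = i.1) :
    TGen k r i * TGen k r j * TGen k r i = TGen k r j * TGen k r i * TGen k r j := by
  have := RingQuot.mkAlgHom_rel k (heckeARel.braid (k := k) i j h)
  rw [map_mul, map_mul, map_mul, map_mul] at this
  exact this

theorem hecke_induction {C : HeckeA k r → Prop} (hc : ∀ c, C (algebraMap k _ c))
    (hg : ∀ i, C (TGen k r i)) (hm : ∀ a b, C a → C b → C (a * b))
    (ha : ∀ a b, C a → C b → C (a + b)) (a : HeckeA k r) : C a := by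
  obtain ⟨x, rfl⟩ := RingQuot.mkAlgHom_surjective k (heckeARel k r) a
  induction x using FreeAlgebra.induction with
  | grade0 c => exact (AlgHom.commutes (RingQuot.mkAlgHom k (heckeARel k r)) c).symm ▸ hc c
  | grade1 i => exact hg i
  | mul x y h1 h2 => exact (map_mul (RingQuot.mkAlgHom k (heckeARel k r)) x y).symm ▸ hm _ _ h1 h2
  | add x y h1 h2 => exact (map_add (RingQuot.mkAlgHom k (heckeARel k r)) x y).symm ▸ ha _ _ h1 h2

/-- The algebra map determined by images of the generators. -/
def heckeLift {B : Type} [Ring B] [Algebra k B] (t : AGen r → B)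
    (h : ∀ ⦃a b⦄, heckeARel k r a b → FreeAlgebra.lift k t a = FreeAlgebra.lift k t b) :
    HeckeA k r →ₐ[k] B :=
  RingQuot.liftAlgHom k ⟨FreeAlgebra.lift k t, h⟩

theorem heckeLift_TGen {B : Type} [Ring B] [Algebra k B] (t : AGen r → B)
    (h : ∀ ⦃a b⦄, heckeARel k r a b → FreeAlgebra.lift k t a = FreeAlgebra.lift k t b)
    (i : AGen r) : heckeLift t h (TGen k r i) = t i :=
  (RingQuot.liftAlgHom_mkAlgHom_apply k (FreeAlgebra.lift k t) h _).trans
    (FreeAlgebra.lift_ι_apply t i)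

variable {T : Equiv.Perm (Fin r) → HeckeA k r}

theorem T_mul_of_lt (hT : IsHeckeBasis k r T) {w : Equiv.Perm (Fin r)} {i : AGen r}
    (h : w (lo i) < w (hi i)) :
    T w * TGen k r i = T (w * adjSwap r i) :=
  (hT.2.2 w i (invCount_mul_adjSwap h)).symm

theorem T_eq_of_gt (hT : IsHeckeBasis k r T) {w : Equiv.Perm (Fin r)} {i : AGen r}
    (h : w (hi i) < w (lo i)) :
    T w = T (w * adjSwap r i) * TGen k r i := by
  rw [T_mul_of_lt hT (by rwa [mul_adjSwap_lo, mul_adjSwap_hi]), mul_adjSwap_mul]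

theorem T_mul_of_gt (hT : IsHeckeBasis k r T) {w : Equiv.Perm (Fin r)} {i : AGen r}
    (h : w (hi i) < w (lo i)) :
    T w * TGen k r i = - T w := by
  rw [T_eq_of_gt hT h, mul_assoc, TGen_sq, mul_neg]

theorem span_T (hT : IsHeckeBasis k r T) : Submodule.span k (Set.range T) = ⊤ := by
  have key : ∀ a : HeckeA k r, ∀ x ∈ Submodule.span k (Set.range T),
      x * a ∈ Submodule.span k (Set.range T) := by
    refine hecke_induction (fun c x hx => ?_) (fun i x hx => ?_) (fun a b h1 h2 x hx => ?_)
      fun a b h1 h2 x hx => ?_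
    · rw [← Algebra.commutes, ← Algebra.smul_def]
      exact Submodule.smul_mem _ _ hx
    · induction hx using Submodule.span_induction with
      | mem x h =>
        obtain ⟨w, rfl⟩ := h
        rcases lt_or_gt w i with h | h
        · rw [T_mul_of_lt hT h]
          exact Submodule.subset_span ⟨_, rfl⟩
        · rw [T_mul_of_gt hT h]
          exact neg_mem (Submodule.subset_span ⟨_, rfl⟩)
      | zero => rw [zero_mul]; exact zero_mem _
      | add x y _ _ h1 h2 => rw [add_mul]; exact add_mem h1 h2
      | smul c x _ h1 => rw [smul_mul_assoc]; exact Submodule.smul_mem _ _ h1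
    · rw [← mul_assoc]
      exact h2 _ (h1 _ hx)
    · rw [mul_add]
      exact add_mem (h1 _ hx) (h2 _ hx)
  refine eq_top_iff.2 fun a _ => ?_
  have := key a (T 1) (Submodule.subset_span ⟨_, rfl⟩)
  rwa [hT.1, one_mul] at this

theorem finite_hecke (hT : IsHeckeBasis k r T) : Module.Finite k (HeckeA k r) :=
  Module.Finite.of_fg_top (span_T hT ▸ Submodule.fg_span (Set.finite_range T))

theorem xElt_mul_TGen (hT : IsHeckeBasis k r T) {lam : Comp n r} {i : AGen r}
    (hi' : adjSwap r i ∈ YoungFinset lam.1) :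
    xElt k T lam * TGen k r i = 0 := by
  rw [xElt, Finset.sum_mul]
  refine Finset.sum_involution (fun w _ => w * adjSwap r i) (fun w _ => ?_) (fun w _ _ h => ?_)
    (fun w hw => young_mul hw hi') fun w _ => mul_adjSwap_mul w i
  · rcases lt_or_gt w i with h | h
    · rw [T_mul_of_lt hT h, T_mul_of_gt hT (by rwa [mul_adjSwap_lo, mul_adjSwap_hi]),
        add_neg_cancel]
    · rw [T_mul_of_gt hT h, ← T_eq_of_gt hT h, neg_add_cancel]
  · exact adjSwap_ne_one i (mul_eq_left.1 h)

theorem xElt_mul_T (hT : IsHeckeBasis k r T) {lam : Comp n r} {w : Equiv.Perm (Fin r)}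
    (hw : w ∈ YoungFinset lam.1)
    (h1 : w ≠ 1) : xElt k T lam * T w = 0 := by
  induction hm : invCount w using Nat.strong_induction_on generalizing w with
  | _ m ih =>
    obtain ⟨i, hi'⟩ := exists_descent h1
    have hs := adjSwap_mem_of_descent hw hi'
    rw [T_eq_of_gt hT hi', ← mul_assoc]
    by_cases h2 : w * adjSwap r i = 1
    · rw [h2, hT.1, mul_one, xElt_mul_TGen hT hs]
    · have hc := invCount_mul_adjSwap (w := w * adjSwap r i) (i := i)
        (by rwa [mul_adjSwap_lo, mul_adjSwap_hi])
      rw [mul_adjSwap_mul] at hc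
      rw [ih _ (by omega) (young_mul hw hs) h2 rfl, zero_mul]

theorem xElt_sq (hT : IsHeckeBasis k r T) (lam : Comp n r) :
    xElt k T lam * xElt k T lam = xElt k T lam := by
  calc xElt k T lam * xElt k T lam = ∑ w ∈ YoungFinset lam.1, xElt k T lam * T w :=
        Finset.mul_sum _ _ _
    _ = xElt k T lam * T 1 :=
        Finset.sum_eq_single_of_mem 1 (young_one _) fun w hw h => xElt_mul_T hT hw h
    _ = xElt k T lam := by rw [hT.1, mul_one]

end Algebra

section Schur

instance (n r : ℕ) : Finite (Comp n r) :=
  Finite.of_injective (fun lam : Comp n r => fun i : Fin n =>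
      (⟨lam.1 i, Nat.lt_succ_of_le ((Finset.single_le_sum (fun _ _ => Nat.zero_le _)
        (Finset.mem_univ i)).trans_eq lam.2)⟩ : Fin (r + 1)))
    fun _ _ h => Subtype.ext (funext fun i => congrArg Fin.val (congrFun h i))

variable {k : Type} [Field k] {n r : ℕ} {T : Equiv.Perm (Fin r) → HeckeA k r}

theorem finite_schurModule (hT : IsHeckeBasis k r T) : Module.Finite k (SchurModule k n r T) := by
  have := finite_hecke hT
  have : ∀ lam : Comp n r, Module.Finite k (xIdeal k T lam) := fun lam =>
    inferInstanceAs (Module.Finite k ((xIdeal k T lam).restrictScalars k))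
  exact inferInstanceAs (Module.Finite k (∀ lam : Comp n r, (xIdeal k T lam : Type)))

theorem finite_schur0 (hT : IsHeckeBasis k r T) : Module.Finite k (Schur0 k n r T) := by
  have := finite_schurModule (n := n) hT
  exact Module.Finite.of_injective (LinearMap.restrictScalarsₗ k (HeckeA k r)ᵐᵒᵖ
    (SchurModule k n r T) (SchurModule k n r T) k) (LinearMap.restrictScalars_injective k)

end Schur
end ZeroHecke

namespace ZeroHecke

section Functor

variable {k : Type} [Field k] {n r : ℕ} {T : Equiv.Perm (Fin r) → HeckeA k r}

instance : Fintype (Comp n r) := Fintype.ofFinite _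
instance : DecidableEq (Comp n r) := Classical.decEq _

variable (T) in
/-- The projection of `⊕ x_λ H` to `H` through the summand indexed by `lam`. -/
def coord (lam : Comp n r) : SchurModule k n r T →ₗ[(HeckeA k r)ᵐᵒᵖ] HeckeA k r :=
  (xIdeal k T lam).subtype.comp
    (LinearMap.proj (R := (HeckeA k r)ᵐᵒᵖ) (φ := fun mu : Comp n r => (xIdeal k T mu : Type)) lam)

variable (T) in
/-- The map `H → ⊕ x_λ H` given by left multiplication with `x_λ`. -/
def emb (lam : Comp n r) : HeckeA k r →ₗ[(HeckeA k r)ᵐᵒᵖ] SchurModule k n r T :=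
  (LinearMap.single (HeckeA k r)ᵐᵒᵖ (fun mu : Comp n r => (xIdeal k T mu : Type)) lam).comp
    ({ toFun := fun h => ⟨xElt k T lam * h,
        Submodule.mem_span_singleton.2 ⟨op h, by rw [op_smul_eq_mul]⟩⟩
       map_add' := fun _ _ => Subtype.ext (mul_add _ _ _)
       map_smul' := fun c x => Subtype.ext (by
        show xElt k T lam * (c • x) = c • (xElt k T lam * x)
        rw [smul_eq_mul_unop, smul_eq_mul_unop, mul_assoc]) } :
      HeckeA k r →ₗ[(HeckeA k r)ᵐᵒᵖ] xIdeal k T lam)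

theorem coord_emb_self (lam : Comp n r) (h : HeckeA k r) :
    coord T lam (emb T lam h) = xElt k T lam * h := by
  have := Pi.single_eq_same (M := fun mu : Comp n r => (xIdeal k T mu : Type)) lam
    ⟨xElt k T lam * h, Submodule.mem_span_singleton.2 ⟨op h, by rw [op_smul_eq_mul]⟩⟩
  exact congrArg Subtype.val this

theorem coord_emb_of_ne {lam mu : Comp n r} (hne : lam ≠ mu) (h : HeckeA k r) :
    coord T lam (emb T mu h) = 0 := by
  have := Pi.single_eq_of_ne (M := fun mu : Comp n r => (xIdeal k T mu : Type)) hne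
    ⟨xElt k T mu * h, Submodule.mem_span_singleton.2 ⟨op h, by rw [op_smul_eq_mul]⟩⟩
  exact congrArg Subtype.val this

theorem schur_ext {p q : SchurModule k n r T} (h : ∀ lam, coord T lam p = coord T lam q) :
    p = q :=
  funext fun lam => Subtype.ext (h lam)

theorem xElt_mul_coord (hT : IsHeckeBasis k r T) (lam : Comp n r) (p : SchurModule k n r T) :
    xElt k T lam * coord T lam p = coord T lam p := by
  obtain ⟨c, hc⟩ := Submodule.mem_span_singleton.1 (p lam).2
  have : coord T lam p = xElt k T lam * unop c := hc.symm
  rw [this, ← mul_assoc, xElt_sq hT]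

theorem sum_emb_coord (hT : IsHeckeBasis k r T) (p : SchurModule k n r T) :
    ∑ lam, emb T lam (coord T lam p) = p := by
  refine schur_ext fun mu => ?_
  rw [map_sum, Finset.sum_eq_single_of_mem mu (Finset.mem_univ _)
    fun lam _ h => coord_emb_of_ne h.symm _, coord_emb_self, xElt_mul_coord hT]

/-- `⊕ x_λ H` as a finite-dimensional `H`-module. -/
abbrev schurFM (n : ℕ) (hT : IsHeckeBasis k r T) : FM k (HeckeA k r)ᵐᵒᵖ :=
  haveI := finite_schurModule (n := n) hT
  ⟨SchurModule k n r T⟩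

variable (n T) in
/-- The right `S_0(n,r)`-module `Hom_H(⊕ x_λ H, X)`. -/
def HomS (X : FM k (HeckeA k r)ᵐᵒᵖ) : Type := SchurModule k n r T →ₗ[(HeckeA k r)ᵐᵒᵖ] X

variable (X Y : FM k (HeckeA k r)ᵐᵒᵖ)

variable {X} in
/-- The underlying homomorphism. -/
abbrev HomS.hom (f : HomS n T X) : SchurModule k n r T →ₗ[(HeckeA k r)ᵐᵒᵖ] X := f

instance : AddCommGroup (HomS n T X) :=
  inferInstanceAs (AddCommGroup (SchurModule k n r T →ₗ[(HeckeA k r)ᵐᵒᵖ] X))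
instance : Module k (HomS n T X) :=
  inferInstanceAs (Module k (SchurModule k n r T →ₗ[(HeckeA k r)ᵐᵒᵖ] X))

instance : Module (Schur0 k n r T)ᵐᵒᵖ (HomS n T X) where
  smul a f := LinearMap.comp (σ₁₂ := RingHom.id _) (M₂ := SchurModule k n r T) f (unop a)
  one_smul _ := LinearMap.comp_id _
  mul_smul _ _ _ := rfl
  smul_zero _ := LinearMap.zero_comp _
  smul_add _ _ _ := LinearMap.add_comp _ _ _
  add_smul _ _ _ := LinearMap.comp_add _ _ _
  zero_smul _ := LinearMap.comp_zero _

instance : IsScalarTower k (Schur0 k n r T)ᵐᵒᵖ (HomS n T X) :=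
  .of_algebraMap_smul fun c f => LinearMap.ext fun p => by
    show f.hom (c • p) = c • f.hom p
    exact f.hom.map_smul_of_tower c p

/-- `HomS` as a finite-dimensional module. -/
abbrev homFM (n : ℕ) (hT : IsHeckeBasis k r T) (X : FM k (HeckeA k r)ᵐᵒᵖ) :
    FM k (Schur0 k n r T)ᵐᵒᵖ :=
  haveI : Module.Finite k (HomS n T X) := FM.finite_hom (schurFM n hT) X
  ⟨HomS n T X⟩

variable {X Y}

/-- Functoriality of `HomS`. -/
def HomS.map (g : X →ₗ[(HeckeA k r)ᵐᵒᵖ] Y) :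
    HomS n T X →ₗ[(Schur0 k n r T)ᵐᵒᵖ] HomS n T Y where
  toFun f := LinearMap.comp (σ₁₂ := RingHom.id _) (M₂ := X) g f
  map_add' _ _ := LinearMap.comp_add _ _ _
  map_smul' _ _ := rfl

/-- The map `⊕ x_λ H → X` sending `x_λ` to `x x_λ` and the other summands to zero. -/
def liftAt (T : Equiv.Perm (Fin r) → HeckeA k r) (lam : Comp n r) (x : X) : HomS n T X :=
  (LinearMap.comp (σ₁₂ := RingHom.id _) (M₂ := HeckeA k r)
    { toFun := fun h => op h • x
      map_add' := fun a b => by rw [MulOpposite.op_add, add_smul]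
      map_smul' := fun c a => by
        rw [smul_eq_mul_unop, op_mul, op_unop, mul_smul, RingHom.id_apply] } (coord T lam))

theorem liftAt_apply (lam : Comp n r) (x : X) (p : SchurModule k n r T) :
    (liftAt T lam x).hom p = op (coord T lam p) • x := rfl

/-- Evaluation at the generator `x_λ`. -/
def evAt (lam : Comp n r) (f : HomS n T X) : X :=
  f.hom (emb T lam 1)

theorem HomS.apply_eq (hT : IsHeckeBasis k r T) (f : HomS n T X) (p : SchurModule k n r T) :
    f.hom p = ∑ lam, op (coord T lam p) • evAt lam f := by
  conv_lhs => rw [← sum_emb_coord hT p, map_sum]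
  refine Finset.sum_congr rfl fun lam _ => ?_
  rw [evAt, ← map_smul, ← map_smul, op_smul_eq_mul, one_mul]

theorem HomS.ext_evAt (hT : IsHeckeBasis k r T) {f g : HomS n T X}
    (h : ∀ lam, evAt lam f = evAt lam g) : f = g :=
  LinearMap.ext fun p => by
    show f.hom p = g.hom p
    rw [HomS.apply_eq hT, HomS.apply_eq hT]
    simp only [h]

theorem op_xElt_smul_evAt (hT : IsHeckeBasis k r T) (lam : Comp n r) (f : HomS n T X) :
    op (xElt k T lam) • evAt lam f = evAt lam f := by
  rw [evAt, ← map_smul, ← map_smul, op_smul_eq_mul, one_mul]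
  congr 1
  refine schur_ext fun mu => ?_
  by_cases h : mu = lam
  · rw [h, coord_emb_self, coord_emb_self, xElt_sq hT, mul_one]
  · rw [coord_emb_of_ne h, coord_emb_of_ne h]

theorem evAt_liftAt (lam : Comp n r) (x : X) :
    evAt lam (liftAt T lam x) = op (xElt k T lam) • x := by
  rw [evAt, liftAt_apply, coord_emb_self, mul_one]

theorem HomS.map_surjective (hT : IsHeckeBasis k r T) {g : X →ₗ[(HeckeA k r)ᵐᵒᵖ] Y}
    (hg : Function.Surjective g) : Function.Surjective (HomS.map (n := n) (T := T) g) := by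
  intro f
  choose s hs using hg
  refine ⟨∑ lam, liftAt T lam (s (evAt lam f)), LinearMap.ext fun p => ?_⟩
  show g (HomS.hom (∑ lam, liftAt T lam (s (evAt lam f))) p) = f.hom p
  have : HomS.hom (∑ lam, liftAt T lam (s (evAt lam f))) p
      = ∑ lam, (liftAt T lam (s (evAt lam f))).hom p := LinearMap.sum_apply _ _ _
  rw [this, map_sum, HomS.apply_eq hT]
  refine Finset.sum_congr rfl fun lam _ => ?_
  rw [liftAt_apply, map_smul, hs]

theorem exists_factor {R P S X Q : Type} [Ring R] [AddCommGroup P] [AddCommGroup S]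
    [AddCommGroup X] [AddCommGroup Q] [Module R P] [Module R S] [Module R X] [Module R Q]
    {i : S →ₗ[R] X} {p : X →ₗ[R] Q} (hi : Function.Injective i)
    (hip : LinearMap.ker p ≤ LinearMap.range i) {f : P →ₗ[R] X} (hf : p.comp f = 0) :
    ∃ g : P →ₗ[R] S, i.comp g = f := by
  refine ⟨(LinearEquiv.ofInjective i hi).symm.toLinearMap.comp
    (f.codRestrict (LinearMap.range i) fun z => hip (LinearMap.congr_fun hf z)), ?_⟩
  ext z
  exact congrArg Subtype.val ((LinearEquiv.ofInjective i hi).apply_symm_apply _)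

/-- Modules that are extensions with the same outer terms have the same support after applying
`Hom_H(⊕ x_λ H, -)`. -/
theorem exists_hom_ne_zero_of_exact (hT : IsHeckeBasis k r T) {S Q : FM k (HeckeA k r)ᵐᵒᵖ}
    {i : S →ₗ[(HeckeA k r)ᵐᵒᵖ] X} {p : X →ₗ[(HeckeA k r)ᵐᵒᵖ] Q} (hi : Function.Injective i)
    (hip : LinearMap.ker p ≤ LinearMap.range i)
    {i' : S →ₗ[(HeckeA k r)ᵐᵒᵖ] Y} {p' : Y →ₗ[(HeckeA k r)ᵐᵒᵖ] Q} (hi' : Function.Injective i')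
    (hp' : Function.Surjective p')
    {P : Type} [AddCommGroup P] [Module (Schur0 k n r T)ᵐᵒᵖ P]
    [Module.Projective (Schur0 k n r T)ᵐᵒᵖ P]
    (h : ∃ f : P →ₗ[(Schur0 k n r T)ᵐᵒᵖ] HomS n T X, f ≠ 0) :
    ∃ f : P →ₗ[(Schur0 k n r T)ᵐᵒᵖ] HomS n T Y, f ≠ 0 := by
  obtain ⟨f, hf⟩ := h
  by_cases hpf : (HomS.map p).comp f = 0
  · obtain ⟨g, rfl⟩ := exists_factor (i := HomS.map (n := n) (T := T) i) (p := HomS.map p)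
      (fun a b hab => LinearMap.ext fun z => hi (LinearMap.congr_fun
        (f := (HomS.map i a).hom) (g := (HomS.map i b).hom) hab z))
      (fun a ha => by
        obtain ⟨g, hg⟩ := exists_factor hi hip (f := a.hom) ha
        exact ⟨g, hg⟩) hpf
    refine ⟨(HomS.map i').comp g, fun h => hf ?_⟩
    have hg : g = 0 := LinearMap.ext fun z => LinearMap.ext fun m => hi' (by
      have h1 : HomS.map i' (g z) = 0 := LinearMap.congr_fun h z
      refine (LinearMap.congr_fun (f := (HomS.map i' (g z)).hom) (g := 0) h1 m).trans ?_
      exact (map_zero i').symm)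
    rw [hg, LinearMap.comp_zero]
  · obtain ⟨g, hg⟩ := Module.projective_lifting_property (HomS.map p') ((HomS.map p).comp f)
      (HomS.map_surjective hT hp')
    refine ⟨g, fun h => hpf ?_⟩
    rw [← hg, h, LinearMap.comp_zero]

/-- The endomorphism of `⊕ x_λ H` sending `x_μ` to `x_λ x_μ`, up to inclusion. -/
def moveTo (T : Equiv.Perm (Fin r) → HeckeA k r) (lam mu : Comp n r) : Schur0 k n r T :=
  LinearMap.comp (σ₁₂ := RingHom.id _) (M₂ := HeckeA k r) (emb T lam) (coord T mu)

theorem op_moveTo_smul_liftAt (lam mu : Comp n r) (x : X) :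
    op (moveTo T lam mu) • liftAt T lam x = liftAt T mu (op (xElt k T lam) • x) :=
  LinearMap.ext fun p => by
    show op (coord T lam (emb T lam (coord T mu p))) • x = op (coord T mu p) • op (xElt k T lam) • x
    rw [coord_emb_self, op_mul, mul_smul]

theorem evAt_op_moveTo_smul (lam mu : Comp n r) (f : HomS n T X) :
    evAt mu (op (moveTo T lam mu) • f) = op (xElt k T mu) • evAt lam f := by
  show f.hom (emb T lam (coord T mu (emb T mu 1))) = _
  rw [coord_emb_self, evAt, ← map_smul, ← map_smul, op_smul_eq_mul, one_mul, mul_one]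

end Functor
end ZeroHecke

namespace ZeroHecke

section Construct

variable {k : Type} [Field k] {r : ℕ}

/-- Operators `t₁, t₂, t₃` placed on the first three generators, and zero on the others. -/
def threeGen {B : Type} [Zero B] (t₁ t₂ t₃ : B) (i : ℕ) : B :=
  if i = 0 then t₁ else if i = 1 then t₂ else if i = 2 then t₃ else 0

theorem threeGen_rel {B : Type} [Ring B] [Algebra k B] {t₁ t₂ t₃ : B} (h1 : t₁ * t₁ = -t₁)
    (h2 : t₂ * t₂ = -t₂) (h3 : t₃ * t₃ = -t₃) (h12 : t₁ * t₂ * t₁ = t₂ * t₁ * t₂)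
    (h23 : t₂ * t₃ * t₂ = t₃ * t₂ * t₃) (h13 : t₁ * t₃ = t₃ * t₁)
    ⦃a b : FreeAlgebra k (AGen r)⦄ (h : heckeARel k r a b) :
    FreeAlgebra.lift k (fun i : AGen r => threeGen t₁ t₂ t₃ i.1) a =
      FreeAlgebra.lift k (fun i : AGen r => threeGen t₁ t₂ t₃ i.1) b := by
  have h0 : ∀ i : AGen r, i.1 = 0 ∨ i.1 = 1 ∨ i.1 = 2 ∨ 3 ≤ i.1 := fun i => by omega
  have e0 : threeGen t₁ t₂ t₃ 0 = t₁ := rfl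
  have e1 : threeGen t₁ t₂ t₃ 1 = t₂ := rfl
  have e2 : threeGen t₁ t₂ t₃ 2 = t₃ := rfl
  have e3 : ∀ m, 3 ≤ m → threeGen t₁ t₂ t₃ m = 0 := fun m hm => by
    rw [threeGen, if_neg (by omega), if_neg (by omega), if_neg (by omega)]
  cases h with
  | sq i =>
    rw [map_mul, map_neg, FreeAlgebra.lift_ι_apply]
    rcases h0 i with h | h | h | h
    · rw [h, e0, h1]
    · rw [h, e1, h2]
    · rw [h, e2, h3]
    · rw [e3 _ h]; simp
  | braid i j hij =>
    simp only [map_mul, FreeAlgebra.lift_ι_apply]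
    rcases h0 i with h | h | h | h <;> rcases h0 j with h' | h' | h' | h' <;>
      first
      | omega
      | (rw [e3 _ h]; simp)
      | (rw [e3 _ h']; simp)
      | (rw [h, h']; simp only [e0, e1, e2, h12, h23])
  | comm i j hij =>
    simp only [map_mul, FreeAlgebra.lift_ι_apply]
    rcases h0 i with h | h | h | h <;> rcases h0 j with h' | h' | h' | h' <;>
      first
      | omega
      | (rw [e3 _ h]; simp)
      | (rw [e3 _ h']; simp)
      | (rw [h, h']; simp only [e0, e2, h13])

/-- The right `H`-module given by a representation of `H` in the opposite endomorphism ring. -/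
def ofRep (V : Type) [AddCommGroup V] [Module k V] [Module.Finite k V]
    (φ : HeckeA k r →ₐ[k] (Module.End k V)ᵐᵒᵖ) : FM k (HeckeA k r)ᵐᵒᵖ :=
  letI : Module (HeckeA k r)ᵐᵒᵖ V :=
    { smul := fun c x => (unop (φ (unop c))) x
      one_smul := fun x => by
        show (unop (φ 1)) x = x
        rw [map_one]; rfl
      mul_smul := fun c d x => by
        show (unop (φ (unop d * unop c))) x = (unop (φ (unop c))) ((unop (φ (unop d))) x)
        rw [map_mul]; rfl
      smul_zero := fun c => map_zero _
      smul_add := fun c => map_add _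
      add_smul := fun c d x => by
        show (unop (φ (unop c + unop d))) x = (unop (φ (unop c))) x + (unop (φ (unop d))) x
        rw [map_add]; rfl
      zero_smul := fun x => by
        show (unop (φ 0)) x = 0
        rw [map_zero]; rfl }
  haveI : IsScalarTower k (HeckeA k r)ᵐᵒᵖ V := .of_algebraMap_smul fun c x => by
    show (unop (φ (algebraMap k _ c))) x = c • x
    rw [AlgHom.commutes]; rfl
  { carrier := V }

/-- A `k`-linear map commuting with the generators is `H`-linear. -/
def linOfGen {X Y : FM k (HeckeA k r)ᵐᵒᵖ} (f : X →ₗ[k] Y)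
    (h : ∀ i x, f (op (TGen k r i) • x) = op (TGen k r i) • f x) :
    X →ₗ[(HeckeA k r)ᵐᵒᵖ] Y where
  toFun := f
  map_add' := f.map_add
  map_smul' c x := by
    obtain ⟨a, rfl⟩ := op_surjective c
    have : ∀ x, f (op a • x) = op a • f x := by
      refine hecke_induction (C := fun a => ∀ x, f (op a • x) = op a • f x) (fun c x => ?_)
        (fun i x => h i x) (fun a b h1 h2 x => ?_) (fun a b h1 h2 x => ?_) a
      · have : (op (algebraMap k (HeckeA k r) c)) = algebraMap k (HeckeA k r)ᵐᵒᵖ c := rfl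
        rw [this, algebraMap_smul, algebraMap_smul, f.map_smul]
      · rw [op_mul, mul_smul, mul_smul, h2, h1]
      · rw [MulOpposite.op_add, add_smul, add_smul, map_add, h1, h2]
    exact this x

/-- The right `H`-module on which the first three generators act by given operators and the
others by zero. -/
def ofThree (V : Type) [AddCommGroup V] [Module k V] [Module.Finite k V]
    (t₁ t₂ t₃ : Module.End k V) (h1 : t₁ * t₁ = -t₁) (h2 : t₂ * t₂ = -t₂) (h3 : t₃ * t₃ = -t₃)
    (h12 : t₁ * t₂ * t₁ = t₂ * t₁ * t₂) (h23 : t₂ * t₃ * t₂ = t₃ * t₂ * t₃)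
    (h13 : t₁ * t₃ = t₃ * t₁) : FM k (HeckeA k r)ᵐᵒᵖ :=
  ofRep V (heckeLift (fun i : AGen r => threeGen (op t₁) (op t₂) (op t₃) i.1)
    (threeGen_rel (by rw [← op_mul, h1]; rfl) (by rw [← op_mul, h2]; rfl)
      (by rw [← op_mul, h3]; rfl) (by simp only [← op_mul, ← mul_assoc, h12])
      (by simp only [← op_mul, ← mul_assoc, h23]) (by simp only [← op_mul, h13])))

theorem ofThree_smul {V : Type} [AddCommGroup V] [Module k V] [Module.Finite k V]
    {t₁ t₂ t₃ : Module.End k V} {h1 : t₁ * t₁ = -t₁} {h2 : t₂ * t₂ = -t₂} {h3 : t₃ * t₃ = -t₃}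
    {h12 : t₁ * t₂ * t₁ = t₂ * t₁ * t₂} {h23 : t₂ * t₃ * t₂ = t₃ * t₂ * t₃}
    {h13 : t₁ * t₃ = t₃ * t₁} (i : AGen r)
    (x : (ofThree V t₁ t₂ t₃ h1 h2 h3 h12 h23 h13 : FM k (HeckeA k r)ᵐᵒᵖ)) :
    op (TGen k r i) • x = (threeGen t₁ t₂ t₃ i.1 : Module.End k V) x := by
  refine (congrArg (fun z : (Module.End k V)ᵐᵒᵖ => unop z x) (heckeLift_TGen _ _ i)).trans ?_
  show unop (threeGen (op t₁) (op t₂) (op t₃) i.1) x = _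
  unfold threeGen
  split_ifs <;> rfl

end Construct
end ZeroHecke

namespace ZeroHecke

section Parabolic

variable {k : Type} [Field k] {n r : ℕ} {T : Equiv.Perm (Fin r) → HeckeA k r}

theorem adjSwap_not_mem_young {lam : Fin n → ℕ} {i : AGen r} {m : Fin n}
    (h : i.1 + 1 = psum lam m + lam m) (h0 : 0 < lam m) : adjSwap r i ∉ YoungFinset lam := by
  intro hmem
  have h1 := (mem_young.1 hmem (lo i) m
    ⟨by show _ ≤ i.1; omega, by show i.1 < _; omega⟩).2
  rw [adjSwap_eq, Equiv.swap_apply_left] at h1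
  have : (hi i : ℕ) = i.1 + 1 := rfl
  omega

/-- If `i` is the only generator of the Young subgroup acting nontrivially on `X`, then `x_λ`
acts as `1 + T_i`. -/
theorem xElt_smul (hT : IsHeckeBasis k r T) {X : FM k (HeckeA k r)ᵐᵒᵖ} {lam : Comp n r}
    {i : AGen r} (hi : adjSwap r i ∈ YoungFinset lam.1)
    (h : ∀ j, adjSwap r j ∈ YoungFinset lam.1 → j = i ∨ ∀ x : X, op (TGen k r j) • x = 0)
    (x : X) : op (xElt k T lam) • x = x + op (TGen k r i) • x := by
  have hdesc : ∀ w ∈ YoungFinset lam.1, ∀ j, w (ZeroHecke.hi j) < w (lo j) → j ≠ i →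
      ∀ x : X, op (T w) • x = 0 := fun w hw j hj hne x => by
    rw [T_eq_of_gt hT hj, op_mul, mul_smul,
      (h j (adjSwap_mem_of_descent hw hj)).resolve_left hne]
  have hzero : ∀ w ∈ YoungFinset lam.1, w ∉ ({1, adjSwap r i} : Finset _) → op (T w) • x = 0 := by
    intro w hw hw'
    simp only [Finset.mem_insert, Finset.mem_singleton, not_or] at hw'
    obtain ⟨j, hj⟩ := exists_descent hw'.1
    by_cases hji : j = i
    · subst hji
      have hne : w * adjSwap r j ≠ 1 := fun h1 => hw'.2 (by
        rw [← mul_adjSwap_mul w j, h1, one_mul])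
      obtain ⟨j', hj'⟩ := exists_descent hne
      rw [T_eq_of_gt hT hj, op_mul, mul_smul, hdesc _ (young_mul hw hi) j' hj', smul_zero]
      rintro rfl
      rw [mul_adjSwap_lo, mul_adjSwap_hi] at hj'
      exact lt_asymm hj hj'
    · exact hdesc w hw j hj hji x
  have hsub : ({1, adjSwap r i} : Finset _) ⊆ YoungFinset lam.1 := by
    intro w hw
    simp only [Finset.mem_insert, Finset.mem_singleton] at hw
    rcases hw with rfl | rfl
    · exact young_one _
    · exact hi
  have : op (xElt k T lam) = ∑ w ∈ YoungFinset lam.1, op (T w) :=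
    map_sum (opAddEquiv (α := HeckeA k r)) _ _
  rw [this, Finset.sum_smul, ← Finset.sum_subset hsub hzero,
    Finset.sum_pair (adjSwap_ne_one i).symm, hT.1, hT.2.1, op_one, one_smul]

/-- The composition `(a, b, c, 0, …, 0)`. -/
def comp3 (hn : 3 ≤ n) (a b c : ℕ) (h : a + b + c = r) : Comp n r :=
  ⟨fun i => if i.1 = 0 then a else if i.1 = 1 then b else if i.1 = 2 then c else 0, by
    rw [Fin.sum_univ_eq_sum_range
      (fun i => if i = 0 then a else if i = 1 then b else if i = 2 then c else 0) n]
    obtain ⟨m, rfl⟩ := Nat.exists_eq_add_of_le' hn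
    rw [Finset.sum_range_succ', Finset.sum_range_succ', Finset.sum_range_succ']
    simp
    omega⟩

theorem psum_comp3 (hn : 3 ≤ n) {a b c : ℕ} (h : a + b + c = r) :
    psum (comp3 hn a b c h).1 ⟨0, by omega⟩ = 0 ∧ psum (comp3 hn a b c h).1 ⟨1, by omega⟩ = a ∧
    psum (comp3 hn a b c h).1 ⟨2, by omega⟩ = a + b := by
  have h0 := psum_zero (comp3 hn a b c h).1 ⟨0, by omega⟩ rfl
  have h1 := psum_succ (comp3 hn a b c h).1 ⟨0, by omega⟩ ⟨1, by omega⟩ rfl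
  have h2 := psum_succ (comp3 hn a b c h).1 ⟨1, by omega⟩ ⟨2, by omega⟩ rfl
  rw [h0] at h1
  rw [h1] at h2
  refine ⟨h0, h1.trans (by simp [comp3]), h2.trans (by simp [comp3])⟩

theorem ne_of_adjSwap_mem_comp3 (hn : 3 ≤ n) {a b c : ℕ} (h : a + b + c = r) (ha : 0 < a)
    (hb : 0 < b) {i : AGen r} (hi : adjSwap r i ∈ YoungFinset (comp3 hn a b c h).1) :
    i.1 + 1 ≠ a ∧ i.1 + 1 ≠ a + b := by
  obtain ⟨h0, h1, h2⟩ := psum_comp3 hn h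
  refine ⟨fun e => adjSwap_not_mem_young (m := ⟨0, by omega⟩) ?_ ?_ hi,
    fun e => adjSwap_not_mem_young (m := ⟨1, by omega⟩) ?_ ?_ hi⟩
  · rw [h0, e]; simp [comp3]
  · simpa [comp3]
  · rw [h1, e]; simp [comp3]
  · simpa [comp3]

variable {X : FM k (HeckeA k r)ᵐᵒᵖ} (hn : 3 ≤ n) (hr : 4 ≤ r)

/-- The composition `(2, 1, r - 3)`. -/
abbrev comp₁ : Comp n r := comp3 hn 2 1 (r - 3) (by omega)
/-- The composition `(1, 2, r - 3)`. -/
abbrev comp₂ : Comp n r := comp3 hn 1 2 (r - 3) (by omega)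
/-- The composition `(1, 1, r - 2)`. -/
abbrev comp₃ : Comp n r := comp3 hn 1 1 (r - 2) (by omega)

theorem xElt_comp₁_smul (hT : IsHeckeBasis k r T)
    (hX : ∀ (i : AGen r) (x : X), 3 ≤ i.1 → op (TGen k r i) • x = 0) (x : X) :
    op (xElt k T (comp₁ hn hr)) • x = x + op (TGen k r ⟨0, by omega⟩) • x := by
  obtain ⟨h0, h1, h2⟩ := psum_comp3 hn (show 2 + 1 + (r - 3) = r by omega)
  refine xElt_smul hT (adjSwap_mem_young (m := ⟨0, by omega⟩) (h0.trans_le (Nat.zero_le _)) ?_)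
    (fun j hj => ?_) x
  · rw [h0]; simp [comp3]
  · have := ne_of_adjSwap_mem_comp3 hn _ (by omega) (by omega) hj
    by_cases h3 : 3 ≤ j.1
    · exact .inr fun x => hX j x h3
    · exact .inl (Subtype.ext (by show j.1 = 0; omega))

theorem xElt_comp₂_smul (hT : IsHeckeBasis k r T)
    (hX : ∀ (i : AGen r) (x : X), 3 ≤ i.1 → op (TGen k r i) • x = 0) (x : X) :
    op (xElt k T (comp₂ hn hr)) • x = x + op (TGen k r ⟨1, by omega⟩) • x := by
  obtain ⟨h0, h1, h2⟩ := psum_comp3 hn (show 1 + 2 + (r - 3) = r by omega)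
  refine xElt_smul hT (adjSwap_mem_young (m := ⟨1, by omega⟩) h1.le ?_) (fun j hj => ?_) x
  · rw [h1]; simp [comp3]
  · have := ne_of_adjSwap_mem_comp3 hn _ (by omega) (by omega) hj
    by_cases h3 : 3 ≤ j.1
    · exact .inr fun x => hX j x h3
    · exact .inl (Subtype.ext (by show j.1 = 1; omega))

theorem xElt_comp₃_smul (hT : IsHeckeBasis k r T)
    (hX : ∀ (i : AGen r) (x : X), 3 ≤ i.1 → op (TGen k r i) • x = 0) (x : X) :
    op (xElt k T (comp₃ hn hr)) • x = x + op (TGen k r ⟨2, by omega⟩) • x := by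
  obtain ⟨h0, h1, h2⟩ := psum_comp3 hn (show 1 + 1 + (r - 2) = r by omega)
  refine xElt_smul hT (adjSwap_mem_young (m := ⟨2, by omega⟩) h2.le ?_) (fun j hj => ?_) x
  · rw [h2]
    have : (comp3 hn 1 1 (r - 2) (by omega) : Comp n r).1 ⟨2, by omega⟩ = r - 2 := by simp [comp3]
    rw [this]
    show 2 + 1 < _
    omega
  · have := ne_of_adjSwap_mem_comp3 hn _ (by omega) (by omega) hj
    by_cases h3 : 3 ≤ j.1
    · exact .inr fun x => hX j x h3
    · exact .inl (Subtype.ext (by show j.1 = 2; omega))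

end Parabolic
end ZeroHecke

namespace ZeroHecke

section Family

variable (k : Type) [Field k]

/-- The action of `T₁` on the members of the family. -/
def famOne : Module.End k (Fin 8 → k) where
  toFun x := ![0, 0, -x 2, 0, -x 4, 0, -x 6, -x 7]
  map_add' x y := by ext i; fin_cases i <;> simp <;> ring
  map_smul' c x := by ext i; fin_cases i <;> simp

/-- The action of `T₃` on the members of the family. -/
def famThree : Module.End k (Fin 8 → k) where
  toFun x := ![0, 0, 0, -x 3, 0, -x 5, -x 6, -x 7]
  map_add' x y := by ext i; fin_cases i <;> simp <;> ring
  map_smul' c x := by ext i; fin_cases i <;> simp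

variable {k} in
/-- The action of `T₂` on the member of the family with the given parameter. -/
def famTwo (c : k) : Module.End k (Fin 8 → k) where
  toFun x := ![-x 0, -x 1, -x 2, -x 3, x 0 - x 1, c * x 0 - x 1, x 0 + x 2, x 1 + x 3]
  map_add' x y := by ext i; fin_cases i <;> simp <;> ring
  map_smul' c x := by ext i; fin_cases i <;> simp <;> ring

/-- The action of `T₁` on the common submodule. -/
def famSubOne : Module.End k (Fin 4 → k) where
  toFun x := ![-x 0, 0, -x 2, -x 3]
  map_add' x y := by ext i; fin_cases i <;> simp <;> ring
  map_smul' c x := by ext i; fin_cases i <;> simp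

/-- The action of `T₃` on the common submodule. -/
def famSubThree : Module.End k (Fin 4 → k) where
  toFun x := ![0, -x 1, -x 2, -x 3]
  map_add' x y := by ext i; fin_cases i <;> simp <;> ring
  map_smul' c x := by ext i; fin_cases i <;> simp

/-- The action of `T₁` on the common quotient. -/
def famQuoOne : Module.End k (Fin 4 → k) where
  toFun x := ![0, 0, -x 2, 0]
  map_add' x y := by ext i; fin_cases i <;> simp; ring
  map_smul' c x := by ext i; fin_cases i <;> simp

/-- The action of `T₃` on the common quotient. -/
def famQuoThree : Module.End k (Fin 4 → k) where
  toFun x := ![0, 0, 0, -x 3]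
  map_add' x y := by ext i; fin_cases i <;> simp; ring
  map_smul' c x := by ext i; fin_cases i <;> simp

variable {k} (r : ℕ)

/-- A one-parameter family of modules over the 0-Hecke algebra. -/
def fam (c : k) : FM k (HeckeA k r)ᵐᵒᵖ :=
  ofThree (Fin 8 → k) (famOne k) (famTwo c) (famThree k)
    (by ext x i; fin_cases i <;> simp [famOne])
    (by ext x i; fin_cases i <;> simp [famTwo] <;> ring)
    (by ext x i; fin_cases i <;> simp [famThree])
    (by ext x i; fin_cases i <;> simp [famOne, famTwo])
    (by ext x i; fin_cases i <;> simp [famTwo, famThree])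
    (by ext x i; fin_cases i <;> simp [famOne, famThree])

variable (k) in
/-- The common submodule of the family. -/
def famSub : FM k (HeckeA k r)ᵐᵒᵖ :=
  ofThree (Fin 4 → k) (famSubOne k) 0 (famSubThree k)
    (by ext x i; fin_cases i <;> simp [famSubOne])
    (by simp)
    (by ext x i; fin_cases i <;> simp [famSubThree])
    (by simp) (by simp)
    (by ext x i; fin_cases i <;> simp [famSubOne, famSubThree])

variable (k) in
/-- The common quotient of the family. -/
def famQuo : FM k (HeckeA k r)ᵐᵒᵖ :=
  ofThree (Fin 4 → k) (famQuoOne k) (-1) (famQuoThree k)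
    (by ext x i; fin_cases i <;> simp [famQuoOne])
    (by ext x i; simp)
    (by ext x i; fin_cases i <;> simp [famQuoThree])
    (by ext x i; fin_cases i <;> simp [famQuoOne])
    (by ext x i; fin_cases i <;> simp [famQuoThree])
    (by ext x i; fin_cases i <;> simp [famQuoOne, famQuoThree])

variable {r} in
theorem fam_smul {c : k} (i : AGen r) (x : fam r c) : op (TGen k r i) • x =
    (threeGen (famOne k) (famTwo c) (famThree k) i.1 : Module.End k (Fin 8 → k)) x :=
  ofThree_smul i x

variable {r} in
theorem famSub_smul (i : AGen r) (x : famSub k r) : op (TGen k r i) • x =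
    (threeGen (famSubOne k) 0 (famSubThree k) i.1 : Module.End k (Fin 4 → k)) x :=
  ofThree_smul i x

variable {r} in
theorem famQuo_smul (i : AGen r) (x : famQuo k r) : op (TGen k r i) • x =
    (threeGen (famQuoOne k) (-1) (famQuoThree k) i.1 : Module.End k (Fin 4 → k)) x :=
  ofThree_smul i x

theorem threeGen_cases₂ {B B' : Type} [Zero B] [Zero B'] {t₁ t₂ t₃ : B} {u₁ u₂ u₃ : B'}
    {C : B → B' → Prop} (h1 : C t₁ u₁) (h2 : C t₂ u₂) (h3 : C t₃ u₃) (h0 : C 0 0) (i : ℕ) :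
    C (threeGen t₁ t₂ t₃ i) (threeGen u₁ u₂ u₃ i) := by
  unfold threeGen
  split_ifs <;> assumption

/-- The inclusion of the common submodule. -/
def famIncl (c : k) : famSub k r →ₗ[(HeckeA k r)ᵐᵒᵖ] fam r c :=
  linOfGen (X := famSub k r) (Y := fam r c)
    { toFun := fun s : Fin 4 → k => (![0, 0, 0, 0, s 0, s 1, s 2, s 3] : Fin 8 → k)
      map_add' := fun s t => by
        show _ = (_ : Fin 8 → k) + _
        ext i; fin_cases i <;> simp <;> rfl
      map_smul' := fun c s => by
        show _ = c • (_ : Fin 8 → k)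
        ext i; fin_cases i <;> simp <;> rfl }
    fun i x => by
      rw [fam_smul, famSub_smul]
      refine threeGen_cases₂ (C := fun (a : Module.End k (Fin 4 → k))
        (b : Module.End k (Fin 8 → k)) => (![0, 0, 0, 0, a x 0, a x 1, a x 2, a x 3] : Fin 8 → k)
          = b (![0, 0, 0, 0, x 0, x 1, x 2, x 3] : Fin 8 → k)) ?_ ?_ ?_ ?_ i.1
      · ext i; fin_cases i <;> simp [famOne, famSubOne]
      · ext i; fin_cases i <;> simp [famTwo] <;> rfl
      · ext i; fin_cases i <;> simp [famThree, famSubThree]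
      · ext i; fin_cases i <;> simp <;> rfl

/-- The projection to the common quotient. -/
def famProj (c : k) : fam r c →ₗ[(HeckeA k r)ᵐᵒᵖ] famQuo k r :=
  linOfGen (X := fam r c) (Y := famQuo k r)
    { toFun := fun x : Fin 8 → k => (![x 0, x 1, x 2, x 3] : Fin 4 → k)
      map_add' := fun s t => by
        show _ = (_ : Fin 4 → k) + _
        ext i; fin_cases i <;> simp <;> rfl
      map_smul' := fun c s => by
        show _ = c • (_ : Fin 4 → k)
        ext i; fin_cases i <;> simp <;> rfl }
    fun i x => by
      rw [fam_smul, famQuo_smul]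
      refine threeGen_cases₂ (C := fun (a : Module.End k (Fin 8 → k))
        (b : Module.End k (Fin 4 → k)) => (![a x 0, a x 1, a x 2, a x 3] : Fin 4 → k)
          = b (![x 0, x 1, x 2, x 3] : Fin 4 → k)) ?_ ?_ ?_ ?_ i.1
      · ext i; fin_cases i <;> simp [famOne, famQuoOne]
      · ext i; fin_cases i <;> simp [famTwo]
      · ext i; fin_cases i <;> simp [famThree, famQuoThree]
      · ext i; fin_cases i <;> simp <;> rfl

theorem famIncl_injective (c : k) : Function.Injective (famIncl r c) := by
  intro (s : Fin 4 → k) (t : Fin 4 → k) h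
  have h : (![0, 0, 0, 0, s 0, s 1, s 2, s 3] : Fin 8 → k) = ![0, 0, 0, 0, t 0, t 1, t 2, t 3] := h
  show s = t
  ext i
  fin_cases i
  · exact congrFun h 4
  · exact congrFun h 5
  · exact congrFun h 6
  · exact congrFun h 7

theorem famProj_surjective (c : k) : Function.Surjective (famProj r c) := by
  intro (s : Fin 4 → k)
  refine ⟨(![s 0, s 1, s 2, s 3, 0, 0, 0, 0] : Fin 8 → k), ?_⟩
  show (![s 0, s 1, s 2, s 3] : Fin 4 → k) = s
  ext i
  fin_cases i <;> rfl

theorem ker_famProj_le (c : k) : LinearMap.ker (famProj r c) ≤ LinearMap.range (famIncl r c) := by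
  intro (x : Fin 8 → k) h
  have h : (![x 0, x 1, x 2, x 3] : Fin 4 → k) = 0 := h
  refine ⟨(![x 4, x 5, x 6, x 7] : Fin 4 → k), ?_⟩
  show (![0, 0, 0, 0, x 4, x 5, x 6, x 7] : Fin 8 → k) = x
  ext i
  fin_cases i
  · exact (congrFun h 0).symm
  · exact (congrFun h 1).symm
  · exact (congrFun h 2).symm
  · exact (congrFun h 3).symm
  all_goals rfl

end Family
end ZeroHecke

namespace ZeroHecke

section Orthogonal

variable {k : Type} [Field k]

/-- The action of `1 + T₁` on the members of the family. -/
def idemOne (x : Fin 8 → k) : Fin 8 → k := ![x 0, x 1, 0, x 3, 0, x 5, 0, 0]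

/-- The action of `1 + T₂` on the member of the family with the given parameter. -/
def idemTwo (c : k) (x : Fin 8 → k) : Fin 8 → k :=
  ![0, 0, 0, 0, x 4 + x 0 - x 1, x 5 + c * x 0 - x 1, x 6 + x 0 + x 2, x 7 + x 1 + x 3]

/-- The action of `1 + T₃` on the members of the family. -/
def idemThree (x : Fin 8 → k) : Fin 8 → k := ![x 0, x 1, x 2, 0, x 4, 0, 0, 0]

set_option maxHeartbeats 2000000 in
theorem eq_zero_of_intertwine {c d : k} (hcd : c ≠ d) {f₁ f₂ f₃ : (Fin 8 → k) →ₗ[k] (Fin 8 → k)}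
    (h11 : ∀ x, f₁ (idemOne x) = idemOne (f₁ x)) (h12 : ∀ x, f₂ (idemOne x) = idemTwo d (f₁ x))
    (h13 : ∀ x, f₃ (idemOne x) = idemThree (f₁ x)) (h21 : ∀ x, f₁ (idemTwo c x) = idemOne (f₂ x))
    (h22 : ∀ x, f₂ (idemTwo c x) = idemTwo d (f₂ x))
    (h23 : ∀ x, f₃ (idemTwo c x) = idemThree (f₂ x))
    (h31 : ∀ x, f₁ (idemThree x) = idemOne (f₃ x))
    (h32 : ∀ x, f₂ (idemThree x) = idemTwo d (f₃ x))
    (h33 : ∀ x, f₃ (idemThree x) = idemThree (f₃ x)) (h1 : ∀ x, idemOne (f₁ x) = f₁ x)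
    (h2 : ∀ x, idemTwo d (f₂ x) = f₂ x) (h3 : ∀ x, idemThree (f₃ x) = f₃ x) :
    (∀ x, f₁ x = 0) ∧ (∀ x, f₂ x = 0) ∧ ∀ x, f₃ x = 0 := by
  have c1 : ∀ x, f₁ x 2 = 0 ∧ f₁ x 4 = 0 ∧ f₁ x 6 = 0 ∧ f₁ x 7 = 0 := fun x =>
    ⟨(congrFun (h1 x) 2).symm, (congrFun (h1 x) 4).symm, (congrFun (h1 x) 6).symm,
      (congrFun (h1 x) 7).symm⟩
  have c2 : ∀ x, f₂ x 0 = 0 ∧ f₂ x 1 = 0 ∧ f₂ x 2 = 0 ∧ f₂ x 3 = 0 := fun x =>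
    ⟨(congrFun (h2 x) 0).symm, (congrFun (h2 x) 1).symm, (congrFun (h2 x) 2).symm,
      (congrFun (h2 x) 3).symm⟩
  have c3 : ∀ x, f₃ x 3 = 0 ∧ f₃ x 5 = 0 ∧ f₃ x 6 = 0 ∧ f₃ x 7 = 0 := fun x =>
    ⟨(congrFun (h3 x) 3).symm, (congrFun (h3 x) 5).symm, (congrFun (h3 x) 6).symm,
      (congrFun (h3 x) 7).symm⟩
  have k12 : ∀ x, f₂ (idemOne x) 4 = f₁ x 4 + f₁ x 0 - f₁ x 1 ∧
      f₂ (idemOne x) 5 = f₁ x 5 + d * f₁ x 0 - f₁ x 1 ∧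
      f₂ (idemOne x) 6 = f₁ x 6 + f₁ x 0 + f₁ x 2 ∧
      f₂ (idemOne x) 7 = f₁ x 7 + f₁ x 1 + f₁ x 3 := fun x =>
    ⟨congrFun (h12 x) 4, congrFun (h12 x) 5, congrFun (h12 x) 6, congrFun (h12 x) 7⟩
  have k32 : ∀ x, f₂ (idemThree x) 4 = f₃ x 4 + f₃ x 0 - f₃ x 1 ∧
      f₂ (idemThree x) 5 = f₃ x 5 + d * f₃ x 0 - f₃ x 1 ∧
      f₂ (idemThree x) 6 = f₃ x 6 + f₃ x 0 + f₃ x 2 ∧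
      f₂ (idemThree x) 7 = f₃ x 7 + f₃ x 1 + f₃ x 3 := fun x =>
    ⟨congrFun (h32 x) 4, congrFun (h32 x) 5, congrFun (h32 x) 6, congrFun (h32 x) 7⟩
  have k21 : ∀ x, f₁ (idemTwo c x) 5 = f₂ x 5 ∧ f₁ (idemTwo c x) 0 = f₂ x 0 ∧
      f₁ (idemTwo c x) 1 = f₂ x 1 ∧ f₁ (idemTwo c x) 3 = f₂ x 3 := fun x =>
    ⟨congrFun (h21 x) 5, congrFun (h21 x) 0, congrFun (h21 x) 1, congrFun (h21 x) 3⟩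
  have k23 : ∀ x, f₃ (idemTwo c x) 4 = f₂ x 4 ∧ f₃ (idemTwo c x) 0 = f₂ x 0 ∧
      f₃ (idemTwo c x) 1 = f₂ x 1 ∧ f₃ (idemTwo c x) 2 = f₂ x 2 := fun x =>
    ⟨congrFun (h23 x) 4, congrFun (h23 x) 0, congrFun (h23 x) 1, congrFun (h23 x) 2⟩
  have k31 : ∀ x, f₁ (idemThree x) 0 = f₃ x 0 ∧ f₁ (idemThree x) 1 = f₃ x 1 ∧
      f₁ (idemThree x) 3 = f₃ x 3 ∧ f₁ (idemThree x) 5 = f₃ x 5 := fun x =>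
    ⟨congrFun (h31 x) 0, congrFun (h31 x) 1, congrFun (h31 x) 3, congrFun (h31 x) 5⟩
  have k13 : ∀ x, f₃ (idemOne x) 0 = f₁ x 0 ∧ f₃ (idemOne x) 1 = f₁ x 1 ∧
      f₃ (idemOne x) 2 = f₁ x 2 ∧ f₃ (idemOne x) 4 = f₁ x 4 := fun x =>
    ⟨congrFun (h13 x) 0, congrFun (h13 x) 1, congrFun (h13 x) 2, congrFun (h13 x) 4⟩
  let e : Fin 8 → Fin 8 → k := fun i => Pi.single i 1
  have a1 : ∀ i, idemOne (e i) = if i = 0 ∨ i = 1 ∨ i = 3 ∨ i = 5 then e i else 0 := by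
    intro i
    ext j
    fin_cases i <;> fin_cases j <;> simp [idemOne, e]
  have a3 : ∀ i, idemThree (e i) = if i = 0 ∨ i = 1 ∨ i = 2 ∨ i = 4 then e i else 0 := by
    intro i
    ext j
    fin_cases i <;> fin_cases j <;> simp [idemThree, e]
  have a20 : idemTwo c (e 0) = e 4 + c • e 5 + e 6 := by
    ext j
    fin_cases j <;> simp [idemTwo, e]
  have a21 : idemTwo c (e 1) = e 7 - e 4 - e 5 := by
    ext j
    fin_cases j <;> simp [idemTwo, e]
  have a22 : idemTwo c (e 2) = e 6 := by
    ext j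
    fin_cases j <;> simp [idemTwo, e]
  have a23 : idemTwo c (e 3) = e 7 := by
    ext j
    fin_cases j <;> simp [idemTwo, e]
  have a24 : ∀ i, 4 ≤ i → idemTwo c (e i) = e i := by
    intro i hi
    ext j
    fin_cases i <;> first | (exact absurd hi (by decide)) | (fin_cases j <;> simp [idemTwo, e])
  have hdec : ∀ x, idemTwo c x = idemTwo c x 4 • e 4 + idemTwo c x 5 • e 5 +
      idemTwo c x 6 • e 6 + idemTwo c x 7 • e 7 := fun x => by
    ext j
    fin_cases j <;> simp [idemTwo, e]
  clear_value e
  have z1 : ∀ i, ¬(i = 0 ∨ i = 1 ∨ i = 3 ∨ i = 5) → f₁ (e i) = 0 := fun i hi => by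
    rw [← h1, ← h11, a1, if_neg hi, map_zero]
  have z3 : ∀ i, ¬(i = 0 ∨ i = 1 ∨ i = 2 ∨ i = 4) → f₃ (e i) = 0 := fun i hi => by
    rw [← h3, ← h33, a3, if_neg hi, map_zero]
  have r2 : ∀ x, f₂ (idemTwo c x) = f₂ x := fun x => (h22 x).trans (h2 x)
  have f24 : f₂ (e 4) 5 = 0 ∧ f₂ (e 4) 6 = 0 ∧ f₂ (e 4) 7 = 0 := by
    have h := k23 (e 4)
    have h' := k32 (e 4)
    rw [a24 4 (by decide)] at h
    rw [a3, if_pos (by decide)] at h'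
    have := c2 (e 4)
    have := c3 (e 4)
    grind
  have f25 : f₂ (e 5) 4 = 0 ∧ f₂ (e 5) 6 = 0 ∧ f₂ (e 5) 7 = 0 := by
    have h := k21 (e 5)
    have h' := k12 (e 5)
    rw [a24 5 (by decide)] at h
    rw [a1, if_pos (by decide)] at h'
    have := c2 (e 5)
    have := c1 (e 5)
    grind
  have f26 : f₂ (e 6) 4 = 0 ∧ f₂ (e 6) 5 = 0 ∧ f₂ (e 6) 7 = 0 := by
    have h := k21 (e 6)
    have h' := k23 (e 6)
    rw [a24 6 (by decide), z1 6 (by decide)] at h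
    rw [a24 6 (by decide), z3 6 (by decide)] at h'
    have h3 := (k32 (e 2)).2.2.2
    rw [a3, if_pos (by decide), ← r2, a22] at h3
    have h4 := (k31 (e 2)).2.1
    rw [a3, if_pos (by decide), z1 2 (by decide)] at h4
    have := c3 (e 2)
    have h0 : ∀ j, (0 : Fin 8 → k) j = 0 := fun j => rfl
    grind
  have f27 : f₂ (e 7) 4 = 0 ∧ f₂ (e 7) 5 = 0 ∧ f₂ (e 7) 6 = 0 := by
    have h := k21 (e 7)
    have h' := k23 (e 7)
    rw [a24 7 (by decide), z1 7 (by decide)] at h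
    rw [a24 7 (by decide), z3 7 (by decide)] at h'
    have h3 := (k12 (e 3)).2.2.1
    rw [a1, if_pos (by decide), ← r2, a23] at h3
    have h4 := (k13 (e 3)).1
    rw [a1, if_pos (by decide), z3 3 (by decide)] at h4
    have := c1 (e 3)
    have h0 : ∀ j, (0 : Fin 8 → k) j = 0 := fun j => rfl
    grind
  have q35 : ∀ i, i = 0 ∨ i = 1 → f₁ (e i) 3 = 0 ∧ f₁ (e i) 5 = 0 := by
    intro i hi
    have h := k31 (e i)
    rw [a3, if_pos (by grind)] at h
    have := c3 (e i)
    grind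
  have q0 := k12 (e 0)
  rw [a1, if_pos (by decide), ← r2, a20] at q0
  have q1 := k12 (e 1)
  rw [a1, if_pos (by decide), ← r2, a21] at q1
  simp only [map_add, map_sub, map_smul, Pi.add_apply, Pi.sub_apply, Pi.smul_apply,
    smul_eq_mul] at q0 q1
  have hq0 := q35 0 (.inl rfl)
  have hq1 := q35 1 (.inr rfl)
  have hc0 := c1 (e 0)
  have hc1 := c1 (e 1)
  have hη : (c - d) * f₂ (e 5) 5 = 0 := by grind
  have hη := (mul_eq_zero.1 hη).resolve_left (sub_ne_zero.2 hcd)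
  have hall : f₂ (e 4) 4 = 0 ∧ f₂ (e 6) 6 = 0 ∧ f₂ (e 7) 7 = 0 := by grind
  have hz : ∀ i, (∀ j : Fin 8, 4 ≤ j → f₂ (e i) j = 0) → f₂ (e i) = 0 := fun i h => by
    have := c2 (e i)
    ext j
    fin_cases j
    · exact this.1
    · exact this.2.1
    · exact this.2.2.1
    · exact this.2.2.2
    all_goals exact h _ (by decide)
  have g2 : ∀ i : Fin 8, 4 ≤ i → f₂ (e i) = 0 := fun i hi => hz i fun j hj => by
    fin_cases i <;> first | (exact absurd hi (by decide)) | skip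
    all_goals fin_cases j <;> first | (exact absurd hj (by decide)) | skip
    all_goals simp [f24, f25, f26, f27, hη, hall]
  have f2z : ∀ x, f₂ x = 0 := fun x => by
    rw [← r2, hdec]
    simp only [map_add, map_smul, g2 4 (by decide), g2 5 (by decide), g2 6 (by decide),
      g2 7 (by decide), smul_zero, add_zero]
  have hzz : ∀ j, (0 : Fin 8 → k) j = 0 := fun j => rfl
  have f1z : ∀ x, f₁ x = 0 := fun x => by
    have h := k12 x
    rw [f2z] at h
    have := c1 x
    have h' : f₁ x 0 = 0 ∧ f₁ x 1 = 0 ∧ f₁ x 3 = 0 ∧ f₁ x 5 = 0 := by grind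
    ext j
    fin_cases j <;> simp [this, h']
  refine ⟨f1z, f2z, fun x => ?_⟩
  have h := k32 x
  have h' := k31 x
  rw [f2z] at h
  rw [f1z] at h'
  have := c3 x
  have h' : f₃ x 0 = 0 ∧ f₃ x 1 = 0 ∧ f₃ x 2 = 0 ∧ f₃ x 4 = 0 := by grind
  ext j
  fin_cases j <;> simp [this, h']

end Orthogonal
end ZeroHecke

namespace ZeroHecke

section Evaluate

variable {k : Type} [Field k] {n r : ℕ} {T : Equiv.Perm (Fin r) → HeckeA k r}
variable {X Y : FM k (HeckeA k r)ᵐᵒᵖ}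

theorem op_moveTo_smul (lam mu : Comp n r) (f : HomS n T X) :
    op (moveTo T lam mu) • f = liftAt T mu (evAt lam f) :=
  LinearMap.ext fun p => by
    show f.hom (emb T lam (coord T mu p)) = op (coord T mu p) • f.hom (emb T lam 1)
    rw [← map_smul, ← map_smul, op_smul_eq_mul, one_mul]

/-- `liftAt` as a linear map. -/
def liftAtₗ (T : Equiv.Perm (Fin r) → HeckeA k r) (lam : Comp n r) : X →ₗ[k] HomS n T X where
  toFun := liftAt T lam
  map_add' x y := LinearMap.ext fun p => smul_add (op (coord T lam p)) x y
  map_smul' c x := LinearMap.ext fun p => smul_comm (op (coord T lam p)) c x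

variable (X) in
/-- `evAt` as a linear map. -/
def evAtₗ (T : Equiv.Perm (Fin r) → HeckeA k r) (lam : Comp n r) : HomS n T X →ₗ[k] X where
  toFun := evAt lam
  map_add' _ _ := rfl
  map_smul' _ _ := rfl

/-- The map induced on the spaces `X x_λ` by a homomorphism of `S_0(n,r)`-modules. -/
def compAt (lam : Comp n r) (φ : HomS n T X →ₗ[(Schur0 k n r T)ᵐᵒᵖ] HomS n T Y) : X →ₗ[k] Y :=
  (evAtₗ Y T lam).comp ((φ.restrictScalars k).comp (liftAtₗ T lam))

variable (φ : HomS n T X →ₗ[(Schur0 k n r T)ᵐᵒᵖ] HomS n T Y)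

theorem compAt_apply (lam : Comp n r) (x : X) : compAt lam φ x = evAt lam (φ (liftAt T lam x)) :=
  rfl

theorem compAt_xElt (lam mu : Comp n r) (x : X) :
    compAt mu φ (op (xElt k T lam) • x) = op (xElt k T mu) • compAt lam φ x := by
  rw [compAt_apply, compAt_apply, ← op_moveTo_smul_liftAt, map_smul, evAt_op_moveTo_smul]

theorem xElt_compAt (hT : IsHeckeBasis k r T) (lam : Comp n r) (x : X) :
    op (xElt k T lam) • compAt lam φ x = compAt lam φ x :=
  op_xElt_smul_evAt hT _ _

theorem op_xElt_smul_evAt_apply (lam mu : Comp n r) (f : HomS n T X) :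
    op (xElt k T mu) • evAt lam (φ f) = compAt mu φ (evAt lam f) := by
  rw [compAt_apply, ← op_moveTo_smul, map_smul, evAt_op_moveTo_smul]

end Evaluate

section NotFinite

variable {k : Type} [Field k] {n r : ℕ} {T : Equiv.Perm (Fin r) → HeckeA k r}

theorem fam_smul_eq_zero {c : k} (i : AGen r) (x : fam r c) (h : 3 ≤ i.1) :
    op (TGen k r i) • x = 0 := by
  rw [fam_smul, threeGen, if_neg (by omega), if_neg (by omega), if_neg (by omega)]
  rfl

theorem add_famOne (x : Fin 8 → k) : x + famOne k x = idemOne x := by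
  ext i
  fin_cases i <;> simp [famOne, idemOne]

theorem add_famTwo {c : k} (x : Fin 8 → k) : x + famTwo c x = idemTwo c x := by
  ext i
  fin_cases i <;> simp [famTwo, idemTwo] <;> ring

theorem add_famThree (x : Fin 8 → k) : x + famThree k x = idemThree x := by
  ext i
  fin_cases i <;> simp [famThree, idemThree]

variable (hn : 3 ≤ n) (hr : 4 ≤ r)

theorem fam_comp₁ (hT : IsHeckeBasis k r T) {c : k} (x : fam r c) :
    op (xElt k T (comp₁ hn hr)) • x = idemOne (k := k) x := by
  refine (xElt_comp₁_smul hn hr hT fam_smul_eq_zero x).trans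
    ((congrArg (x + ·) (fam_smul _ x)).trans (add_famOne _))

theorem fam_comp₂ (hT : IsHeckeBasis k r T) {c : k} (x : fam r c) :
    op (xElt k T (comp₂ hn hr)) • x = idemTwo c x := by
  refine (xElt_comp₂_smul hn hr hT fam_smul_eq_zero x).trans
    ((congrArg (x + ·) (fam_smul _ x)).trans (add_famTwo _))

theorem fam_comp₃ (hT : IsHeckeBasis k r T) {c : k} (x : fam r c) :
    op (xElt k T (comp₃ hn hr)) • x = idemThree (k := k) x := by
  refine (xElt_comp₃_smul hn hr hT fam_smul_eq_zero x).trans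
    ((congrArg (x + ·) (fam_smul _ x)).trans (add_famThree _))

theorem eq_zero_of_idem {c : k} {y : Fin 8 → k} (h1 : idemOne y = 0) (h2 : idemTwo c y = 0)
    (h3 : idemThree y = 0) : y = 0 := by
  have a0 : y 0 = 0 := congrFun h1 0
  have a1 : y 1 = 0 := congrFun h1 1
  have a2 : y 2 = 0 := congrFun h3 2
  have a3 : y 3 = 0 := congrFun h1 3
  have a4 : y 4 = 0 := congrFun h3 4
  have a5 : y 5 = 0 := congrFun h1 5
  have a6 : y 6 + y 0 + y 2 = 0 := congrFun h2 6
  have a7 : y 7 + y 1 + y 3 = 0 := congrFun h2 7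
  rw [a0, a2, add_zero, add_zero] at a6
  rw [a1, a3, add_zero, add_zero] at a7
  ext i
  fin_cases i <;> assumption

theorem hom_fam_eq_zero (hn : 3 ≤ n) (hr : 4 ≤ r) (hT : IsHeckeBasis k r T) {c d : k} (hcd : c ≠ d)
    (φ : HomS n T (fam r c) →ₗ[(Schur0 k n r T)ᵐᵒᵖ] HomS n T (fam r d)) : φ = 0 := by
  obtain ⟨z1, z2, z3⟩ := eq_zero_of_intertwine hcd (f₁ := compAt (comp₁ hn hr) φ)
    (f₂ := compAt (comp₂ hn hr) φ) (f₃ := compAt (comp₃ hn hr) φ)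
    (fun x => (congrArg _ (fam_comp₁ hn hr hT (c := c) x).symm).trans
      ((compAt_xElt φ _ _ x).trans (fam_comp₁ hn hr hT (c := d) _)))
    (fun x => (congrArg _ (fam_comp₁ hn hr hT (c := c) x).symm).trans
      ((compAt_xElt φ _ _ x).trans (fam_comp₂ hn hr hT (c := d) _)))
    (fun x => (congrArg _ (fam_comp₁ hn hr hT (c := c) x).symm).trans
      ((compAt_xElt φ _ _ x).trans (fam_comp₃ hn hr hT (c := d) _)))
    (fun x => (congrArg _ (fam_comp₂ hn hr hT (c := c) x).symm).trans
      ((compAt_xElt φ _ _ x).trans (fam_comp₁ hn hr hT (c := d) _)))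
    (fun x => (congrArg _ (fam_comp₂ hn hr hT (c := c) x).symm).trans
      ((compAt_xElt φ _ _ x).trans (fam_comp₂ hn hr hT (c := d) _)))
    (fun x => (congrArg _ (fam_comp₂ hn hr hT (c := c) x).symm).trans
      ((compAt_xElt φ _ _ x).trans (fam_comp₃ hn hr hT (c := d) _)))
    (fun x => (congrArg _ (fam_comp₃ hn hr hT (c := c) x).symm).trans
      ((compAt_xElt φ _ _ x).trans (fam_comp₁ hn hr hT (c := d) _)))
    (fun x => (congrArg _ (fam_comp₃ hn hr hT (c := c) x).symm).trans
      ((compAt_xElt φ _ _ x).trans (fam_comp₂ hn hr hT (c := d) _)))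
    (fun x => (congrArg _ (fam_comp₃ hn hr hT (c := c) x).symm).trans
      ((compAt_xElt φ _ _ x).trans (fam_comp₃ hn hr hT (c := d) _)))
    (fun x => (fam_comp₁ hn hr hT (c := d) _).symm.trans (xElt_compAt φ hT _ x))
    (fun x => (fam_comp₂ hn hr hT (c := d) _).symm.trans (xElt_compAt φ hT _ x))
    (fun x => (fam_comp₃ hn hr hT (c := d) _).symm.trans (xElt_compAt φ hT _ x))
  refine LinearMap.ext fun f => HomS.ext_evAt hT fun lam => ?_
  have hz : evAt lam (φ f) = 0 := by
    refine eq_zero_of_idem (c := d) ?_ ?_ ?_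
    · exact (fam_comp₁ hn hr hT (c := d) _).symm.trans
        ((op_xElt_smul_evAt_apply φ _ _ f).trans (z1 _))
    · exact (fam_comp₂ hn hr hT (c := d) _).symm.trans
        ((op_xElt_smul_evAt_apply φ _ _ f).trans (z2 _))
    · exact (fam_comp₃ hn hr hT (c := d) _).symm.trans
        ((op_xElt_smul_evAt_apply φ _ _ f).trans (z3 _))
  exact hz

theorem not_tauTiltingFinite_schur0 [IsAlgClosed k] (hn : 3 ≤ n) (hr : 4 ≤ r)
    (hT : IsHeckeBasis k r T) :
    ¬ TauTiltingFinite k (Schur0 k n r T) := by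
  have := finite_schur0 (n := n) hT
  have : Infinite k := IsAlgClosed.instInfinite
  refine FM.not_tauTiltingFinite (Λ := k) (fun c => homFM n hT (fam r c)) (fun c => ?_)
    (fun a b hab f => hom_fam_eq_zero hn hr hT hab f)
    (fun P _ _ _ a b h => exists_hom_ne_zero_of_exact hT (famIncl_injective r a)
      (ker_famProj_le r a) (famIncl_injective r b) (famProj_surjective r b) h)
  let x : fam r c := (Pi.single 0 1 : Fin 8 → k)
  refine ⟨liftAt T (comp₁ hn hr) x, 0, fun h => ?_⟩
  have h1 : evAt (comp₁ hn hr) (liftAt T (comp₁ hn hr) x) = 0 :=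
    congrArg (evAt (comp₁ hn hr)) h
  rw [evAt_liftAt, fam_comp₁ hn hr hT] at h1
  have h2 : (Pi.single 0 1 : Fin 8 → k) 0 = 0 := congrFun (β := fun _ : Fin 8 => k) h1 0
  simp at h2

end NotFinite
end ZeroHecke

/-- A full corner `εAε` of an algebra `A`, identified with a quotient of `H`. -/
structure FullCorner (k H A : Type) [Field k] [Ring H] [Algebra k H] [Ring A] [Algebra k A] where
  map : H →ₗ[k] A
  map_mul : ∀ a b, map (a * b) = map a * map b
  surj : ∀ a, ∃ h, map h = map 1 * a * map 1
  ι : Type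
  [fintype : Fintype ι]
  left : ι → A
  right : ι → A
  left_mul : ∀ s, left s * map 1 = left s
  mul_right : ∀ s, map 1 * right s = right s
  sum_mul : ∑ s, left s * right s = 1

namespace FullCorner

attribute [instance] FullCorner.fintype

variable {k H A : Type} [Field k] [Ring H] [Algebra k H] [Ring A] [Algebra k A]
variable (C : FullCorner k H A) (N N' N'' : FM k Aᵐᵒᵖ)

theorem map_mul_one (h : H) : C.map h * C.map 1 = C.map h := by rw [← C.map_mul, mul_one]

/-- The subspace `Nε`. -/
def space : Submodule k N where
  carrier := {x | op (C.map 1) • x = x}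
  add_mem' {x y} hx hy := by
    show _ • (x + y) = x + y
    rw [smul_add, hx, hy]
  zero_mem' := smul_zero _
  smul_mem' c x hx := by
    show _ • (c • x) = c • x
    rw [smul_comm, hx]

variable {N} in
theorem smul_mem (h : H) (x : N) : op (C.map h) • x ∈ C.space N := by
  show op (C.map 1) • op (C.map h) • x = _
  rw [← mul_smul, ← op_mul, C.map_mul_one]

instance : Module Hᵐᵒᵖ (C.space N) where
  smul c x := ⟨op (C.map (unop c)) • x.1, C.smul_mem _ _⟩
  one_smul x := Subtype.ext x.2
  mul_smul c d x := Subtype.ext (by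
    show op (C.map (unop d * unop c)) • x.1 = op (C.map (unop c)) • op (C.map (unop d)) • x.1
    rw [C.map_mul, op_mul, mul_smul])
  smul_zero c := Subtype.ext (smul_zero _)
  smul_add c x y := Subtype.ext (smul_add _ _ _)
  add_smul c d x := Subtype.ext (by
    show op (C.map (unop c + unop d)) • x.1 = op (C.map (unop c)) • x.1 + op (C.map (unop d)) • x.1
    rw [map_add, MulOpposite.op_add, add_smul])
  zero_smul x := Subtype.ext (by
    show op (C.map 0) • x.1 = 0
    rw [map_zero, MulOpposite.op_zero, zero_smul])

theorem coe_smul (h : H) (x : C.space N) :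
    ((op h • x : C.space N) : N) = op (C.map h) • (x : N) := rfl

instance : IsScalarTower k Hᵐᵒᵖ (C.space N) :=
  .of_algebraMap_smul fun c x => Subtype.ext (by
    show op (C.map (algebraMap k H c)) • x.1 = c • x.1
    rw [Algebra.algebraMap_eq_smul_one, map_smul, op_smul, smul_assoc]
    congr 1
    exact x.2)

/-- The `H`-module `Nε`. -/
abbrev corner : FM k Hᵐᵒᵖ := ⟨C.space N⟩

variable {N N' N''}

theorem left_mem (s : C.ι) (x : N) : op (C.left s) • x ∈ C.space N := by
  show op (C.map 1) • op (C.left s) • x = _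
  rw [← mul_smul, ← op_mul, C.left_mul]

theorem sum_smul (x : N) : ∑ s, op (C.right s) • op (C.left s) • x = x := by
  simp_rw [← mul_smul, ← op_mul]
  rw [← Finset.sum_smul, ← Finset.op_sum, C.sum_mul]
  exact one_smul _ x

/-- Restriction of homomorphisms to the corner. -/
def restrict (f : N →ₗ[Aᵐᵒᵖ] N') : C.corner N →ₗ[Hᵐᵒᵖ] C.corner N' where
  toFun x := ⟨f x.1, by
    show op (C.map 1) • f x.1 = f x.1
    rw [← map_smul, show op (C.map 1) • x.1 = x.1 from x.2]⟩
  map_add' x y := Subtype.ext (map_add f _ _)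
  map_smul' c x := Subtype.ext (map_smul f _ _)

theorem ext_restrict {f g : N →ₗ[Aᵐᵒᵖ] N'} (h : C.restrict f = C.restrict g) : f = g := by
  ext x
  rw [← C.sum_smul x, map_sum, map_sum]
  refine Finset.sum_congr rfl fun s _ => ?_
  exact (map_smul f _ _).trans ((congrArg _
    (congrArg Subtype.val (LinearMap.congr_fun h ⟨_, C.left_mem s x⟩))).trans (map_smul g _ _).symm)

theorem exists_restrict (φ : C.corner N →ₗ[Hᵐᵒᵖ] C.corner N') :
    ∃ f : N →ₗ[Aᵐᵒᵖ] N', C.restrict f = φ := by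
  have key : ∀ (a : A) (x : C.space N) (y : C.space N), op a • x.1 = y.1 →
      op (C.map 1 * a * C.map 1) • (φ x).1 = (φ y).1 := fun a x y hxy => by
    obtain ⟨h, hh⟩ := C.surj a
    have hy : op h • x = y := Subtype.ext (by
      rw [C.coe_smul, hh, op_mul, op_mul, mul_smul, mul_smul,
        show op (C.map 1) • x.1 = x.1 from x.2, hxy]
      exact y.2)
    rw [← hy, map_smul, ← hh]
    rfl
  have fix : ∀ x : C.space N', op (C.map 1) • x.1 = x.1 := fun x => x.2
  let F : N → N' := fun x => ∑ s, op (C.right s) • (φ ⟨_, C.left_mem s x⟩).1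
  have Fadd : ∀ x y, F (x + y) = F x + F y := fun x y => by
    show ∑ s, _ = ∑ s, _ + ∑ s, _
    rw [← Finset.sum_add_distrib]
    refine Finset.sum_congr rfl fun s _ => ?_
    rw [← smul_add]
    congr 1
    have : (⟨_, C.left_mem s (x + y)⟩ : C.space N) = ⟨_, C.left_mem s x⟩ + ⟨_, C.left_mem s y⟩ :=
      Subtype.ext (smul_add _ _ _)
    rw [this]
    exact congrArg Subtype.val (map_add φ _ _)
  have Fsum : ∀ {ι : Type} (t : Finset ι) (g : ι → N), F (∑ i ∈ t, g i) = ∑ i ∈ t, F (g i) :=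
    fun t g => map_sum (AddMonoidHom.mk' F Fadd) g t
  have Fcorner : ∀ (x : C.space N) (a : A), F (op a • x.1) = op a • (φ x).1 := fun x a => by
    have h1 : ∀ s, (φ ⟨_, C.left_mem s (op a • x.1)⟩).1
        = op (C.map 1 * (a * C.left s) * C.map 1) • (φ x).1 := fun s =>
      (key _ _ _ (by rw [op_mul, mul_smul])).symm
    show ∑ s, _ = _
    simp_rw [h1, ← mul_smul, ← op_mul]
    rw [← Finset.sum_smul, ← Finset.op_sum]
    have h2 : ∑ s, C.map 1 * (a * C.left s) * C.map 1 * C.right s = C.map 1 * a := by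
      conv_rhs => rw [← mul_one (C.map 1 * a), ← C.sum_mul, Finset.mul_sum]
      refine Finset.sum_congr rfl fun s _ => ?_
      rw [mul_assoc _ (C.map 1) (C.right s), C.mul_right]
      simp only [mul_assoc]
    rw [h2]
    show op (C.map 1 * a) • _ = _
    rw [op_mul, mul_smul, fix]
  have Fsmul : ∀ (a : A) (x : N), F (op a • x) = op a • F x := fun a x => by
    conv_lhs => rw [← C.sum_smul x, Finset.smul_sum, Fsum]
    rw [show F x = ∑ s, _ from rfl, Finset.smul_sum]
    refine Finset.sum_congr rfl fun s _ => ?_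
    rw [← mul_smul, ← op_mul]
    have := Fcorner ⟨_, C.left_mem s x⟩ (C.right s * a)
    rw [this, op_mul, mul_smul]
  refine ⟨{ toFun := F, map_add' := Fadd, map_smul' := fun c x => Fsmul (unop c) x }, ?_⟩
  ext x
  have := Fcorner x 1
  rw [op_one, one_smul, one_smul] at this
  exact this

theorem restrict_comp (f : N →ₗ[Aᵐᵒᵖ] N') (g : N' →ₗ[Aᵐᵒᵖ] N'') :
    C.restrict (g.comp f) = (C.restrict g).comp (C.restrict f) := rfl

theorem iso_of_iso (h : FM.Iso (C.corner N) (C.corner N')) : FM.Iso N N' := by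
  obtain ⟨e⟩ := h
  obtain ⟨f, hf⟩ := C.exists_restrict e.toLinearMap
  obtain ⟨g, hg⟩ := C.exists_restrict e.symm.toLinearMap
  refine ⟨LinearEquiv.ofLinearMap f g (C.ext_restrict ?_) (C.ext_restrict ?_)⟩
  · rw [restrict_comp, hf, hg]
    exact LinearMap.ext fun x => e.apply_symm_apply x
  · rw [restrict_comp, hf, hg]
    exact LinearMap.ext fun x => e.symm_apply_apply x

theorem indec_corner (h : FM.Indec N) : FM.Indec (C.corner N) := by
  refine ⟨?_, fun K L hKL => ?_⟩
  · by_contra hn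
    rw [not_nontrivial_iff_subsingleton] at hn
    have := h.1
    obtain ⟨x, hx⟩ := exists_ne (0 : N)
    refine hx ?_
    rw [← C.sum_smul x]
    refine Finset.sum_eq_zero fun s _ => ?_
    have : (⟨_, C.left_mem s x⟩ : C.space N) = 0 := hn.elim _ _
    rw [show op (C.left s) • x = 0 from congrArg Subtype.val this, smul_zero]
  · let π : C.corner N →ₗ[Hᵐᵒᵖ] C.corner N := K.subtype.comp (K.projectionOnto L hKL)
    have hK : ∀ x : C.corner N, x ∈ K → π x = x := fun x hx =>
      congrArg Subtype.val (Submodule.projectionOnto_apply_left hKL ⟨x, hx⟩)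
    have hL : ∀ x : C.corner N, x ∈ L → π x = 0 := fun x hx =>
      congrArg Subtype.val ((Submodule.projectionOnto_apply_eq_zero_iff hKL).2 hx)
    obtain ⟨f, hf⟩ := C.exists_restrict π
    have hff : f.comp f = f := C.ext_restrict (by
      rw [restrict_comp, hf]
      exact LinearMap.ext fun x => hK _ (Submodule.coe_mem _))
    have hff' : ∀ x, f (f x) = f x := fun x => LinearMap.congr_fun hff x
    have hc : IsCompl (LinearMap.range f) (LinearMap.ker f) :=
      LinearMap.IsIdempotentElem.isCompl hff
    rcases h.2 _ _ hc with h0 | h0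
    · left
      rw [eq_bot_iff]
      intro x hx
      have h1 : π = 0 := by
        rw [← hf, LinearMap.range_eq_bot.1 h0]; rfl
      rw [Submodule.mem_bot, ← hK x hx, h1]; rfl
    · right
      rw [eq_bot_iff]
      intro x hx
      have h1 : π = LinearMap.id := by
        have : f = LinearMap.id := LinearMap.ext fun x => LinearMap.ker_eq_bot.1 h0 (hff' x)
        rw [← hf, this]; rfl
      have h2 := hL x hx
      rw [h1] at h2
      exact h2

theorem representationFinite (C : FullCorner k H A) [Module.Finite k A] {m : ℕ}
    (ty : Fin m → FM k Hᵐᵒᵖ → Prop)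
    (h1 : ∀ X, FM.Indec X → ∃ i, ty i X)
    (h2 : ∀ i X Y, FM.Indec X → FM.Indec Y → ty i X → ty i Y → FM.Iso X Y) :
    RepresentationFinite A := by
  classical
  refine FM.representationFinite_of_fm (k := k) (m := m) (fun i =>
    if h : ∃ N : FM k Aᵐᵒᵖ, FM.Indec N ∧ ty i (C.corner N) then h.choose else .zero)
    fun N hN => ?_
  obtain ⟨i, hi⟩ := h1 _ (C.indec_corner hN)
  have h : ∃ N : FM k Aᵐᵒᵖ, FM.Indec N ∧ ty i (C.corner N) := ⟨N, hN, hi⟩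
  refine ⟨i, ?_⟩
  rw [dif_pos h]
  exact C.iso_of_iso (h2 i _ _ (C.indec_corner hN) (C.indec_corner h.choose_spec.1) hi
    h.choose_spec.2)

end FullCorner

namespace ZeroHecke

section Corner

variable {k : Type} [Field k] {n r : ℕ} {T : Equiv.Perm (Fin r) → HeckeA k r}

/-- The composition `(1, …, 1, 0, …, 0)`. -/
def onesComp (h : r ≤ n) : Comp n r :=
  ⟨fun i => if i.1 < r then 1 else 0, by
    rw [Fin.sum_univ_eq_sum_range (fun i => if i < r then 1 else 0) n, Finset.sum_ite,
      Finset.sum_const_zero, add_zero, Finset.sum_const, smul_eq_mul, mul_one]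
    have : Finset.filter (fun i => i < r) (Finset.range n) = Finset.range r := by
      ext i
      simp only [Finset.mem_filter, Finset.mem_range]
      omega
    rw [this, Finset.card_range]⟩

theorem psum_onesComp (h : r ≤ n) (i : Fin n) (hi : i.1 < r) : psum (onesComp h).1 i = i.1 := by
  have hf : (Finset.univ.filter fun j : Fin n => (j : ℕ) < (i : ℕ)) = Finset.Iio i := by
    ext j
    simp
  rw [psum, hf, Finset.sum_congr rfl (g := fun _ => 1) fun j hj => ?_]
  · rw [Finset.sum_const, smul_eq_mul, mul_one, Fin.card_Iio]
  · have : j < i := Finset.mem_Iio.1 hj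
    exact if_pos (by omega)

theorem xElt_onesComp (hT : IsHeckeBasis k r T) (h : r ≤ n) : xElt k T (onesComp h) = 1 := by
  have : YoungFinset (r := r) (onesComp h).1 = {1} := by
    ext w
    rw [YoungFinset, Finset.mem_filter, Finset.mem_singleton]
    refine ⟨fun hw => Equiv.ext fun x => Fin.ext ?_, fun hw => ?_⟩
    · have hx : x.1 < n := lt_of_lt_of_le x.2 h
      have h1 : (onesComp h).1 ⟨x.1, hx⟩ = 1 := if_pos x.2
      have := hw.2 x ⟨x.1, hx⟩
      rw [psum_onesComp h ⟨x.1, hx⟩ x.2, h1] at this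
      have := this ⟨le_refl _, Nat.lt_succ_self _⟩
      show (w x).1 = x.1
      simp only at this
      omega
    · rw [hw]
      exact ⟨Finset.mem_univ _, fun x i hx => hx⟩
  rw [xElt, this, Finset.sum_singleton, hT.1]

/-- Left multiplication, as an endomorphism of the right regular module. -/
def mulLeftHom (a : HeckeA k r) : HeckeA k r →ₗ[(HeckeA k r)ᵐᵒᵖ] HeckeA k r where
  toFun x := a * x
  map_add' := mul_add a
  map_smul' c x := by
    rw [smul_eq_mul_unop, smul_eq_mul_unop, mul_assoc, RingHom.id_apply]

/-- The endomorphism of `⊕ x_λ H` through the summand `lam` given by left multiplication. -/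
def mulAt (T : Equiv.Perm (Fin r) → HeckeA k r) (lam : Comp n r) (a : HeckeA k r) :
    Schur0 k n r T :=
  LinearMap.comp (σ₁₂ := RingHom.id _) (M₂ := HeckeA k r) (emb T lam)
    (LinearMap.comp (σ₁₂ := RingHom.id _) (M₂ := HeckeA k r) (mulLeftHom a) (coord T lam))

/-- For `r ≤ n`, the 0-Hecke algebra is a full corner of the 0-Schur algebra. -/
def schurCorner (hT : IsHeckeBasis k r T) (h : r ≤ n) :
    FullCorner k (HeckeA k r) (Schur0 k n r T) :=
  have hce : ∀ x, coord T (onesComp h) (emb T (onesComp h) x) = x := fun x => by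
    rw [coord_emb_self, xElt_onesComp hT, one_mul]
  { map :=
      { toFun := mulAt T (onesComp h)
        map_add' := fun a b => LinearMap.ext fun p => by
          show emb T (onesComp h) ((a + b) * coord T (onesComp h) p)
            = emb T (onesComp h) (a * coord T (onesComp h) p)
              + emb T (onesComp h) (b * coord T (onesComp h) p)
          rw [add_mul, map_add]
        map_smul' := fun c a => LinearMap.ext fun p => by
          show emb T (onesComp h) ((c • a) * coord T (onesComp h) p)
            = c • emb T (onesComp h) (a * coord T (onesComp h) p)
          rw [smul_mul_assoc, LinearMap.map_smul_of_tower] }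
    map_mul := fun a b => LinearMap.ext fun p => by
      show emb T (onesComp h) ((a * b) * coord T (onesComp h) p)
        = emb T (onesComp h) (a * coord T (onesComp h)
          (emb T (onesComp h) (b * coord T (onesComp h) p)))
      rw [hce, mul_assoc]
    surj := fun a => ⟨coord T (onesComp h)
        ((show SchurModule k n r T →ₗ[(HeckeA k r)ᵐᵒᵖ] SchurModule k n r T from a)
          (emb T (onesComp h) 1)), LinearMap.ext fun p => by
      let a' : SchurModule k n r T →ₗ[(HeckeA k r)ᵐᵒᵖ] SchurModule k n r T := a
      show emb T (onesComp h) (coord T (onesComp h) (a' (emb T (onesComp h) 1))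
          * coord T (onesComp h) p)
        = emb T (onesComp h) (1 * coord T (onesComp h)
          (a' (emb T (onesComp h) (1 * coord T (onesComp h) p))))
      rw [one_mul, one_mul, ← op_smul_eq_mul, ← map_smul, ← map_smul, ← map_smul, op_smul_eq_mul,
        one_mul]⟩
    ι := Comp n r
    left := fun lam => moveTo T lam (onesComp h)
    right := fun lam => moveTo T (onesComp h) lam
    left_mul := fun lam => LinearMap.ext fun p => by
      show emb T lam (coord T (onesComp h)
        (emb T (onesComp h) (1 * coord T (onesComp h) p))) = emb T lam (coord T (onesComp h) p)
      rw [hce, one_mul]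
    mul_right := fun lam => LinearMap.ext fun p => by
      show emb T (onesComp h) (1 * coord T (onesComp h) (emb T (onesComp h) (coord T lam p)))
        = emb T (onesComp h) (coord T lam p)
      rw [hce, one_mul]
    sum_mul := LinearMap.ext fun p => by
      refine (LinearMap.sum_apply _ _ _).trans ((Finset.sum_congr rfl fun lam _ => ?_).trans
        (sum_emb_coord hT p))
      show emb T lam (coord T (onesComp h) (emb T (onesComp h) (coord T lam p))) = _
      rw [hce] }

end Corner
end ZeroHecke

namespace ZeroHecke

section Classify

variable {k V : Type} [Field k] [AddCommGroup V] [Module k V]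

/-- The pair of operators `(p, q)` is represented by the pair of matrices `(P, Q)`. -/
def HasForm {m : ℕ} (P Q : Matrix (Fin m) (Fin m) k) (p q : Module.End k V) : Prop :=
  ∃ b : Module.Basis (Fin m) k V, LinearMap.toMatrix b b p = P ∧ LinearMap.toMatrix b b q = Q

/-- A pair of operators without nontrivial commuting idempotents. -/
def IndecPair (p q : Module.End k V) : Prop :=
  ∀ e : Module.End k V, e * e = e → e * p = p * e → e * q = q * e → e = 0 ∨ e = 1

theorem IndecPair.swap {p q : Module.End k V} (h : IndecPair p q) : IndecPair q p :=
  fun e h1 h2 h3 => h e h1 h3 h2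

theorem HasForm.swap {m : ℕ} {P Q : Matrix (Fin m) (Fin m) k} {p q : Module.End k V}
    (h : HasForm P Q p q) : HasForm Q P q p := by
  obtain ⟨b, h1, h2⟩ := h
  exact ⟨b, h2, h1⟩

theorem hasForm_scalar [Nontrivial V] (c d : k)
    (h : IndecPair (c • 1 : Module.End k V) (d • 1)) :
    HasForm (m := 1) (c • 1) (d • 1) (c • 1 : Module.End k V) (d • 1) := by
  obtain ⟨x, hx⟩ := exists_ne (0 : V)
  obtain ⟨φ, hφ⟩ := Module.Projective.exists_dual_ne_zero k hx
  have h1 := h (((φ x)⁻¹ • φ).smulRight x) (by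
      ext y
      simp [hφ]) (by simp) (by simp)
  have h2 : ∀ y, ((φ x)⁻¹ * φ y) • x = y := by
    rcases h1 with h1 | h1
    · refine absurd (LinearMap.congr_fun h1 x) ?_
      simpa [hφ] using hx
    · exact fun y => LinearMap.congr_fun h1 y
  refine ⟨Module.Basis.mk (v := fun _ : Fin 1 => x) (LinearIndependent.of_subsingleton 0 hx) ?_,
    by simp, by simp⟩
  intro y _
  rw [← h2 y]
  exact Submodule.smul_mem _ _ (Submodule.subset_span ⟨0, rfl⟩)

theorem hasForm_of_mul_ne_zero {p q : Module.End k V} (hp : p * p = p) (hq : q * q = q)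
    (h : IndecPair p q) (hpqp : p * q * p = 0) (hqpq : q * p * q = 0) (ha : p * q ≠ 0) :
    HasForm (m := 2) !![0, 0; 1, 1] !![1, 0; 0, 0] p q := by
  have hp' : ∀ x, p (p x) = p x := fun x => LinearMap.congr_fun hp x
  have hq' : ∀ x, q (q x) = q x := fun x => LinearMap.congr_fun hq x
  have hpqp' : ∀ x, p (q (p x)) = 0 := fun x => LinearMap.congr_fun hpqp x
  have hqpq' : ∀ x, q (p (q x)) = 0 := fun x => LinearMap.congr_fun hqpq x
  obtain ⟨u, hu⟩ : ∃ u, p (q u) ≠ 0 := by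
    by_contra! hn
    exact ha (LinearMap.ext hn)
  obtain ⟨φ', hφ'⟩ := Module.Projective.exists_dual_ne_zero k hu
  obtain ⟨φ, hφ⟩ : ∃ φ : V →ₗ[k] k, φ (p (q u)) = 1 :=
    ⟨(φ' (p (q u)))⁻¹ • φ', by simp [hφ']⟩
  obtain ⟨v, hpv, hqv⟩ : ∃ v, p v = p (q u) ∧ q v = v :=
    ⟨q u - q (p u), by rw [map_sub, hpqp', sub_zero], by rw [map_sub, hq', hq']⟩
  obtain ⟨w, hw⟩ : ∃ w, w = p v := ⟨_, rfl⟩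
  have hpw : p w = w := by rw [hw, hp']
  have hqw : q w = 0 := by rw [hw, hpv, hqpq']
  have hφw : φ w = 1 := by rw [hw, hpv, hφ]
  let π : Module.End k V := (φ.comp (p * q)).smulRight v + (φ.comp (p - p * q)).smulRight w
  have hπ : ∀ x, π x = φ (p (q x)) • v + φ (p x - p (q x)) • w := fun x => rfl
  have hπv : π v = v := by simp [hπ, hqv, ← hw, hφw]
  have hπw : π w = w := by simp [hπ, hqw, hpw, hφw]
  have h2 := h π (by
      ext x
      show π (π x) = π x
      rw [hπ x, map_add, map_smul, map_smul, hπv, hπw]) (by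
      ext x
      show π (p x) = p (π x)
      rw [hπ x, hπ, map_add, map_smul, map_smul, hpqp', hp', ← hw, hpw, ← add_smul, ← map_add]
      simp) (by
      ext x
      show π (q x) = q (π x)
      rw [hπ x, hπ, map_add, map_smul, map_smul, hq', hqv, hqw]
      simp)
  have h3 : ∀ y, π y = y := by
    rcases h2 with h2 | h2
    · refine absurd (hφw.symm.trans ?_) one_ne_zero
      rw [← hπw, h2]; simp
    · exact fun y => LinearMap.congr_fun h2 y
  have hli : LinearIndependent k ![v, w] := by
    refine LinearIndependent.pair_iff.2 fun s t hst => ?_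
    have e1 := congrArg φ (congrArg p (congrArg q hst))
    simp [hqv, hqw, ← hw, hφw] at e1
    refine ⟨e1, ?_⟩
    rw [e1, zero_smul, zero_add] at hst
    simpa [hφw] using congrArg φ hst
  let b : Module.Basis (Fin 2) k V := Module.Basis.mk hli (by
    intro y _
    rw [← h3 y, hπ]
    exact add_mem (Submodule.smul_mem _ _ (Submodule.subset_span ⟨0, rfl⟩))
      (Submodule.smul_mem _ _ (Submodule.subset_span ⟨1, rfl⟩)))
  have b0 : b 0 = v := by simp [b]
  have b1 : b 1 = w := by simp [b]
  refine ⟨b, ?_, ?_⟩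
  · ext i j
    rw [LinearMap.toMatrix_apply]
    fin_cases j
    · have : p (b 0) = b 1 := by rw [b0, b1, hw]
      fin_cases i <;> simp [this]
    · have : p (b 1) = b 1 := by rw [b1, hpw]
      fin_cases i <;> simp [this]
  · ext i j
    rw [LinearMap.toMatrix_apply]
    fin_cases j
    · have : q (b 0) = b 0 := by rw [b0, hqv]
      fin_cases i <;> simp [this]
    · have : q (b 1) = 0 := by rw [b1, hqw]
      fin_cases i <;> simp [this]

/-- The six possible normal forms of an indecomposable pair of idempotents with `pqp = qpq`. -/
def PairType (p q : Module.End k V) : Fin 6 → Prop :=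
  ![HasForm (m := 1) ((1 : k) • 1) ((1 : k) • 1) p q,
    HasForm (m := 1) ((0 : k) • 1) ((0 : k) • 1) p q,
    HasForm (m := 1) ((1 : k) • 1) ((0 : k) • 1) p q,
    HasForm (m := 1) ((0 : k) • 1) ((1 : k) • 1) p q,
    HasForm (m := 2) !![0, 0; 1, 1] !![1, 0; 0, 0] p q,
    HasForm (m := 2) !![1, 0; 0, 0] !![0, 0; 1, 1] p q]

theorem exists_pairType [Nontrivial V] {p q : Module.End k V} (hp : p * p = p) (hq : q * q = q)
    (hpq : p * q * p = q * p * q) (h : IndecPair p q) : ∃ i, PairType p q i := by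
  have scalar : ∀ c d : k, p = c • 1 → q = d • 1 →
      HasForm (m := 1) (c • 1) (d • 1) p q := fun c d h1 h2 => by
    subst h1 h2
    exact hasForm_scalar c d h
  have hpz : p * (p * q * p) = p * q * p := by rw [← mul_assoc, ← mul_assoc, hp]
  have hzp : p * q * p * p = p * q * p := by rw [mul_assoc, hp]
  have hqz : q * (p * q * p) = p * q * p := by rw [hpq, ← mul_assoc, ← mul_assoc, hq]
  have hzq : p * q * p * q = p * q * p := by rw [hpq, mul_assoc, hq]
  have hqpq : q * p * q = p * q * p := hpq.symm
  have hqpqp : q * p * q * p = p * q * p := by rw [hqpq, hzp]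
  have hqpp : q * p * p = q * p := by rw [mul_assoc, hp]
  have hpqq : p * q * q = p * q := by rw [mul_assoc, hq]
  have hzz : p * q * p * (p * q * p) = p * q * p := by
    rw [← mul_assoc, ← mul_assoc, hzp, hzq, hzp]
  rcases h (p * q * p) hzz (by rw [hzp, hpz]) (by rw [hzq, hqz]) with hz | hz
  · rw [hz] at hqpq hzz
    let z' : Module.End k V := 1 - (p + q - p * q - q * p)
    have hpz' : p * z' = 0 := by
      simp only [z', mul_sub, mul_add, ← mul_assoc, hp, hz, mul_one]
      abel
    have hqz' : q * z' = 0 := by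
      simp only [z', mul_sub, mul_add, ← mul_assoc, hq, hqpq, mul_one]
      abel
    have hzp' : z' * p = 0 := by
      simp only [z', sub_mul, add_mul, hp, hz, hqpp, one_mul]
      abel
    have hzq' : z' * q = 0 := by
      simp only [z', sub_mul, add_mul, hq, hqpq, hpqq, one_mul]
      abel
    have hzz' : z' * z' = z' := by
      conv_lhs => enter [1]; simp only [z']
      simp only [sub_mul, add_mul, mul_assoc, hpz', hqz', mul_zero, one_mul]
      abel
    rcases h z' hzz' (by rw [hzp', hpz']) (by rw [hzq', hqz']) with h0 | h0
    · have h1 : p + q - p * q - q * p = 1 := (sub_eq_zero.1 h0).symm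
      by_cases ha : p * q = 0
      · by_cases hb : q * p = 0
        · have hs : p + q = 1 := by rw [← h1, ha, hb, sub_zero, sub_zero]
          rcases h p hp rfl (by rw [ha, hb]) with h2 | h2
          · exact ⟨3, scalar 0 1 (by simp [h2]) (by simpa [h2] using hs)⟩
          · exact ⟨2, scalar 1 0 (by simp [h2]) (by simpa [h2] using hs)⟩
        · exact ⟨5, (hasForm_of_mul_ne_zero hq hp h.swap hqpq hz hb).swap⟩
      · exact ⟨4, hasForm_of_mul_ne_zero hp hq h hz hqpq ha⟩
    · refine ⟨1, scalar 0 0 ?_ ?_⟩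
      · rw [h0, mul_one] at hpz'
        rw [hpz', zero_smul]
      · rw [h0, mul_one] at hqz'
        rw [hqz', zero_smul]
  · refine ⟨0, scalar 1 1 ?_ ?_⟩
    · rw [hz, mul_one] at hpz
      rw [hpz, one_smul]
    · rw [hz, mul_one] at hqz
      rw [hqz, one_smul]

theorem HasForm.exists_equiv {W : Type} [AddCommGroup W] [Module k W] {m : ℕ}
    {P Q : Matrix (Fin m) (Fin m) k} {p q : Module.End k V} {p' q' : Module.End k W}
    (h : HasForm P Q p q) (h' : HasForm P Q p' q') :
    ∃ e : V ≃ₗ[k] W, (∀ x, e (p x) = p' (e x)) ∧ ∀ x, e (q x) = q' (e x) := by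
  obtain ⟨b, h1, h2⟩ := h
  obtain ⟨b', h1', h2'⟩ := h'
  have key : ∀ (p : Module.End k V) (p' : Module.End k W),
      LinearMap.toMatrix b b p = LinearMap.toMatrix b' b' p' →
      ∀ x, b.equiv b' (.refl _) (p x) = p' (b.equiv b' (.refl _) x) := fun p p' h x => by
    refine LinearMap.congr_fun (f := (b.equiv b' (.refl _)).toLinearMap.comp p)
      (g := p'.comp (b.equiv b' (.refl _)).toLinearMap) (b.ext fun i => b'.ext_elem fun j => ?_) x
    have := congrFun (congrFun h j) i
    rw [LinearMap.toMatrix_apply, LinearMap.toMatrix_apply] at this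
    simpa [Module.Basis.equiv] using this
  exact ⟨b.equiv b' (.refl _), key _ _ (h1.trans h1'.symm), key _ _ (h2.trans h2'.symm)⟩

theorem PairType.exists_equiv {W : Type} [AddCommGroup W] [Module k W] {p q : Module.End k V}
    {p' q' : Module.End k W} {i : Fin 6} (h : PairType p q i) (h' : PairType p' q' i) :
    ∃ e : V ≃ₗ[k] W, (∀ x, e (p x) = p' (e x)) ∧ ∀ x, e (q x) = q' (e x) := by
  fin_cases i <;> exact HasForm.exists_equiv h h'

end Classify

section SmallRank

variable {k : Type} [Field k] {r : ℕ} (X Y : FM k (HeckeA k r)ᵐᵒᵖ)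

/-- The action of `-T_{i+1}`, or zero if there is no such generator. -/
def genOp (i : ℕ) : Module.End k X :=
  if h : i + 2 ≤ r then
    -Module.toModuleEnd k X (S := (HeckeA k r)ᵐᵒᵖ) (op (TGen k r (⟨i, h⟩ : {i : ℕ // i + 2 ≤ r})))
  else 0

theorem genOp_apply (i : AGen r) (x : X) : genOp X i.1 x = -(op (TGen k r i) • x) := by
  rw [genOp, dif_pos i.2]
  rfl

theorem genOp_eq_zero {i : ℕ} (h : ¬ i + 2 ≤ r) : genOp X i = 0 := dif_neg h

theorem genOp_mul_self (i : ℕ) : genOp X i * genOp X i = genOp X i := by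
  by_cases h : i + 2 ≤ r
  · obtain ⟨j, rfl⟩ : ∃ j : AGen r, j.1 = i := ⟨⟨i, h⟩, rfl⟩
    ext x
    rw [Module.End.mul_apply, genOp_apply, genOp_apply, smul_neg, neg_neg, ← mul_smul, ← op_mul,
      TGen_sq, MulOpposite.op_neg, neg_smul]
  · rw [genOp_eq_zero X h, mul_zero]

theorem genOp_braid (i : ℕ) :
    genOp X i * genOp X (i + 1) * genOp X i = genOp X (i + 1) * genOp X i * genOp X (i + 1) := by
  by_cases h : i + 1 + 2 ≤ r
  · obtain ⟨j, rfl⟩ : ∃ j : AGen r, j.1 = i := ⟨⟨i, by omega⟩, rfl⟩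
    obtain ⟨l, hl⟩ : ∃ l : AGen r, l.1 = j.1 + 1 := ⟨⟨j.1 + 1, h⟩, rfl⟩
    rw [← hl]
    ext x
    simp only [Module.End.mul_apply, genOp_apply, smul_neg, neg_neg, ← mul_smul, ← op_mul,
      TGen_braid j l (Or.inl hl.symm)]
  · rw [genOp_eq_zero X h]; simp

theorem op_TGen_smul (i : AGen r) (x : X) : op (TGen k r i) • x = -genOp X i.1 x := by
  rw [genOp_apply, neg_neg]

variable {X Y}

/-- For `r ≤ 3`, a linear map commuting with the first two generators is `H`-linear. -/
def linOfGenOp (hr : r ≤ 3) (f : X →ₗ[k] Y) (h0 : ∀ x, f (genOp X 0 x) = genOp Y 0 (f x))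
    (h1 : ∀ x, f (genOp X 1 x) = genOp Y 1 (f x)) : X →ₗ[(HeckeA k r)ᵐᵒᵖ] Y :=
  linOfGen f fun i x => by
    rw [op_TGen_smul, op_TGen_smul, map_neg]
    have := i.2
    obtain h | h : i.1 = 0 ∨ i.1 = 1 := by omega
    · rw [h, h0]
    · rw [h, h1]

theorem indecPair_genOp (hr : r ≤ 3) (h : FM.Indec X) : IndecPair (genOp X 0) (genOp X 1) := by
  intro e he h0 h1
  let f : X →ₗ[(HeckeA k r)ᵐᵒᵖ] X :=
    linOfGenOp hr e (fun x => LinearMap.congr_fun h0 x) fun x => LinearMap.congr_fun h1 x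
  have hff : f.comp f = f := LinearMap.ext fun x => LinearMap.congr_fun he x
  rcases h.2 _ _ (LinearMap.IsIdempotentElem.isCompl hff) with h0 | h0
  · left
    exact LinearMap.ext fun x => LinearMap.congr_fun (LinearMap.range_eq_bot.1 h0) x
  · right
    exact LinearMap.ext fun x => LinearMap.ker_eq_bot.1 h0 (LinearMap.congr_fun hff x)

theorem representationFinite_schur0 {n : ℕ} {T : Equiv.Perm (Fin r) → HeckeA k r}
    (hT : IsHeckeBasis k r T) (hn : r ≤ n) (hr : r ≤ 3) :
    RepresentationFinite (Schur0 k n r T) := by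
  have := finite_schur0 (n := n) hT
  refine (schurCorner hT hn).representationFinite (fun i X => PairType (genOp X 0) (genOp X 1) i)
    (fun X hX => ?_) fun i X Y _ _ hX hY => ?_
  · have := hX.1
    exact exists_pairType (genOp_mul_self X 0) (genOp_mul_self X 1) (genOp_braid X 0)
      (indecPair_genOp hr hX)
  · obtain ⟨e, h0, h1⟩ := hX.exists_equiv hY
    exact FM.Iso.of_bijective (f := linOfGenOp hr e.toLinearMap h0 h1) e.bijective

end SmallRank
end ZeroHecke

/-- For `n ≥ 3`, the 0-Schur algebra `S_0(n,r)` is τ-tilting finite iff it is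
representation-finite. -/
theorem statement7 (k : Type) [Field k] [IsAlgClosed k]
    (n r : ℕ) (hn : 3 ≤ n) (T : Equiv.Perm (Fin r) → HeckeA k r)
    (hT : IsHeckeBasis k r T) :
    TauTiltingFinite k (Schur0 k n r T) ↔ RepresentationFinite (Schur0 k n r T) := by
  have := ZeroHecke.finite_schur0 (n := n) hT
  refine ⟨fun h => ?_, FM.tauTiltingFinite_of_representationFinite⟩
  by_cases hr : 4 ≤ r
  · exact absurd h (ZeroHecke.not_tauTiltingFinite_schur0 hn hr hT)
  · exact ZeroHecke.representationFinite_schur0 hT (by omega) (by omega)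

end
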